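/- arXiv:2105.09769 — 4 statements merged into one kernel-verified Lean document; each statement's English description precedes it below -/
import Mathlib

section
/- Let U, V be open neighborhoods of 0 in ℝⁿ and let φ : U → V be a homeomorphism with φ(0) = 0 which is a blow-spherical homeomorphism, so that for every v ∈ S^{n−1} the limit ν_φ(v) := lim_{t→0⁺} φ(tv)/‖φ(tv)‖ exists and the map (x,r) ↦ (φ(rx)/‖φ(rx)‖, ‖φ(rx)‖) extends to a homeomorphism of the corresponding strict transforms. Suppose moreover that φ is image arc-analytic: for every real analytic map α : (−1,1) → U there exist ε ∈ (0,1] and a real analytic map g : (−ε, ε) → ℝⁿ with g(0) = φ(α(0)) such that the germs at φ(α(0)) of the images of g and of φ∘α coincide (they agree inside some neighborhood of φ(α(0))). Then ν_φ(−v) = −ν_φ(v) for every v ∈ S^{n−1}. -/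
open Filter Set Topology

/-- The point of the spherical blow-up corresponding to `x ≠ 0`: `(x/‖x‖, ‖x‖)`. -/
noncomputable def sphBlowup {E : Type*} [NormedAddCommGroup E] [NormedSpace ℝ E]
    (x : E) : E × ℝ :=
  (‖x‖⁻¹ • x, ‖x‖)

/-- The strict transform `X′` of `X` under the spherical blow-up at the origin:
the closure of `β⁻¹(X \ {0})`. -/
def strictTransform {E : Type*} [NormedAddCommGroup E] [NormedSpace ℝ E]
    (X : Set E) : Set (E × ℝ) :=
  closure (sphBlowup '' (X \ {0}))

/-- The boundary `∂X′ = X′ ∩ (S^{n-1} × {0})` of the strict transform. -/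
def boundaryTransform {E : Type*} [NormedAddCommGroup E] [NormedSpace ℝ E]
    (X : Set E) : Set (E × ℝ) :=
  strictTransform X ∩ {p | p.2 = 0}

/-- `φ : (X,0) → (Y,0)` is a blow-spherical homeomorphism: a homeomorphism of `X`
onto `Y` fixing `0` such that `(x,r) ↦ (φ(rx)/‖φ(rx)‖, ‖φ(rx)‖)` extends to a
homeomorphism of the strict transforms. -/
def IsBlowSphericalHomeo {E F : Type*} [NormedAddCommGroup E] [NormedSpace ℝ E]
    [NormedAddCommGroup F] [NormedSpace ℝ F] (X : Set E) (Y : Set F) (φ : E → F) : Prop :=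
  φ 0 = 0 ∧ Set.BijOn φ X Y ∧ ContinuousOn φ X ∧
    (∃ ψ : F → E, Set.InvOn ψ φ X Y ∧ ContinuousOn ψ Y) ∧
    ∃ Φ : E × ℝ → F × ℝ,
      Set.BijOn Φ (strictTransform X) (strictTransform Y) ∧
      ContinuousOn Φ (strictTransform X) ∧
      (∃ Ψ : F × ℝ → E × ℝ, Set.InvOn Ψ Φ (strictTransform X) (strictTransform Y) ∧
        ContinuousOn Ψ (strictTransform Y)) ∧
      ∀ x ∈ X \ {0}, Φ (sphBlowup x) = sphBlowup (φ x)

lemma aux_mem_strict {E : Type*} [NormedAddCommGroup E] [NormedSpace ℝ E] {X : Set E} {x : E}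
    (hx : x ∈ X) (h0 : x ≠ 0) : sphBlowup x ∈ strictTransform X :=
  subset_closure ⟨x, ⟨hx, h0⟩, rfl⟩

lemma aux_blow_ray {E : Type*} [NormedAddCommGroup E] [NormedSpace ℝ E] {ξ : E} (hξ : ‖ξ‖ = 1) :
    Tendsto (fun t : ℝ => sphBlowup (t • ξ)) (𝓝[>] 0) (𝓝 (ξ, 0)) := by
  have h1 : Tendsto (fun t : ℝ => (ξ, t)) (𝓝[>] 0) (𝓝 (ξ, 0)) := by
    apply Tendsto.mono_left _ nhdsWithin_le_nhds
    exact (Continuous.tendsto (by fun_prop) (0 : ℝ))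
  refine h1.congr' ?_
  filter_upwards [self_mem_nhdsWithin] with t ht
  have ht : 0 < t := ht
  have : ‖t • ξ‖ = t := by rw [norm_smul, hξ, mul_one, Real.norm_of_nonneg ht.le]
  simp only [sphBlowup, this, smul_smul, inv_mul_cancel₀ ht.ne', one_smul]

lemma aux_ray_mem {E : Type*} [NormedAddCommGroup E] [NormedSpace ℝ E] {X : Set E}
    (hX : IsOpen X) (h0 : (0 : E) ∈ X) {ξ : E} (hξ : ‖ξ‖ = 1) :
    ∀ᶠ t : ℝ in 𝓝[>] 0, t • ξ ∈ X \ {0} := by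
  have h1 : ∀ᶠ t : ℝ in 𝓝 0, t • ξ ∈ X := by
    have : Tendsto (fun t : ℝ => t • ξ) (𝓝 0) (𝓝 ((0 : ℝ) • ξ)) :=
      Continuous.tendsto (by fun_prop) (0 : ℝ)
    rw [zero_smul] at this
    exact this (hX.mem_nhds h0)
  filter_upwards [nhdsWithin_le_nhds h1, self_mem_nhdsWithin] with t ht ht'
  refine ⟨ht, ?_⟩
  have ht' : 0 < t := ht'
  have : ξ ≠ 0 := by rintro rfl; simp at hξ
  simp [ht'.ne', this]

lemma aux_bdry_mem {E : Type*} [NormedAddCommGroup E] [NormedSpace ℝ E] {X : Set E}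
    (hX : IsOpen X) (h0 : (0 : E) ∈ X) {ξ : E} (hξ : ‖ξ‖ = 1) :
    (ξ, (0 : ℝ)) ∈ strictTransform X := by
  refine mem_closure_of_tendsto (aux_blow_ray hξ) ?_
  filter_upwards [aux_ray_mem hX h0 hξ] with t ht
  exact ⟨_, ht, rfl⟩

lemma aux_dir_limit {E : Type*} [NormedAddCommGroup E] [NormedSpace ℝ E] (g : ℝ → E) (t₀ : ℝ)
    (hg : AnalyticAt ℝ g t₀) (hnz : ¬ ∀ᶠ z in 𝓝 t₀, g z = 0) :
    ∃ (u : E) (s : ℝ), (s = 1 ∨ s = -1 ∧ g t₀ = 0) ∧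
      Tendsto (fun t => sphBlowup (g t)) (𝓝[>] t₀) (𝓝 (u, ‖g t₀‖)) ∧
      Tendsto (fun t => sphBlowup (g t)) (𝓝[<] t₀) (𝓝 (s • u, ‖g t₀‖)) ∧
      ∀ᶠ z in 𝓝[≠] t₀, g z ≠ 0 := by
  obtain ⟨m, h, hh, hh0, hgh⟩ := hg.exists_eventuallyEq_pow_smul_nonzero_iff.2 hnz
  have hc : Tendsto (fun t => ‖h t‖⁻¹ • h t) (𝓝 t₀) (𝓝 (‖h t₀‖⁻¹ • h t₀)) :=
    ((hh.continuousAt.norm).inv₀ (norm_ne_zero_iff.2 hh0)).smul hh.continuousAt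
  have hgn : Tendsto (fun t => ‖g t‖) (𝓝 t₀) (𝓝 ‖g t₀‖) := hg.continuousAt.norm
  have hm : m = 0 ∨ g t₀ = 0 := by
    rcases Nat.eq_zero_or_pos m with h | h
    · exact Or.inl h
    · right
      rw [hgh.self_of_nhds]; simp [h.ne']
  refine ⟨‖h t₀‖⁻¹ • h t₀, (-1) ^ m, ?_, ?_, ?_, ?_⟩
  · rcases hm with rfl | h0
    · simp
    · rcases neg_one_pow_eq_or ℝ m with h1 | h1
      · exact Or.inl h1
      · exact Or.inr ⟨h1, h0⟩
  · refine Tendsto.prodMk_nhds ?_ (hgn.mono_left nhdsWithin_le_nhds)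
    refine (hc.mono_left nhdsWithin_le_nhds).congr' ?_
    filter_upwards [nhdsWithin_le_nhds hgh, self_mem_nhdsWithin] with t ht ht'
    have hp : 0 < t - t₀ := sub_pos.2 ht'
    have hp' : 0 < (t - t₀) ^ m := pow_pos hp m
    rw [ht, norm_smul, Real.norm_of_nonneg hp'.le, smul_smul, mul_inv, mul_right_comm,
      inv_mul_cancel₀ hp'.ne', one_mul]
  · refine Tendsto.prodMk_nhds ?_ (hgn.mono_left nhdsWithin_le_nhds)
    refine ((hc.const_smul ((-1 : ℝ) ^ m)).mono_left nhdsWithin_le_nhds).congr' ?_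
    filter_upwards [nhdsWithin_le_nhds hgh, self_mem_nhdsWithin] with t ht ht'
    have hp : 0 < t₀ - t := sub_pos.2 ht'
    have hp' : 0 < (t₀ - t) ^ m := pow_pos hp m
    have e : (t - t₀) ^ m = (-1) ^ m * (t₀ - t) ^ m := by rw [← mul_pow]; congr 1; ring
    have e2 : ‖(-1 : ℝ) ^ m * (t₀ - t) ^ m‖ = (t₀ - t) ^ m := by
      rw [norm_mul, norm_pow, norm_neg, norm_one, one_pow, one_mul, Real.norm_of_nonneg hp'.le]
    rw [ht, e, norm_smul, e2, smul_smul, smul_smul]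
    congr 1
    field_simp
  · have h1 : ∀ᶠ z in 𝓝 t₀, h z ≠ 0 := hh.continuousAt.eventually_ne hh0
    filter_upwards [nhdsWithin_le_nhds hgh, nhdsWithin_le_nhds h1, self_mem_nhdsWithin]
      with t ht ht1 ht2
    rw [ht]
    exact smul_ne_zero (pow_ne_zero _ (sub_ne_zero.2 ht2)) ht1

lemma aux_lift {E : Type*} [NormedAddCommGroup E] [NormedSpace ℝ E] {U V : Set E}
    {φ ψ : E → E} {Φ Ψ : E × ℝ → E × ℝ} (hφ0 : φ 0 = 0) (h0U : (0 : E) ∈ U)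
    (hb : BijOn φ U V) (hinv : InvOn ψ φ U V)
    (hInv : InvOn Ψ Φ (strictTransform U) (strictTransform V))
    (hΨ : ContinuousOn Ψ (strictTransform V))
    (hΦφ : ∀ x ∈ U \ {0}, Φ (sphBlowup x) = sphBlowup (φ x))
    {g : ℝ → E} {l : Filter ℝ} [l.NeBot] {p : E × ℝ}
    (hl : Tendsto (fun t => sphBlowup (g t)) l (𝓝 p)) (hg : ∀ᶠ t in l, g t ∈ V \ {0}) :
    Tendsto (fun t => sphBlowup (ψ (g t))) l (𝓝 (Ψ p)) ∧ Φ (Ψ p) = p := by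
  have hp : p ∈ strictTransform V := by
    refine mem_closure_of_tendsto hl ?_
    filter_upwards [hg] with t ht
    exact ⟨_, ht, rfl⟩
  refine ⟨?_, hInv.2 hp⟩
  have h1 : Tendsto (fun t => sphBlowup (g t)) l (𝓝[strictTransform V] p) := by
    refine tendsto_nhdsWithin_iff.2 ⟨hl, ?_⟩
    filter_upwards [hg] with t ht
    exact aux_mem_strict ht.1 ht.2
  refine ((hΨ p hp).tendsto.comp h1).congr' ?_
  filter_upwards [hg] with t ht
  have hx : ψ (g t) ∈ U := by
    obtain ⟨y, hy, hyt⟩ := hb.surjOn ht.1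
    rw [← hyt, hinv.1 hy]; exact hy
  have hx0 : ψ (g t) ≠ 0 := by
    intro h
    have := hinv.2 ht.1
    rw [h, hφ0] at this
    exact ht.2 this.symm
  have h2 := hΦφ _ ⟨hx, hx0⟩
  rw [hinv.2 ht.1] at h2
  simp only [Function.comp]
  rw [← h2, hInv.1 (aux_mem_strict hx hx0)]

lemma aux_nu {E : Type*} [NormedAddCommGroup E] [NormedSpace ℝ E] {U V : Set E}
    (hU : IsOpen U) (h0U : (0 : E) ∈ U)
    {φ : E → E} {Φ : E × ℝ → E × ℝ} (hφ0 : φ 0 = 0) 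
    (hφ : ContinuousOn φ U)
    (hΦ : ContinuousOn Φ (strictTransform U))
    (hΦφ : ∀ x ∈ U \ {0}, Φ (sphBlowup x) = sphBlowup (φ x))
    (ν : E → E)
    (hν : ∀ v : E, ‖v‖ = 1 →
      Tendsto (fun t : ℝ => ‖φ (t • v)‖⁻¹ • φ (t • v)) (𝓝[>] 0) (𝓝 (ν v))) {ξ : E}
    (hξ : ‖ξ‖ = 1) : Φ (ξ, 0) = (ν ξ, 0) := by
  have hm := aux_bdry_mem hU h0U hξ
  have h1 : Tendsto (fun t : ℝ => sphBlowup (t • ξ)) (𝓝[>] 0) (𝓝[strictTransform U] (ξ, 0)) := by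
    refine tendsto_nhdsWithin_iff.2 ⟨aux_blow_ray hξ, ?_⟩
    filter_upwards [aux_ray_mem hU h0U hξ] with t ht
    exact aux_mem_strict ht.1 ht.2
  have h2 := (hΦ _ hm).tendsto.comp h1
  have h3 : Tendsto (fun t : ℝ => sphBlowup (φ (t • ξ))) (𝓝[>] 0) (𝓝 (ν ξ, 0)) := by
    refine Tendsto.prodMk_nhds (hν ξ hξ) ?_
    have h4 : Tendsto (fun t : ℝ => t • ξ) (𝓝 0) (𝓝 ((0 : ℝ) • ξ)) :=
      Continuous.tendsto (by fun_prop) (0 : ℝ)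
    rw [zero_smul] at h4
    have h5 := ((hφ.continuousAt (hU.mem_nhds h0U)).tendsto.comp h4).norm
    rw [hφ0, norm_zero] at h5
    exact h5.mono_left nhdsWithin_le_nhds
  refine tendsto_nhds_unique (h2.congr' ?_) h3
  filter_upwards [aux_ray_mem hU h0U hξ] with t ht
  exact hΦφ _ ht

noncomputable def auxR (c τ : ℝ) : ℝ := c * ((1 - τ) * Real.sin (Real.pi / (1 - τ)))

noncomputable def auxT (y : ℝ) : ℝ := 1 - 1 / y

noncomputable def auxArc {E : Type*} [NormedAddCommGroup E] [NormedSpace ℝ E] (c η : ℝ) (v w : E)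
    (τ : ℝ) : E := auxR c τ • (v + (η * τ) • w)

lemma auxT_lt {y τ : ℝ} (hy : 0 < y) (hτ : τ < 1) : auxT y < τ ↔ y < 1 / (1 - τ) := by
  unfold auxT
  have h : 0 < 1 - τ := by linarith
  rw [lt_div_iff₀ h, sub_lt_comm, lt_div_iff₀ hy, mul_comm]

lemma lt_auxT {y τ : ℝ} (hy : 0 < y) (hτ : τ < 1) : τ < auxT y ↔ 1 / (1 - τ) < y := by
  unfold auxT
  have h : 0 < 1 - τ := by linarith
  rw [div_lt_iff₀ h, lt_sub_comm, div_lt_iff₀ hy, mul_comm]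

lemma auxT_lt_one {y : ℝ} (hy : 0 < y) : auxT y < 1 := by
  unfold auxT; have : 0 < 1 / y := by positivity
  linarith

lemma auxT_mono {x y : ℝ} (hx : 0 < x) (hxy : x < y) : auxT x < auxT y := by
  unfold auxT
  have := one_div_lt_one_div_of_lt hx hxy
  linarith

lemma auxR_T {c y : ℝ} (hy : 0 < y) : auxR c (auxT y) = c * (1 / y * Real.sin (Real.pi * y)) := by
  unfold auxR auxT
  simp

lemma aux_sin_shift (m : ℕ) (y : ℝ) :
    Real.sin (Real.pi * y) = Real.sin (Real.pi * (y - 2 * m)) := by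
  rw [← Real.sin_sub_nat_mul_two_pi _ m]; congr 1; ring

lemma aux_sin_pos (m : ℕ) {y : ℝ} (h1 : 2 * (m : ℝ) - 1 < y) (h2 : y < 2 * m + 2)
    (h : 0 < Real.sin (Real.pi * y)) : 2 * (m : ℝ) < y ∧ y < 2 * m + 1 := by
  have hpi := Real.pi_pos
  rw [aux_sin_shift m] at h
  constructor
  · by_contra hc
    push Not at hc
    have := Real.sin_nonpos_of_nonpos_of_neg_pi_le (x := Real.pi * (y - 2 * m))
      (by nlinarith) (by nlinarith)
    linarith
  · by_contra hc
    push Not at hc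
    have := Real.sin_nonneg_of_nonneg_of_le_pi (x := Real.pi * (y - 2 * m) - Real.pi)
      (by nlinarith) (by nlinarith)
    rw [Real.sin_sub_pi] at this
    linarith

lemma aux_sin_nonneg (m : ℕ) {y : ℝ} (h1 : 2 * (m : ℝ) ≤ y) (h2 : y ≤ 2 * m + 1) :
    0 ≤ Real.sin (Real.pi * y) := by
  have hpi := Real.pi_pos
  rw [aux_sin_shift m]
  exact Real.sin_nonneg_of_nonneg_of_le_pi (by nlinarith) (by nlinarith)

lemma auxR_mid {c : ℝ} (hc : 0 < c) (m : ℕ) : 0 < auxR c (auxT (2 * m + 1 / 2)) := by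
  rw [auxR_T (by positivity), aux_sin_shift m]
  have : Real.pi * (2 * (m : ℝ) + 1 / 2 - 2 * m) = Real.pi / 2 := by ring
  rw [this, Real.sin_pi_div_two]
  positivity

lemma auxR_pos {c τ : ℝ} (hc : 0 < c) {m : ℕ} (hm : 1 ≤ m) (hτ : τ < 1)
    (h1 : auxT (2 * m - 1) < τ) (h2 : τ < auxT (2 * m + 2)) (h : 0 < auxR c τ) :
    auxT (2 * m) < τ ∧ τ < auxT (2 * m + 1) := by
  have hm' : (1 : ℝ) ≤ m := by exact_mod_cast hm
  have hτ' : 0 < 1 - τ := by linarith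
  rw [auxT_lt (by linarith) hτ] at h1 ⊢
  rw [lt_auxT (by linarith) hτ] at h2 ⊢
  unfold auxR at h
  have h3 := (pos_iff_pos_of_mul_pos h).1 hc
  have h4 := (pos_iff_pos_of_mul_pos h3).1 hτ'
  rw [div_eq_mul_one_div] at h4
  exact aux_sin_pos m h1 h2 h4

lemma auxR_nonneg {c τ : ℝ} (hc : 0 < c) {m : ℕ} (hm : 1 ≤ m) (hτ : τ < 1)
    (h1 : auxT (2 * m) ≤ τ) (h2 : τ ≤ auxT (2 * m + 1)) : 0 ≤ auxR c τ := by
  have hm' : (1 : ℝ) ≤ m := by exact_mod_cast hm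
  have hτ' : 0 < 1 - τ := by linarith
  rw [← not_lt, lt_auxT (by linarith) hτ, not_lt] at h1
  rw [← not_lt, auxT_lt (by linarith) hτ, not_lt] at h2
  unfold auxR
  have := aux_sin_nonneg m h1 h2
  rw [← div_eq_mul_one_div] at this
  positivity

lemma auxR_abs {c τ : ℝ} (hc : 0 < c) (hτ : τ < 1) : |auxR c τ| ≤ c * (1 - τ) := by
  have hτ' : 0 < 1 - τ := by linarith
  unfold auxR
  rw [abs_mul, abs_mul, abs_of_pos hc, abs_of_pos hτ']
  have := Real.abs_sin_le_one (Real.pi / (1 - τ))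
  have : (1 - τ) * |Real.sin (Real.pi / (1 - τ))| ≤ (1 - τ) * 1 := by gcongr
  nlinarith

section
variable {E : Type*} [NormedAddCommGroup E] [InnerProductSpace ℝ E]

lemma auxArc_analytic (c η : ℝ) (v w : E) : AnalyticOnNhd ℝ (auxArc c η v w) (Ioo (-1) 1) := by
  intro τ hτ
  have h : 1 - τ ≠ 0 := by linarith [hτ.2]
  unfold auxArc auxR
  have h1 : AnalyticAt ℝ (fun τ : ℝ => Real.pi / (1 - τ)) τ :=
    analyticAt_const.div (analyticAt_const.sub analyticAt_id) h
  have h2 : AnalyticAt ℝ (fun τ : ℝ => Real.sin (Real.pi / (1 - τ))) τ :=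
    Real.analyticAt_sin.comp' h1
  have h3 : AnalyticAt ℝ (fun τ : ℝ => c * ((1 - τ) * Real.sin (Real.pi / (1 - τ)))) τ :=
    analyticAt_const.mul ((analyticAt_const.sub analyticAt_id).mul h2)
  exact h3.smul (analyticAt_const.add ((analyticAt_const.mul analyticAt_id).smul analyticAt_const))

lemma auxArc_norm {c η τ : ℝ} {v w : E} (hc : 0 < c) (hη : 0 < η) (hη' : η ≤ 1 / 4)
    (hv : ‖v‖ = 1) (hw : ‖w‖ = 1) (hτ : τ ∈ Ioo (-1 : ℝ) 1) :
    ‖auxArc c η v w τ‖ ≤ 2 * c * (1 - τ) := by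
  unfold auxArc
  rw [norm_smul, Real.norm_eq_abs]
  have h1 := auxR_abs hc hτ.2
  have h3 : |τ| < 1 := abs_lt.2 hτ
  have h2 : ‖v + (η * τ) • w‖ ≤ 2 := by
    refine (norm_add_le _ _).trans ?_
    rw [norm_smul, hv, hw, Real.norm_eq_abs, abs_mul, abs_of_pos hη]
    nlinarith [abs_nonneg τ]
  have h4 : 0 ≤ c * (1 - τ) := (abs_nonneg _).trans h1
  calc _ ≤ c * (1 - τ) * 2 := by gcongr
    _ = _ := by ring

lemma auxArc_v {c η τ : ℝ} {v w : E} (hv : ‖v‖ = 1) (hvw : inner ℝ v w = 0) :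
    inner ℝ v (auxArc c η v w τ) = auxR c τ := by
  unfold auxArc
  rw [inner_smul_right, inner_add_right, inner_smul_right, hvw, real_inner_self_eq_norm_sq, hv]
  ring

lemma auxArc_w {c η τ : ℝ} {v w : E} (hw : ‖w‖ = 1) (hvw : inner ℝ v w = 0) :
    inner ℝ w (auxArc c η v w τ) = auxR c τ * (η * τ) := by
  unfold auxArc
  rw [inner_smul_right, inner_add_right, inner_smul_right, real_inner_comm, hvw,
    real_inner_self_eq_norm_sq, hw]
  ring

lemma auxArc_near {c η τ : ℝ} {v w : E} (hη : 0 < η) (hη' : η ≤ 1 / 4)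
    (hv : ‖v‖ = 1) (hw : ‖w‖ = 1) (hτ : τ ∈ Ioo (-1 : ℝ) 1) (hne : auxArc c η v w τ ≠ 0) :
    ‖(sphBlowup (auxArc c η v w τ)).1‖ = 1 ∧
      (‖(sphBlowup (auxArc c η v w τ)).1 - v‖ ≤ 2 * η ∨
        ‖(sphBlowup (auxArc c η v w τ)).1 + v‖ ≤ 2 * η) := by
  refine ⟨by simp [sphBlowup, norm_smul, hne], ?_⟩
  have hr : auxR c τ ≠ 0 := by
    intro h; apply hne; unfold auxArc; rw [h, zero_smul]
  set d := v + (η * τ) • w with hd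
  have h3 : |τ| < 1 := abs_lt.2 hτ
  have hdv : ‖d - v‖ ≤ η := by
    rw [hd, add_sub_cancel_left, norm_smul, hw, Real.norm_eq_abs, abs_mul, abs_of_pos hη]
    nlinarith [abs_nonneg τ]
  have hd1 : |‖d‖ - 1| ≤ η := by
    rw [← hv]; exact (abs_norm_sub_norm_le _ _).trans hdv
  have hd0 : 0 < ‖d‖ := by have := (abs_le.1 hd1).1; linarith
  have hdd : ‖‖d‖⁻¹ • d - d‖ = |‖d‖ - 1| := by
    have : ‖d‖⁻¹ • d - d = (‖d‖⁻¹ - 1) • d := by rw [sub_smul, one_smul]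
    rw [this, norm_smul, Real.norm_eq_abs]
    nth_rewrite 2 [← abs_of_pos hd0]
    rw [← abs_mul, sub_mul, inv_mul_cancel₀ hd0.ne', one_mul, abs_sub_comm]
  have key : ‖‖d‖⁻¹ • d - v‖ ≤ 2 * η := by
    have : ‖d‖⁻¹ • d - v = (‖d‖⁻¹ • d - d) + (d - v) := by abel
    rw [this]
    refine (norm_add_le _ _).trans ?_
    rw [hdd]; linarith
  have e : (sphBlowup (auxArc c η v w τ)).1 = (|auxR c τ|⁻¹ * auxR c τ) • (‖d‖⁻¹ • d) := by
    simp only [sphBlowup, auxArc, ← hd, norm_smul, Real.norm_eq_abs, smul_smul]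
    congr 1
    rw [mul_inv]; ring
  rw [e]
  rcases lt_or_gt_of_ne hr with h | h
  · right
    rw [abs_of_neg h, inv_neg, neg_mul, inv_mul_cancel₀ hr, neg_smul, one_smul,
      neg_add_eq_sub, norm_sub_rev]
    exact key
  · left
    rw [abs_of_pos h, inv_mul_cancel₀ hr, one_smul]
    exact key

lemma aux_near_inner {η : ℝ} {v ξ : E} (hη' : η ≤ 1 / 4)
    (hv : ‖v‖ = 1) (h : ‖ξ - v‖ ≤ 2 * η ∨ ‖ξ + v‖ ≤ 2 * η) : inner ℝ v ξ ≠ 0 := by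
  intro h0
  rcases h with h | h
  · have h1 := abs_real_inner_le_norm v (ξ - v)
    rw [inner_sub_right, h0, real_inner_self_eq_norm_sq, hv] at h1
    norm_num at h1
    linarith
  · have h1 := abs_real_inner_le_norm v (ξ + v)
    rw [inner_add_right, h0, real_inner_self_eq_norm_sq, hv] at h1
    norm_num at h1
    linarith

lemma aux_pair {ν : E → E} (hν : ContinuousOn ν {ξ | ‖ξ‖ = 1}) {p q : E} (hp : ‖p‖ = 1)
    (hq : ‖q‖ = 1) (hpq : ν p + ν q ≠ 0) :
    ∃ δ > 0, ∀ ξ ξ' : E, ‖ξ‖ = 1 → ‖ξ'‖ = 1 → ‖ξ - p‖ < δ → ‖ξ' - q‖ < δ →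
      ν ξ + ν ξ' ≠ 0 := by
  have hpos : 0 < ‖ν p + ν q‖ / 2 := by have := norm_pos_iff.2 hpq; positivity
  obtain ⟨δ₁, h1, H1⟩ := Metric.continuousOn_iff.1 hν p hp _ hpos
  obtain ⟨δ₂, h2, H2⟩ := Metric.continuousOn_iff.1 hν q hq _ hpos
  refine ⟨min δ₁ δ₂, lt_min h1 h2, ?_⟩
  intro ξ ξ' hξ hξ' hd hd' h0
  have a := H1 ξ hξ (by rw [dist_eq_norm]; exact hd.trans_le (min_le_left _ _))
  have b := H2 ξ' hξ' (by rw [dist_eq_norm]; exact hd'.trans_le (min_le_right _ _))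
  rw [dist_eq_norm, norm_sub_rev] at a b
  have : ν p + ν q = (ν p - ν ξ) + (ν q - ν ξ') + (ν ξ + ν ξ') := by abel
  rw [h0, add_zero] at this
  have h3 := norm_add_le (ν p - ν ξ) (ν q - ν ξ')
  rw [← this] at h3
  linarith

end

section
variable {E : Type*} [NormedAddCommGroup E] [InnerProductSpace ℝ E]

lemma aux_Q_open (v w : E) (A B : ℝ) : IsOpen {ξ : E | 0 < inner ℝ v ξ ∧
    A * inner ℝ v ξ < inner ℝ w ξ ∧ inner ℝ w ξ < B * inner ℝ v ξ} := by
  have h1 : IsOpen {ξ : E | 0 < inner ℝ v ξ} := isOpen_lt (by fun_prop) (by fun_prop)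
  have h2 : IsOpen {ξ : E | A * inner ℝ v ξ < inner ℝ w ξ} :=
    isOpen_lt (by fun_prop) (by fun_prop)
  have h3 : IsOpen {ξ : E | inner ℝ w ξ < B * inner ℝ v ξ} :=
    isOpen_lt (by fun_prop) (by fun_prop)
  exact h1.inter (h2.inter h3)

lemma aux_K_closed (v w : E) (A B : ℝ) : IsClosed {ξ : E | 0 ≤ inner ℝ v ξ ∧
    A * inner ℝ v ξ ≤ inner ℝ w ξ ∧ inner ℝ w ξ ≤ B * inner ℝ v ξ} := by
  have h1 : IsClosed {ξ : E | 0 ≤ inner ℝ v ξ} := isClosed_le (by fun_prop) (by fun_prop)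
  have h2 : IsClosed {ξ : E | A * inner ℝ v ξ ≤ inner ℝ w ξ} :=
    isClosed_le (by fun_prop) (by fun_prop)
  have h3 : IsClosed {ξ : E | inner ℝ w ξ ≤ B * inner ℝ v ξ} :=
    isClosed_le (by fun_prop) (by fun_prop)
  exact h1.inter (h2.inter h3)

lemma aux_D_closed (v : E) (A : ℝ) :
    IsClosed {ξ : E | ‖ξ‖ = 1 ∧ (‖ξ - v‖ ≤ A ∨ ‖ξ + v‖ ≤ A)} := by
  have h1 : IsClosed {ξ : E | ‖ξ‖ = 1} := isClosed_eq (by fun_prop) (by fun_prop)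
  have h2 : IsClosed {ξ : E | ‖ξ - v‖ ≤ A} := isClosed_le (by fun_prop) (by fun_prop)
  have h3 : IsClosed {ξ : E | ‖ξ + v‖ ≤ A} := isClosed_le (by fun_prop) (by fun_prop)
  exact h1.inter (h2.union h3)

set_option maxHeartbeats 2000000 in
lemma aux_core (U V : Set E) (hU : IsOpen U) (hV : IsOpen V)
    (h0U : (0 : E) ∈ U) (h0V : (0 : E) ∈ V) (φ ψ : E → E) (Φ Ψ : E × ℝ → E × ℝ)
    (hφ0 : φ 0 = 0) (hb : BijOn φ U V) (hφ : ContinuousOn φ U) (hinv : InvOn ψ φ U V)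
    (hψ : ContinuousOn ψ V)
    (hInv : InvOn Ψ Φ (strictTransform U) (strictTransform V))
    (hΨ : ContinuousOn Ψ (strictTransform V))
    (hΦφ : ∀ x ∈ U \ {0}, Φ (sphBlowup x) = sphBlowup (φ x))
    (harc : ∀ α : ℝ → E,
      AnalyticOnNhd ℝ α (Set.Ioo (-1 : ℝ) 1) → (∀ t ∈ Set.Ioo (-1 : ℝ) 1, α t ∈ U) →
      ∃ ε : ℝ, 0 < ε ∧ ε ≤ 1 ∧ ∃ g : ℝ → E,
        AnalyticOnNhd ℝ g (Set.Ioo (-ε) ε) ∧ g 0 = φ (α 0) ∧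
        ∃ W ∈ 𝓝 (φ (α 0)),
          (g '' Set.Ioo (-ε) ε) ∩ W = ((φ ∘ α) '' Set.Ioo (-1 : ℝ) 1) ∩ W)
    (ν : E → E) (hνΦ : ∀ ξ : E, ‖ξ‖ = 1 → Φ (ξ, 0) = (ν ξ, 0))
    (v w : E) (hv : ‖v‖ = 1) (hw : ‖w‖ = 1) (hvw : inner ℝ v w = 0)
    (η : ℝ) (hη : 0 < η) (hη' : η ≤ 1 / 4)
    (hsep : ∀ ξ ξ' : E, ‖ξ‖ = 1 → ‖ξ'‖ = 1 → (‖ξ - v‖ ≤ 2 * η ∨ ‖ξ + v‖ ≤ 2 * η) →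
      (‖ξ' - v‖ ≤ 2 * η ∨ ‖ξ' + v‖ ≤ 2 * η) → ν ξ + ν ξ' ≠ 0) : False := by
  have hψ0 : ψ 0 = 0 := by have := hinv.1 h0U; rwa [hφ0] at this
  -- the arc
  obtain ⟨r₀, hr₀, hball⟩ := Metric.isOpen_iff.1 hU 0 h0U
  obtain ⟨c, hc, hcr⟩ : ∃ c : ℝ, 0 < c ∧ 4 * c < r₀ := ⟨r₀ / 5, by positivity, by linarith⟩
  set α : ℝ → E := auxArc c η v w with hα
  have hαan : AnalyticOnNhd ℝ α (Ioo (-1) 1) := auxArc_analytic c η v w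
  have hαn : ∀ τ ∈ Ioo (-1 : ℝ) 1, ‖α τ‖ ≤ 2 * c * (1 - τ) := fun τ hτ =>
    auxArc_norm hc hη hη' hv hw hτ
  have hαU : ∀ τ ∈ Ioo (-1 : ℝ) 1, α τ ∈ U := by
    intro τ hτ
    apply hball
    rw [mem_ball_zero_iff]
    have := hαn τ hτ
    nlinarith [hτ.1]
  have hα0 : α 0 = 0 := by simp [hα, auxArc, auxR]
  obtain ⟨ε, hε, -, g, hg, hg0, W₀, hW₀, hW⟩ := harc α hαan hαU
  rw [hα0, hφ0] at hg0 hW₀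
  obtain ⟨W, hWW₀, hWo, h0W⟩ := mem_nhds_iff.1 hW₀
  have hgφ : ∀ t ∈ Ioo (-ε) ε, g t ∈ W → ∃ τ ∈ Ioo (-1 : ℝ) 1, φ (α τ) = g t := by
    intro t ht htW
    have : g t ∈ (φ ∘ α) '' Ioo (-1 : ℝ) 1 ∩ W₀ := by
      rw [← hW]; exact ⟨⟨t, ht, rfl⟩, hWW₀ htW⟩
    exact this.1
  have hφg : ∀ τ ∈ Ioo (-1 : ℝ) 1, φ (α τ) ∈ W → ∃ t ∈ Ioo (-ε) ε, g t = φ (α τ) := by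
    intro τ hτ htW
    have : φ (α τ) ∈ g '' Ioo (-ε) ε ∩ W₀ := by
      rw [hW]; exact ⟨⟨τ, hτ, rfl⟩, hWW₀ htW⟩
    exact this.1
  -- choose a small petal
  have hφc0 : ContinuousAt φ 0 := hφ.continuousAt (hU.mem_nhds h0U)
  have hαlim : Tendsto α (𝓝[<] 1) (𝓝 0) := by
    have h1 : Tendsto (fun τ : ℝ => 2 * c * (1 - τ)) (𝓝[<] 1) (𝓝 0) := by
      have : Tendsto (fun τ : ℝ => 2 * c * (1 - τ)) (𝓝 1) (𝓝 (2 * c * (1 - 1))) :=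
        Continuous.tendsto (by fun_prop) (1 : ℝ)
      rw [sub_self, mul_zero] at this
      exact this.mono_left nhdsWithin_le_nhds
    refine squeeze_zero_norm' ?_ h1
    filter_upwards [Ioo_mem_nhdsLT (show (-1 : ℝ) < 1 by norm_num)] with τ hτ
    exact hαn τ hτ
  have hWev : ∀ᶠ τ in 𝓝[<] (1 : ℝ), φ (α τ) ∈ W := by
    have h1 := hφc0.tendsto.comp hαlim
    rw [hφ0] at h1
    exact h1 (hWo.mem_nhds h0W)
  obtain ⟨N, hN1, hN⟩ := (mem_nhdsLT_iff_exists_Ioo_subset' (show (-1 : ℝ) < 1 by norm_num)).1 hWev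
  have hN1 : N < 1 := hN1
  obtain ⟨m, hm1, hmN⟩ : ∃ m : ℕ, 1 ≤ m ∧ N < auxT (2 * m) := by
    obtain ⟨k, hk⟩ := exists_nat_gt (1 / (1 - N))
    refine ⟨k + 1, by omega, ?_⟩
    rw [lt_auxT (by positivity) hN1]
    push_cast
    have : (0 : ℝ) ≤ k := by positivity
    linarith
  have hm' : (1 : ℝ) ≤ m := by exact_mod_cast hm1
  have hT1 : auxT (2 * m - 1) < auxT (2 * m) := auxT_mono (by linarith) (by linarith)
  have hT2 : auxT (2 * m) < auxT (2 * m + 1 / 2) := auxT_mono (by linarith) (by linarith)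
  have hT3 : auxT (2 * m + 1 / 2) < auxT (2 * m + 1) := auxT_mono (by linarith) (by linarith)
  have hT4 : auxT (2 * m + 1) < auxT (2 * m + 2) := auxT_mono (by linarith) (by linarith)
  have hT5 : auxT (2 * m + 2) < auxT (2 * ((m + 1 : ℕ) : ℝ) + 1 / 2) :=
    auxT_mono (by linarith) (by push_cast; linarith)
  have hT6 : auxT (2 * ((m + 1 : ℕ) : ℝ) + 1 / 2) < 1 := auxT_lt_one (by positivity)
  have hT0 : (0 : ℝ) ≤ auxT (2 * m - 1) := by
    unfold auxT
    rw [sub_nonneg, div_le_one (by linarith)]; linarith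
  set a₀ := auxT (2 * m - 1)
  set a := auxT (2 * m)
  set b := auxT (2 * m + 1)
  set b₀ := auxT (2 * m + 2)
  set mid := auxT (2 * m + 1 / 2)
  set mid' := auxT (2 * ((m + 1 : ℕ) : ℝ) + 1 / 2)
  have hrmid : 0 < auxR c mid := auxR_mid hc m
  have hrmid' : 0 < auxR c mid' := auxR_mid hc (m + 1)
  have hI : ∀ τ ∈ Icc a b, τ ∈ Ioo (-1 : ℝ) 1 := fun τ hτ =>
    ⟨by linarith [hτ.1], by linarith [hτ.2]⟩
  set F : Set E := (φ ∘ α) '' Icc a b with hF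
  have hFc : IsClosed F := by
    refine (isCompact_Icc.image_of_continuousOn ?_).isClosed
    refine hφ.comp (hαan.continuousOn.mono hI) fun τ hτ => hαU τ (hI τ hτ)
  have hFW : F ⊆ W := by
    rintro _ ⟨τ, hτ, rfl⟩
    exact hN ⟨by linarith [hτ.1], by linarith [hτ.2]⟩
  -- cones
  set Q : Set E := {ξ | 0 < inner ℝ v ξ ∧ η * a₀ * inner ℝ v ξ < inner ℝ w ξ ∧
    inner ℝ w ξ < η * b₀ * inner ℝ v ξ} with hQ
  set K : Set E := {ξ | 0 ≤ inner ℝ v ξ ∧ η * a * inner ℝ v ξ ≤ inner ℝ w ξ ∧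
    inner ℝ w ξ ≤ η * b * inner ℝ v ξ} with hK
  have hQo : IsOpen Q := aux_Q_open v w _ _
  have hKc : IsClosed K := aux_K_closed v w _ _
  have hKQ : ∀ ξ ∈ K, inner ℝ v ξ ≠ 0 → ξ ∈ Q := by
    rintro ξ ⟨h1, h2, h3⟩ h0
    have h4 : 0 < inner ℝ v ξ := lt_of_le_of_ne h1 h0.symm
    have h5 : 0 < η * inner ℝ v ξ := by positivity
    exact ⟨h4, by nlinarith, by nlinarith⟩
  have hdirQ : ∀ τ ∈ Ioo (-1 : ℝ) 1, α τ ≠ 0 → (sphBlowup (α τ)).1 ∈ Q → τ ∈ Icc a b := by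
    rintro τ hτ hne ⟨h1, h2, h3⟩
    simp only [sphBlowup, inner_smul_right, hα, auxArc_v hv hvw, auxArc_w hw hvw] at h1 h2 h3
    rw [← hα] at h1 h2 h3
    have hk : 0 < ‖α τ‖⁻¹ := inv_pos.2 (norm_pos_iff.2 hne)
    have hr : 0 < auxR c τ := (pos_iff_pos_of_mul_pos h1).1 hk
    have hp : 0 < η * (‖α τ‖⁻¹ * auxR c τ) := by positivity
    have h4 : a₀ < τ := by
      by_contra hcon
      push Not at hcon
      nlinarith
    have h5 : τ < b₀ := by
      by_contra hcon
      push Not at hcon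
      nlinarith
    have := auxR_pos hc hm1 hτ.2 h4 h5 hr
    exact ⟨this.1.le, this.2.le⟩
  have hdirK : ∀ τ ∈ Icc a b, (sphBlowup (α τ)).1 ∈ K := by
    intro τ hτ
    have hr : 0 ≤ auxR c τ := auxR_nonneg hc hm1 (hI τ hτ).2 hτ.1 hτ.2
    have hk : 0 ≤ ‖α τ‖⁻¹ := by positivity
    have hp : 0 ≤ η * (‖α τ‖⁻¹ * auxR c τ) := by positivity
    simp only [hK, mem_setOf_eq, sphBlowup, inner_smul_right]
    rw [hα, auxArc_v hv hvw, auxArc_w hw hvw, ← hα]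
    exact ⟨by positivity, by nlinarith [hτ.1], by nlinarith [hτ.2]⟩
  have hψg : ∀ τ ∈ Ioo (-1 : ℝ) 1, ψ (φ (α τ)) = α τ := fun τ hτ => hinv.1 (hαU τ hτ)
  -- g is not locally zero
  have hmidI : mid ∈ Ioo (-1 : ℝ) 1 := ⟨by linarith, by linarith⟩
  have hmidI' : mid' ∈ Ioo (-1 : ℝ) 1 := ⟨by linarith, by linarith⟩
  have hαmid : α mid ≠ 0 := by
    intro h
    have := auxArc_v (c := c) (η := η) (τ := mid) hv hvw
    rw [← hα, h, inner_zero_right] at this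
    linarith
  obtain ⟨t₁, ht₁, hgt₁⟩ := hφg mid hmidI (hN ⟨by linarith, by linarith⟩)
  obtain ⟨t₂, ht₂, hgt₂⟩ := hφg mid' hmidI' (hN ⟨by linarith, by linarith⟩)
  have hgt₁0 : g t₁ ≠ 0 := by
    intro h
    apply hαmid
    rw [← hψg mid hmidI, ← hgt₁, h, hψ0]
  have hnz : ∀ t ∈ Ioo (-ε) ε, ¬ ∀ᶠ z in 𝓝 t, g z = 0 := by
    intro t ht h
    exact hgt₁0 (hg.eqOn_zero_of_preconnected_of_eventuallyEq_zero isPreconnected_Ioo ht h ht₁)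
  -- dichotomy
  have hdich : ∀ t ∈ Ioo (-ε) ε, (∀ᶠ s in 𝓝[≠] t, g s ∈ F) ∨ (∀ᶠ s in 𝓝[≠] t, g s ∉ F) := by
    intro t ht
    have hgc : ContinuousAt g t := (hg t ht).continuousAt
    by_cases htW : g t ∈ W
    swap
    · right
      have : ∀ᶠ s in 𝓝 t, g s ∉ F := hgc (hFc.isOpen_compl.mem_nhds fun h => htW (hFW h))
      exact nhdsWithin_le_nhds this
    obtain ⟨u, σ, hσ, hR, hL, hne⟩ := aux_dir_limit g t (hg t ht) (hnz t ht)
    have hev : ∀ᶠ s in 𝓝[≠] t, ∃ τ ∈ Ioo (-1 : ℝ) 1, φ (α τ) = g s ∧ ψ (g s) = α τ ∧ α τ ≠ 0 ∧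
        g s ∈ V \ {0} := by
      have h1 : ∀ᶠ s in 𝓝 t, g s ∈ W := hgc (hWo.mem_nhds htW)
      filter_upwards [nhdsWithin_le_nhds h1, nhdsWithin_le_nhds (Ioo_mem_nhds ht.1 ht.2), hne]
        with s hs1 hs2 hs3
      obtain ⟨τ, hτ, hτs⟩ := hgφ s hs2 hs1
      refine ⟨τ, hτ, hτs, by rw [← hτs, hψg τ hτ], ?_, ?_, hs3⟩
      · intro h; apply hs3; rw [← hτs, h, hφ0]
      · rw [← hτs]; exact hb.mapsTo (hαU τ hτ)
    have hRle : 𝓝[>] t ≤ 𝓝[≠] t := nhdsWithin_mono _ fun s hs => ne_of_gt hs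
    have hLle : 𝓝[<] t ≤ 𝓝[≠] t := nhdsWithin_mono _ fun s hs => ne_of_lt hs
    have hV' : ∀ᶠ s in 𝓝[≠] t, g s ∈ V \ {0} := by
      filter_upwards [hev] with s hs
      obtain ⟨τ, _, _, _, _, h⟩ := hs
      exact h
    obtain ⟨hR1, hR2⟩ := aux_lift hφ0 h0U hb hinv hInv hΨ hΦφ hR (hRle hV')
    obtain ⟨hL1, hL2⟩ := aux_lift hφ0 h0U hb hinv hInv hΨ hΦφ hL (hLle hV')
    have hD : IsClosed {ξ : E | ‖ξ‖ = 1 ∧ (‖ξ - v‖ ≤ 2 * η ∨ ‖ξ + v‖ ≤ 2 * η)} :=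
      aux_D_closed v _
    have hDev : ∀ᶠ s in 𝓝[≠] t, (sphBlowup (ψ (g s))).1 ∈
        {ξ : E | ‖ξ‖ = 1 ∧ (‖ξ - v‖ ≤ 2 * η ∨ ‖ξ + v‖ ≤ 2 * η)} := by
      filter_upwards [hev] with s hs
      obtain ⟨τ, hτ, _, h1, h2, _⟩ := hs
      rw [h1]
      exact auxArc_near hη hη' hv hw hτ h2
    have hRD := hD.mem_of_tendsto ((continuous_fst.tendsto _).comp hR1) (hRle hDev)
    have hLD := hD.mem_of_tendsto ((continuous_fst.tendsto _).comp hL1) (hLle hDev)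
    have heq : Ψ (σ • u, ‖g t‖) = Ψ (u, ‖g t‖) := by
      rcases hσ with rfl | ⟨rfl, hgt0⟩
      · rw [one_smul]
      exfalso
      have hx0 : Tendsto (fun s => ‖ψ (g s)‖) (𝓝 t) (𝓝 0) := by
        have h1 := ((hψ.continuousAt (hV.mem_nhds h0V)).tendsto.comp
          (by rw [← hgt0]; exact hgc.tendsto)).norm
        rw [hψ0, norm_zero] at h1
        exact h1
      have e1 : (Ψ (u, ‖g t‖)).2 = 0 :=
        tendsto_nhds_unique ((continuous_snd.tendsto _).comp hR1)
          (hx0.mono_left nhdsWithin_le_nhds)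
      have e2 : (Ψ ((-1 : ℝ) • u, ‖g t‖)).2 = 0 :=
        tendsto_nhds_unique ((continuous_snd.tendsto _).comp hL1)
          (hx0.mono_left nhdsWithin_le_nhds)
      have f1 := hνΦ _ hRD.1
      have f2 := hνΦ _ hLD.1
      have g1 : Ψ (u, ‖g t‖) = ((Ψ (u, ‖g t‖)).1, 0) := Prod.ext rfl e1
      have g2 : Ψ ((-1 : ℝ) • u, ‖g t‖) = ((Ψ ((-1 : ℝ) • u, ‖g t‖)).1, 0) := Prod.ext rfl e2
      rw [← g1, hR2] at f1
      rw [← g2, hL2] at f2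
      have k1 := congrArg Prod.fst f1
      have k2 := congrArg Prod.fst f2
      simp only at k1 k2
      refine hsep _ _ hRD.1 hLD.1 hRD.2 hLD.2 ?_
      rw [← k1, ← k2]; simp
    rw [heq] at hL1
    have hlim : Tendsto (fun s => (sphBlowup (ψ (g s))).1) (𝓝[≠] t) (𝓝 (Ψ (u, ‖g t‖)).1) := by
      rw [← nhdsLT_sup_nhdsGT]
      exact ((continuous_fst.tendsto _).comp hL1).sup ((continuous_fst.tendsto _).comp hR1)
    by_cases hξ : (Ψ (u, ‖g t‖)).1 ∈ Q
    · left
      filter_upwards [hlim (hQo.mem_nhds hξ), hev] with s hs1 hs2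
      obtain ⟨τ, hτ, h0, h1, h2, _⟩ := hs2
      have hs1 : (sphBlowup (ψ (g s))).1 ∈ Q := hs1
      rw [h1] at hs1
      exact ⟨τ, hdirQ τ hτ h2 hs1, h0⟩
    · right
      have hξK : (Ψ (u, ‖g t‖)).1 ∉ K := fun h =>
        hξ (hKQ _ h (aux_near_inner hη' hv hRD.2))
      filter_upwards [hlim (hKc.isOpen_compl.mem_nhds hξK)] with s hs1 hs2
      obtain ⟨τ, hτ, h0⟩ := hs2
      apply hs1
      have h0 : φ (α τ) = g s := h0
      change (sphBlowup (ψ (g s))).1 ∈ K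
      rw [← h0, hψg τ (hI τ hτ)]
      exact hdirK τ hτ
  -- start
  have hstart : ∀ᶠ s in 𝓝[≠] t₁, g s ∈ F := by
    have hgc : ContinuousAt g t₁ := (hg t₁ ht₁).continuousAt
    have hgV : g t₁ ∈ V := by rw [hgt₁]; exact hb.mapsTo (hαU _ hmidI)
    have hxe : ψ (g t₁) = α mid := by rw [hgt₁, hψg _ hmidI]
    have hxc : ContinuousAt (fun s => ψ (g s)) t₁ :=
      (hψ.continuousAt (hV.mem_nhds hgV)).comp hgc
    have hdc : ContinuousAt (fun s => ‖ψ (g s)‖⁻¹ • ψ (g s)) t₁ :=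
      (hxc.norm.inv₀ (by rw [hxe]; exact norm_ne_zero_iff.2 hαmid)).smul hxc
    have hQm : ‖ψ (g t₁)‖⁻¹ • ψ (g t₁) ∈ Q := by
      rw [hxe]
      refine hKQ _ (hdirK mid ⟨hT2.le, hT3.le⟩) ?_
      exact aux_near_inner hη' hv (auxArc_near hη hη' hv hw hmidI hαmid).2
    have h1 : ∀ᶠ s in 𝓝 t₁, g s ∈ W :=
      hgc (hWo.mem_nhds (by rw [hgt₁]; exact hN ⟨by linarith, by linarith⟩))
    have h2 : ∀ᶠ s in 𝓝 t₁, g s ≠ 0 := hgc.eventually_ne hgt₁0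
    have h3 : ∀ᶠ s in 𝓝 t₁, ‖ψ (g s)‖⁻¹ • ψ (g s) ∈ Q := hdc (hQo.mem_nhds hQm)
    apply nhdsWithin_le_nhds
    filter_upwards [h1, h2, h3, Ioo_mem_nhds ht₁.1 ht₁.2] with s hs1 hs2 hs3 hs4
    obtain ⟨τ, hτ, hτs⟩ := hgφ s hs4 hs1
    have hα' : α τ ≠ 0 := by intro h; apply hs2; rw [← hτs, h, hφ0]
    rw [← hτs, hψg τ hτ] at hs3
    exact ⟨τ, hdirQ τ hτ hα' hs3, hτs⟩
  have hend : ¬ ∀ᶠ s in 𝓝[≠] t₂, g s ∈ F := by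
    intro h
    have hgc : Tendsto g (𝓝[≠] t₂) (𝓝 (g t₂)) :=
      (hg t₂ ht₂).continuousAt.tendsto.mono_left nhdsWithin_le_nhds
    obtain ⟨τ, hτ, hτe⟩ := hFc.mem_of_tendsto hgc h
    have he : α τ = α mid' := by
      rw [← hψg τ (hI τ hτ), ← hψg mid' hmidI', ← hgt₂]
      exact congrArg ψ hτe
    have k1 := congrArg (inner ℝ v) he
    have k2 := congrArg (inner ℝ w) he
    rw [hα, auxArc_v hv hvw, auxArc_v hv hvw] at k1
    rw [hα, auxArc_w hw hvw, auxArc_w hw hvw, k1] at k2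
    have k3 := mul_left_cancel₀ hη.ne' (mul_left_cancel₀ hrmid'.ne' k2)
    linarith [hτ.2]
  -- connectedness
  have hcon := (isPreconnected_Ioo (a := -ε) (b := ε))
    {t | ∀ᶠ s in 𝓝[≠] t, g s ∈ F} {t | ∀ᶠ s in 𝓝[≠] t, g s ∉ F}
    isOpen_setOf_eventually_nhdsWithin isOpen_setOf_eventually_nhdsWithin
    (fun t ht => hdich t ht) ⟨t₁, ht₁, hstart⟩
    ⟨t₂, ht₂, (hdich t₂ ht₂).resolve_left hend⟩
  obtain ⟨t, -, h1, h2⟩ := hcon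
  have h1 : ∀ᶠ s in 𝓝[≠] t, g s ∈ F := h1
  have h2 : ∀ᶠ s in 𝓝[≠] t, g s ∉ F := h2
  obtain ⟨s, hs1, hs2⟩ := (Filter.Eventually.and h1 h2).exists
  exact hs2 hs1

end

/-- If `φ` is a blow-spherical homeomorphism between open neighborhoods
`U, V` of `0` in `ℝⁿ` which is image arc-analytic, then the induced map
`ν_φ(v) = lim_{t→0⁺} φ(tv)/‖φ(tv)‖` on the unit sphere satisfies
`ν_φ(−v) = −ν_φ(v)`. -/
theorem stmt6 {n : ℕ} (U V : Set (EuclideanSpace ℝ (Fin n)))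
    (hU : IsOpen U) (hV : IsOpen V)
    (h0U : (0 : EuclideanSpace ℝ (Fin n)) ∈ U) (h0V : (0 : EuclideanSpace ℝ (Fin n)) ∈ V)
    (φ : EuclideanSpace ℝ (Fin n) → EuclideanSpace ℝ (Fin n))
    (hbs : IsBlowSphericalHomeo U V φ)
    (harc : ∀ α : ℝ → EuclideanSpace ℝ (Fin n),
      AnalyticOnNhd ℝ α (Set.Ioo (-1 : ℝ) 1) → (∀ t ∈ Set.Ioo (-1 : ℝ) 1, α t ∈ U) →
      ∃ ε : ℝ, 0 < ε ∧ ε ≤ 1 ∧ ∃ g : ℝ → EuclideanSpace ℝ (Fin n),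
        AnalyticOnNhd ℝ g (Set.Ioo (-ε) ε) ∧ g 0 = φ (α 0) ∧
        ∃ W ∈ 𝓝 (φ (α 0)),
          (g '' Set.Ioo (-ε) ε) ∩ W = ((φ ∘ α) '' Set.Ioo (-1 : ℝ) 1) ∩ W)
    (ν : EuclideanSpace ℝ (Fin n) → EuclideanSpace ℝ (Fin n))
    (hν : ∀ v : EuclideanSpace ℝ (Fin n), ‖v‖ = 1 →
      Tendsto (fun t : ℝ => ‖φ (t • v)‖⁻¹ • φ (t • v)) (𝓝[>] 0) (𝓝 (ν v))) :
    ∀ v : EuclideanSpace ℝ (Fin n), ‖v‖ = 1 → ν (-v) = -ν v := by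
  intro v hv
  obtain ⟨hφ0, hb, hφ, ⟨ψ, hinv, hψ⟩, Φ, hB, hΦ, ⟨Ψ, hInv, hΨ⟩, hΦφ⟩ := hbs
  have hνΦ : ∀ ξ : EuclideanSpace ℝ (Fin n), ‖ξ‖ = 1 → Φ (ξ, 0) = (ν ξ, 0) := fun ξ hξ =>
    aux_nu (V := V) hU h0U hφ0 hφ hΦ hΦφ ν hν hξ
  have hν1 : ∀ ξ : EuclideanSpace ℝ (Fin n), ‖ξ‖ = 1 → ‖ν ξ‖ = 1 := by
    intro ξ hξ
    refine tendsto_nhds_unique ((hν ξ hξ).norm) ?_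
    refine tendsto_const_nhds.congr' ?_
    filter_upwards [aux_ray_mem hU h0U hξ] with t ht
    have hne : φ (t • ξ) ≠ 0 := by
      intro h
      exact ht.2 (hb.injOn ht.1 h0U (by rw [h, hφ0]))
    rw [norm_smul, norm_inv, norm_norm, inv_mul_cancel₀ (norm_ne_zero_iff.2 hne)]
  have hνinj : ∀ ξ ξ' : EuclideanSpace ℝ (Fin n), ‖ξ‖ = 1 → ‖ξ'‖ = 1 → ν ξ = ν ξ' → ξ = ξ' := by
    intro ξ ξ' h h' he
    have := hB.injOn (aux_bdry_mem hU h0U h) (aux_bdry_mem hU h0U h')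
      (by rw [hνΦ _ h, hνΦ _ h', he])
    exact congrArg Prod.fst this
  have hνc : ContinuousOn ν {ξ | ‖ξ‖ = 1} := by
    have h1 : ContinuousOn (fun ξ : EuclideanSpace ℝ (Fin n) => (Φ (ξ, 0)).1) {ξ | ‖ξ‖ = 1} := by
      refine continuous_fst.comp_continuousOn (hΦ.comp (by fun_prop) ?_)
      intro ξ hξ
      exact aux_bdry_mem hU h0U hξ
    refine h1.congr fun ξ hξ => ?_
    simp only
    rw [hνΦ ξ hξ]
  have hv' : ‖-v‖ = 1 := by rw [norm_neg, hv]
  have hvne : v ≠ 0 := by rintro rfl; simp at hv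
  by_contra hbad
  by_cases hw : ∃ w : EuclideanSpace ℝ (Fin n), w ≠ 0 ∧ inner ℝ v w = 0
  · obtain ⟨w₀, hw₀, hvw₀⟩ := hw
    have hw : ‖‖w₀‖⁻¹ • w₀‖ = 1 := by
      rw [norm_smul, norm_inv, norm_norm, inv_mul_cancel₀ (norm_ne_zero_iff.2 hw₀)]
    have hvw : inner ℝ v (‖w₀‖⁻¹ • w₀) = 0 := by rw [inner_smul_right, hvw₀, mul_zero]
    have hd : ∀ p : EuclideanSpace ℝ (Fin n), ‖p‖ = 1 → ν p + ν p ≠ 0 := by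
      intro p hp h
      have h1 := hν1 p hp
      rw [← two_smul ℝ, smul_eq_zero] at h
      rcases h with h | h
      · norm_num at h
      · rw [h] at h1; simp at h1
    have hbad1 : ν (-v) + ν v ≠ 0 := fun h => hbad (eq_neg_of_add_eq_zero_left h)
    have hbad2 : ν v + ν (-v) ≠ 0 := by rwa [add_comm]
    obtain ⟨δ₁, hδ₁, H1⟩ := aux_pair hνc hv hv (hd v hv)
    obtain ⟨δ₂, hδ₂, H2⟩ := aux_pair hνc hv hv' hbad2
    obtain ⟨δ₃, hδ₃, H3⟩ := aux_pair hνc hv' hv hbad1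
    obtain ⟨δ₄, hδ₄, H4⟩ := aux_pair hνc hv' hv' (hd (-v) hv')
    obtain ⟨η, hη, hη'⟩ : ∃ η : ℝ, 0 < η ∧ η < min (1 / 8) (min (min (δ₁ / 2) (δ₂ / 2))
        (min (δ₃ / 2) (δ₄ / 2))) := exists_between (by positivity)
    simp only [lt_min_iff] at hη'
    obtain ⟨h0, ⟨h1, h2⟩, h3, h4⟩ := hη'
    refine aux_core U V hU hV h0U h0V φ ψ Φ Ψ hφ0 hb hφ hinv hψ hInv hΨ hΦφ harc ν hνΦ v
      (‖w₀‖⁻¹ • w₀) hv hw hvw η hη (by linarith) ?_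
    intro ξ ξ' hξ hξ' hc hc'
    rw [← sub_neg_eq_add] at hc hc'
    rcases hc with hc | hc <;> rcases hc' with hc' | hc'
    · exact H1 ξ ξ' hξ hξ' (by linarith) (by linarith)
    · exact H2 ξ ξ' hξ hξ' (by linarith) (by linarith)
    · exact H3 ξ ξ' hξ hξ' (by linarith) (by linarith)
    · exact H4 ξ ξ' hξ hξ' (by linarith) (by linarith)
  · push Not at hw
    have hspan : ∀ x : EuclideanSpace ℝ (Fin n), x = (inner ℝ v x : ℝ) • v := by
      intro x
      by_contra hx
      refine hw (x - (inner ℝ v x : ℝ) • v) (sub_ne_zero.2 hx) ?_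
      rw [inner_sub_right, inner_smul_right, real_inner_self_eq_norm_sq, hv]
      ring
    have e1 := hspan (ν v)
    have e2 := hspan (ν (-v))
    have n1 := hν1 v hv
    have n2 := hν1 (-v) hv'
    rw [e1, norm_smul, hv, mul_one, Real.norm_eq_abs] at n1
    rw [e2, norm_smul, hv, mul_one, Real.norm_eq_abs] at n2
    rcases abs_eq_abs.1 (n2.trans n1.symm) with h | h
    · rw [h, ← e1] at e2
      have := hνinj _ _ hv' hv e2
      have h5 : (2 : ℝ) • v = 0 := by
        rw [two_smul]; nth_rewrite 1 [← this]; exact neg_add_cancel v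
      exact hvne ((smul_eq_zero.1 h5).resolve_left (by norm_num))
    · apply hbad
      rw [e2, h, neg_smul, ← e1]
end

section
/- Let γ : (−ε, ε) → ℝⁿ be a real analytic map with γ(0) = 0 that is not identically zero and is a homeomorphism onto its image Γ := γ((−ε, ε)). Then the germ (Γ, 0) is blow-spherical homeomorphic to the germ at 0 of the cusp {(x,y) ∈ ℝ² : y² = x³} if and only if the tangent cone C(Γ,0) is a half-line, i.e., C(Γ,0) = {t·v : t ≥ 0} for some v ≠ 0. -/
open Filter Set Topology

/-- The tangent cone at `0` of a set `X`. -/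
def tangentConeAtZero {E : Type*} [NormedAddCommGroup E] [NormedSpace ℝ E]
    (X : Set E) : Set E :=
  {v | ∃ (x : ℕ → E) (t : ℕ → ℝ), (∀ i, x i ∈ X \ {0}) ∧
    Tendsto x atTop (𝓝 0) ∧ (∀ i, 0 < t i) ∧
    Tendsto (fun i => (t i)⁻¹ • x i) atTop (𝓝 v)}

/-- The cusp `{(x,y) ∈ ℝ² : y² = x³}`. -/
def cuspSet : Set (EuclideanSpace ℝ (Fin 2)) := {p | (p 1) ^ 2 = (p 0) ^ 3}

theorem aux_compact_inv {Y : Type*} [TopologicalSpace Y] [T2Space Y] {K : Set ℝ} (hK : IsCompact K)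
    {f : ℝ → Y} (hf : ContinuousOn f K) (hi : InjOn f K) :
    ∃ g : Y → ℝ, ContinuousOn g (f '' K) ∧ ∀ x ∈ K, g (f x) = x := by
  have hl : ∀ x ∈ K, Function.invFunOn f K (f x) = x := fun x hx => hi.leftInvOn_invFunOn hx
  refine ⟨Function.invFunOn f K, ?_, hl⟩
  rw [continuousOn_iff_isClosed]
  intro t ht
  refine ⟨f '' (K ∩ t), ?_, ?_⟩
  · exact ((hK.inter_right ht).image_of_continuousOn (hf.mono inter_subset_left)).isClosed
  · ext y
    constructor
    · rintro ⟨hy, x, hx, rfl⟩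
      have : x ∈ t := by simpa [hl x hx] using hy
      exact ⟨⟨x, ⟨hx, this⟩, rfl⟩, ⟨x, hx, rfl⟩⟩
    · rintro ⟨⟨x, ⟨hx, hxt⟩, rfl⟩, h2⟩
      refine ⟨?_, h2⟩
      simpa [hl x hx] using hxt

theorem aux_sph_inj {E : Type*} [NormedAddCommGroup E] [NormedSpace ℝ E] {x y : E}
    (h : sphBlowup x = sphBlowup y) : x = y := by
  simp only [sphBlowup, Prod.mk.injEq] at h
  obtain ⟨h1, h2⟩ := h
  by_cases hx : x = 0
  · subst hx
    rw [norm_zero] at h2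
    exact (norm_eq_zero.mp h2.symm).symm
  · have hx' : ‖x‖ ≠ 0 := norm_ne_zero_iff.mpr hx
    rw [← h2] at h1
    exact (smul_right_injective E (inv_ne_zero hx')) h1

noncomputable def auxP {E : Type*} [NormedAddCommGroup E] [NormedSpace ℝ E]
    (f : ℝ → E) (u : E) : ℝ → E × ℝ := Function.update (fun t => sphBlowup (f t)) 0 (u, 0)

theorem auxP_ne {E : Type*} [NormedAddCommGroup E] [NormedSpace ℝ E]
    (f : ℝ → E) (u : E) {t : ℝ} (ht : t ≠ 0) : auxP f u t = sphBlowup (f t) := by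
  simp [auxP, ht]

theorem auxP_zero {E : Type*} [NormedAddCommGroup E] [NormedSpace ℝ E]
    (f : ℝ → E) (u : E) : auxP f u 0 = (u, 0) := by
  simp [auxP]

theorem aux_zero_mem {a : ℝ} (ha : 0 < a) : (0 : ℝ) ∈ Icc (-a) a := ⟨by linarith, ha.le⟩

theorem auxP_inj {E : Type*} [NormedAddCommGroup E] [NormedSpace ℝ E]
    {f : ℝ → E} (u : E) {a : ℝ} (ha : 0 < a) (hf0 : f 0 = 0)
    (hi : InjOn f (Icc (-a) a)) : InjOn (auxP f u) (Icc (-a) a) := by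
  have key : ∀ t ∈ Icc (-a) a, t ≠ 0 → auxP f u t ≠ (u, 0) := by
    intro t ht ht0 h
    rw [auxP_ne f u ht0] at h
    have h2 : ‖f t‖ = 0 := congrArg Prod.snd h
    rw [norm_eq_zero, ← hf0] at h2
    exact ht0 (hi ht (aux_zero_mem ha) h2)
  intro s hs t ht h
  by_cases hs0 : s = 0
  · by_cases ht0 : t = 0
    · rw [hs0, ht0]
    · rw [hs0, auxP_zero] at h
      exact absurd h.symm (key t ht ht0)
  · by_cases ht0 : t = 0
    · rw [ht0, auxP_zero] at h
      exact absurd h (key s hs hs0)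
    · rw [auxP_ne f u hs0, auxP_ne f u ht0] at h
      exact hi hs ht (aux_sph_inj h)

theorem auxP_cont {E : Type*} [NormedAddCommGroup E] [NormedSpace ℝ E]
    {f : ℝ → E} {u : E} {a : ℝ} (ha : 0 < a) (hf0 : f 0 = 0) (hf : ContinuousOn f (Icc (-a) a))
    (hi : InjOn f (Icc (-a) a))
    (hu : Tendsto (fun t => ‖f t‖⁻¹ • f t) (𝓝[≠] 0) (𝓝 u)) :
    ContinuousOn (auxP f u) (Icc (-a) a) := by
  intro t ht
  by_cases ht0 : t = 0
  · subst ht0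
    apply ContinuousAt.continuousWithinAt
    unfold auxP
    rw [continuousAt_update_same]
    have hc : ContinuousAt f 0 := hf.continuousAt (Icc_mem_nhds (by linarith) ha)
    have hn : Tendsto (fun t => ‖f t‖) (𝓝[≠] 0) (𝓝 0) := by
      have := hc.norm.tendsto
      rw [hf0, norm_zero] at this
      exact this.mono_left nhdsWithin_le_nhds
    exact hu.prodMk_nhds hn
  · have hft : f t ≠ 0 := by
      intro h
      rw [← hf0] at h
      exact ht0 (hi ht (aux_zero_mem ha) h)
    have h1 : ContinuousWithinAt (fun t => sphBlowup (f t)) (Icc (-a) a) t := by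
      unfold sphBlowup
      exact ((hf t ht).norm.inv₀ (norm_ne_zero_iff.mpr hft)).smul (hf t ht) |>.prodMk (hf t ht).norm
    refine h1.congr_of_eventuallyEq ?_ (auxP_ne f u ht0)
    have : ∀ᶠ s in 𝓝[Icc (-a) a] t, s ≠ 0 := nhdsWithin_le_nhds (isOpen_ne.mem_nhds ht0)
    filter_upwards [this] with s hs using auxP_ne f u hs

theorem aux_strict {E : Type*} [NormedAddCommGroup E] [NormedSpace ℝ E]
    {f : ℝ → E} {u : E} {a : ℝ} (ha : 0 < a) (hf0 : f 0 = 0) (hf : ContinuousOn f (Icc (-a) a))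
    (hi : InjOn f (Icc (-a) a))
    (hu : Tendsto (fun t => ‖f t‖⁻¹ • f t) (𝓝[≠] 0) (𝓝 u)) :
    strictTransform (f '' Ioo (-a) a) = auxP f u '' Icc (-a) a := by
  have hc := auxP_cont ha hf0 hf hi hu
  have him : sphBlowup '' ((f '' Ioo (-a) a) \ {0}) = auxP f u '' (Ioo (-a) a \ {0}) := by
    ext p
    constructor
    · rintro ⟨_, ⟨⟨t, ht, rfl⟩, h0⟩, rfl⟩
      have ht0 : t ≠ 0 := by
        rintro rfl
        exact h0 hf0
      exact ⟨t, ⟨ht, ht0⟩, auxP_ne f u ht0⟩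
    · rintro ⟨t, ⟨ht, ht0⟩, rfl⟩
      refine ⟨f t, ⟨⟨t, ht, rfl⟩, ?_⟩, (auxP_ne f u ht0).symm⟩
      intro h
      rw [mem_singleton_iff, ← hf0] at h
      exact ht0 (hi (Ioo_subset_Icc_self ht) (aux_zero_mem ha) h)
  unfold strictTransform
  rw [him]
  apply Subset.antisymm
  · apply closure_minimal
    · exact image_mono (diff_subset.trans Ioo_subset_Icc_self)
    · exact (isCompact_Icc.image_of_continuousOn hc).isClosed
  · have hcl : Icc (-a) a ⊆ closure (Ioo (-a) a \ {0}) := by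
      have h1 : Ioo (-a) a ⊆ closure (Ioo (-a) a \ {0}) := by
        have hd : Dense ({0}ᶜ : Set ℝ) := dense_compl_singleton 0
        rw [diff_eq]
        exact hd.open_subset_closure_inter isOpen_Ioo
      rw [← closure_Ioo (by linarith : -a ≠ a)]
      exact closure_minimal h1 isClosed_closure
    rintro _ ⟨t, ht, rfl⟩
    have h1 : t ∈ closure (Ioo (-a) a \ {0}) := hcl ht
    exact ((hc t ht).mono (diff_subset.trans Ioo_subset_Icc_self)).mem_closure_image h1

theorem aux_homeo {E F : Type*} [NormedAddCommGroup E] [NormedSpace ℝ E]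
    [NormedAddCommGroup F] [NormedSpace ℝ F]
    {f : ℝ → E} {u : E} {h : ℝ → F} {w : F} {a : ℝ} (ha : 0 < a)
    (hf0 : f 0 = 0) (hf : ContinuousOn f (Icc (-a) a)) (hi : InjOn f (Icc (-a) a))
    (hu : Tendsto (fun t => ‖f t‖⁻¹ • f t) (𝓝[≠] 0) (𝓝 u))
    (hh0 : h 0 = 0) (hh : ContinuousOn h (Icc (-a) a)) (hhi : InjOn h (Icc (-a) a))
    (hw : Tendsto (fun t => ‖h t‖⁻¹ • h t) (𝓝[≠] 0) (𝓝 w)) :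
    ∃ φ, IsBlowSphericalHomeo (f '' Ioo (-a) a) (h '' Ioo (-a) a) φ := by
  obtain ⟨δ, hδc, hδ⟩ := aux_compact_inv isCompact_Icc hf hi
  obtain ⟨η, hηc, hη⟩ := aux_compact_inv isCompact_Icc hh hhi
  obtain ⟨A, hAc, hA⟩ := aux_compact_inv isCompact_Icc (auxP_cont ha hf0 hf hi hu)
    (auxP_inj u ha hf0 hi)
  obtain ⟨B, hBc, hB⟩ := aux_compact_inv isCompact_Icc (auxP_cont ha hh0 hh hhi hw)
    (auxP_inj w ha hh0 hhi)
  have hsub : Ioo (-a) a ⊆ Icc (-a) a := Ioo_subset_Icc_self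
  have hz := aux_zero_mem ha
  have inv1 : InvOn (fun y => f (η y)) (fun x => h (δ x)) (f '' Ioo (-a) a) (h '' Ioo (-a) a) := by
    constructor
    · rintro _ ⟨t, ht, rfl⟩
      simp only [hδ t (hsub ht), hη t (hsub ht)]
    · rintro _ ⟨t, ht, rfl⟩
      simp only [hδ t (hsub ht), hη t (hsub ht)]
  have inv2 : InvOn (fun y => auxP f u (B y)) (fun x => auxP h w (A x))
      (auxP f u '' Icc (-a) a) (auxP h w '' Icc (-a) a) := by
    constructor
    · rintro _ ⟨t, ht, rfl⟩
      simp only [hA t ht, hB t ht]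
    · rintro _ ⟨t, ht, rfl⟩
      simp only [hA t ht, hB t ht]
  refine ⟨fun x => h (δ x), ?_, ?_, ?_, ⟨fun y => f (η y), inv1, ?_⟩, fun x => auxP h w (A x), ?_⟩
  · have := hδ 0 hz
    rw [hf0] at this
    simp only [this, hh0]
  · apply inv1.bijOn
    · rintro _ ⟨t, ht, rfl⟩
      exact ⟨t, ht, by simp only [hδ t (hsub ht)]⟩
    · rintro _ ⟨t, ht, rfl⟩
      exact ⟨t, ht, by simp only [hη t (hsub ht)]⟩
  · refine hh.comp (hδc.mono (image_mono hsub)) ?_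
    rintro _ ⟨t, ht, rfl⟩
    rw [hδ t (hsub ht)]
    exact hsub ht
  · refine hf.comp (hηc.mono (image_mono hsub)) ?_
    rintro _ ⟨t, ht, rfl⟩
    rw [hη t (hsub ht)]
    exact hsub ht
  · rw [aux_strict ha hf0 hf hi hu, aux_strict ha hh0 hh hhi hw]
    refine ⟨?_, ?_, ⟨_, inv2, ?_⟩, ?_⟩
    · apply inv2.bijOn
      · rintro _ ⟨t, ht, rfl⟩
        exact ⟨t, ht, by simp only [hA t ht]⟩
      · rintro _ ⟨t, ht, rfl⟩
        exact ⟨t, ht, by simp only [hB t ht]⟩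
    · refine (auxP_cont ha hh0 hh hhi hw).comp hAc ?_
      rintro _ ⟨t, ht, rfl⟩
      rw [hA t ht]
      exact ht
    · refine (auxP_cont ha hf0 hf hi hu).comp hBc ?_
      rintro _ ⟨t, ht, rfl⟩
      rw [hB t ht]
      exact ht
    · rintro _ ⟨⟨t, ht, rfl⟩, h0⟩
      have ht0 : t ≠ 0 := by
        rintro rfl
        exact h0 hf0
      simp only [hδ t (hsub ht)]
      rw [← auxP_ne f u ht0, ← auxP_ne h w ht0, hA t (hsub ht)]

/-- Directions of `t ^ k • g t`. -/
theorem aux_dir {E : Type*} [NormedAddCommGroup E] [NormedSpace ℝ E]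
    {f g : ℝ → E} {k : ℕ} (hg : ContinuousAt g 0) (hg0 : g 0 ≠ 0)
    {l : Filter ℝ} (hl : l ≤ 𝓝 0) (hfg : ∀ᶠ t in 𝓝 0, f t = t ^ k • g t)
    {σ : ℝ} (hσ : ∀ᶠ t in l, |t ^ k|⁻¹ * t ^ k = σ) :
    Tendsto (fun t => ‖f t‖⁻¹ • f t) l (𝓝 (σ • ‖g 0‖⁻¹ • g 0)) := by
  have h1 : Tendsto (fun t => σ • ‖g t‖⁻¹ • g t) l (𝓝 (σ • ‖g 0‖⁻¹ • g 0)) := by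
    have : ContinuousAt (fun t => σ • ‖g t‖⁻¹ • g t) 0 :=
      ((hg.norm.inv₀ (norm_ne_zero_iff.mpr hg0)).smul hg).const_smul σ
    exact this.tendsto.mono_left hl
  refine h1.congr' ?_
  filter_upwards [hσ, hl hfg] with t h2 h3
  rw [h3, norm_smul, Real.norm_eq_abs, mul_inv, smul_smul, smul_smul, ← h2]
  congr 1
  ring

noncomputable def auxC (s : ℝ) : EuclideanSpace ℝ (Fin 2) := !₂[s ^ 2, s ^ 3]

theorem auxC_cont : Continuous auxC := by
  unfold auxC
  fun_prop

theorem auxC_zero : auxC 0 = 0 := by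
  ext i
  fin_cases i <;> simp [auxC]

theorem auxC_inj : Function.Injective auxC := by
  intro s t h
  have h3 : s ^ 3 = t ^ 3 := by
    have := congrArg (fun p : EuclideanSpace ℝ (Fin 2) => p 1) h
    simpa [auxC] using this
  exact (Odd.strictMono_pow (by decide : Odd 3)).injective h3

theorem auxC_dir : Tendsto (fun t => ‖auxC t‖⁻¹ • auxC t) (𝓝[≠] 0)
    (𝓝 ((1 : ℝ) • ‖(!₂[1, 0] : EuclideanSpace ℝ (Fin 2))‖⁻¹ • !₂[1, 0])) := by
  have hg : Continuous (fun s : ℝ => (!₂[1, s] : EuclideanSpace ℝ (Fin 2))) := by fun_prop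
  refine aux_dir (g := fun s : ℝ => !₂[1, s]) (k := 2) hg.continuousAt ?_ nhdsWithin_le_nhds ?_ ?_
  · intro h
    have := congrArg (fun p : EuclideanSpace ℝ (Fin 2) => p 0) h
    simp at this
  · refine Eventually.of_forall fun t => ?_
    ext i
    fin_cases i
    · simp [auxC]
    · simp [auxC]
      ring
  · filter_upwards [self_mem_nhdsWithin] with t ht
    have : t ≠ 0 := ht
    rw [abs_of_nonneg (sq_nonneg t)]
    field_simp

theorem aux_cusp_param {p : EuclideanSpace ℝ (Fin 2)} (hp : p ∈ cuspSet) :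
    ∃ s, auxC s = p ∧ s ^ 2 = p 0 := by
  have hp' : (p 1) ^ 2 = (p 0) ^ 3 := hp
  have h2 : (p 1 / p 0) ^ 2 = p 0 := by
    by_cases h0 : p 0 = 0
    · simp [h0]
    · field_simp
      linarith
  refine ⟨p 1 / p 0, ?_, h2⟩
  ext i
  fin_cases i
  · simpa [auxC] using h2
  · have h3 : (p 1 / p 0) ^ 3 = p 1 := by
      by_cases h0 : p 0 = 0
      · rw [h0] at hp' ⊢
        have : p 1 = 0 := by
          have : (p 1) ^ 2 = 0 := by rw [hp']; norm_num
          exact pow_eq_zero_iff (two_ne_zero) |>.mp this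
        simp [this]
      · rw [pow_succ, h2]
        field_simp
    simpa [auxC] using h3

theorem aux_cusp_lim {α : Type*} {l : Filter α} {q : α → EuclideanSpace ℝ (Fin 2)}
    (hq : ∀ᶠ x in l, q x ∈ cuspSet \ {0}) (h0 : Tendsto q l (𝓝 0)) :
    Tendsto (fun x => sphBlowup (q x)) l
      (𝓝 ((1 : ℝ) • ‖(!₂[1, 0] : EuclideanSpace ℝ (Fin 2))‖⁻¹ • !₂[1, 0], 0)) := by
  have hex : ∀ x, ∃ s, q x ∈ cuspSet → auxC s = q x ∧ s ^ 2 = q x 0 := by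
    intro x
    by_cases h : q x ∈ cuspSet
    · obtain ⟨s, hs⟩ := aux_cusp_param h
      exact ⟨s, fun _ => hs⟩
    · exact ⟨0, fun h' => absurd h' h⟩
  choose s hs using hex
  have hn : Tendsto (fun x => ‖q x‖) l (𝓝 0) := by simpa using h0.norm
  refine Tendsto.prodMk_nhds ?_ hn
  have hs2 : Tendsto (fun x => s x ^ 2) l (𝓝 0) := by
    have hc : Continuous (fun p : EuclideanSpace ℝ (Fin 2) => p 0) := by fun_prop
    have h1 : Tendsto (fun x => q x 0) l (𝓝 0) := by
      have h2 := (hc.tendsto 0).comp h0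
      simp only [PiLp.zero_apply] at h2
      exact h2
    refine h1.congr' ?_
    filter_upwards [hq] with x hx using (hs x hx.1).2.symm
  have hs0 : Tendsto s l (𝓝 0) := by
    have h1 := hs2.sqrt
    simp only [Real.sqrt_sq_eq_abs, Real.sqrt_zero] at h1
    exact (tendsto_zero_iff_abs_tendsto_zero s).mpr h1
  have hs1 : Tendsto s l (𝓝[≠] 0) := by
    refine tendsto_nhdsWithin_iff.mpr ⟨hs0, ?_⟩
    filter_upwards [hq] with x hx h
    have h' : s x = 0 := h
    have := (hs x hx.1).1
    rw [h', auxC_zero] at this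
    exact hx.2 this.symm
  refine (auxC_dir.comp hs1).congr' ?_
  filter_upwards [hq] with x hx
  simp only [Function.comp, (hs x hx.1).1]

theorem aux_cusp_nhd {a : ℝ} (ha : 0 < a) :
    cuspSet ∩ {p : EuclideanSpace ℝ (Fin 2) | p 0 < a ^ 2} = auxC '' Ioo (-a) a := by
  ext p
  constructor
  · rintro ⟨hp, hpa⟩
    obtain ⟨s, hs, hs2⟩ := aux_cusp_param hp
    refine ⟨s, ?_, hs⟩
    have : s ^ 2 < a ^ 2 := by rw [hs2]; exact hpa
    exact abs_lt.mp (abs_lt_of_sq_lt_sq this ha.le)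
  · rintro ⟨s, hs, rfl⟩
    refine ⟨?_, ?_⟩
    · simp only [cuspSet, auxC, mem_setOf_eq]
      simp
      ring
    · simp only [auxC, mem_setOf_eq]
      simp
      exact sq_lt_sq.mpr (by rw [abs_of_pos ha]; exact abs_lt.mpr hs)

theorem aux_cone_mem {E : Type*} [NormedAddCommGroup E] [NormedSpace ℝ E]
    {X : Set E} {f : ℝ → E} {w : E} {l : Filter ℝ} [l.NeBot] [l.IsCountablyGenerated]
    (hX : ∀ᶠ t in l, f t ∈ X \ {0}) (h0 : Tendsto f l (𝓝 0))
    (hw : Tendsto (fun t => ‖f t‖⁻¹ • f t) l (𝓝 w)) {s : ℝ} (hs : 0 ≤ s) :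
    s • w ∈ tangentConeAtZero X := by
  obtain ⟨τ, hτ⟩ := exists_seq_tendsto l
  obtain ⟨N, hN⟩ := eventually_atTop.mp (hτ.eventually hX)
  have hτ' : Tendsto (fun i => τ (i + N)) atTop l := hτ.comp (tendsto_add_atTop_nat N)
  have hne : ∀ i, 0 < ‖f (τ (i + N))‖ := fun i =>
    norm_pos_iff.mpr (hN (i + N) (Nat.le_add_left _ _)).2
  have hp : ∀ i : ℕ, 0 < s + 1 / ((i : ℝ) + 1) := fun i => by positivity
  refine ⟨fun i => f (τ (i + N)), fun i => ‖f (τ (i + N))‖ / (s + 1 / ((i : ℝ) + 1)),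
    fun i => hN _ (Nat.le_add_left _ _), h0.comp hτ', fun i => div_pos (hne i) (hp i), ?_⟩
  have h1 : Tendsto (fun i : ℕ => s + 1 / ((i : ℝ) + 1)) atTop (𝓝 s) := by
    simpa using tendsto_one_div_add_atTop_nhds_zero_nat.const_add s
  refine (h1.smul (hw.comp hτ')).congr fun i => ?_
  simp only [Function.comp, smul_smul]
  congr 1
  rw [inv_div]
  ring

theorem aux_cone_sub {E : Type*} [NormedAddCommGroup E] [NormedSpace ℝ E]
    {I : Set ℝ} {f : ℝ → E} {δ : E → ℝ} {u : E} (hf0 : f 0 = 0) (h0I : (0 : ℝ) ∈ I)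
    (hδc : ContinuousOn δ (f '' I)) (hδ : ∀ t ∈ I, δ (f t) = t)
    (hu : Tendsto (fun t => ‖f t‖⁻¹ • f t) (𝓝[≠] 0) (𝓝 u)) {v : E}
    (hv : v ∈ tangentConeAtZero (f '' I)) : v = ‖v‖ • u := by
  obtain ⟨x, t, hx, hx0, ht, hlim⟩ := hv
  have hfd : ∀ i, f (δ (x i)) = x i := by
    intro i
    obtain ⟨s, hs, h⟩ := (hx i).1
    rw [← h, hδ s hs]
  have hd0 : δ 0 = 0 := by
    have := hδ 0 h0I
    rwa [hf0] at this
  have hτ0 : Tendsto (fun i => δ (x i)) atTop (𝓝 0) := by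
    have h1 : Tendsto x atTop (𝓝[f '' I] 0) :=
      tendsto_nhdsWithin_iff.mpr ⟨hx0, Eventually.of_forall fun i => (hx i).1⟩
    have h2 := (hδc 0 ⟨0, h0I, hf0⟩).tendsto.comp h1
    rw [hd0] at h2
    exact h2
  have hτ : Tendsto (fun i => δ (x i)) atTop (𝓝[≠] 0) := by
    refine tendsto_nhdsWithin_iff.mpr ⟨hτ0, Eventually.of_forall fun i h => ?_⟩
    have h' : δ (x i) = 0 := h
    have h2 := hfd i
    rw [h', hf0] at h2
    exact (hx i).2 h2.symm
  have h3 := hlim.norm.smul (hu.comp hτ)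
  refine tendsto_nhds_unique hlim (h3.congr fun i => ?_)
  simp only [Function.comp, hfd]
  have hxi : ‖x i‖ ≠ 0 := norm_ne_zero_iff.mpr (hx i).2
  rw [norm_smul, norm_inv, Real.norm_eq_abs, abs_of_pos (ht i), smul_smul]
  congr 1
  field_simp

/-- For a real analytic curve germ `γ` that is a homeomorphism onto its
image `Γ`, the germ `(Γ,0)` is blow-spherical homeomorphic to the germ at `0` of the
cusp `{y² = x³}` if and only if the tangent cone `C(Γ,0)` is a half-line. -/
theorem stmt7 {n : ℕ} (ε : ℝ) (hε : 0 < ε)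
    (γ : ℝ → EuclideanSpace ℝ (Fin n))
    (hγan : AnalyticOnNhd ℝ γ (Set.Ioo (-ε) ε))
    (hγ0 : γ 0 = 0)
    (hγne : ¬ ∀ t ∈ Set.Ioo (-ε) ε, γ t = 0)
    (hinj : Set.InjOn γ (Set.Ioo (-ε) ε))
    (hhomeo : ∃ δ : EuclideanSpace ℝ (Fin n) → ℝ,
      ContinuousOn δ (γ '' Set.Ioo (-ε) ε) ∧ ∀ t ∈ Set.Ioo (-ε) ε, δ (γ t) = t) :
    (∃ (U : Set (EuclideanSpace ℝ (Fin n))) (V : Set (EuclideanSpace ℝ (Fin 2))),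
      IsOpen U ∧ (0 : EuclideanSpace ℝ (Fin n)) ∈ U ∧
      IsOpen V ∧ (0 : EuclideanSpace ℝ (Fin 2)) ∈ V ∧
      ∃ φ : EuclideanSpace ℝ (Fin n) → EuclideanSpace ℝ (Fin 2),
        IsBlowSphericalHomeo ((γ '' Set.Ioo (-ε) ε) ∩ U) (cuspSet ∩ V) φ) ↔
    (∃ v : EuclideanSpace ℝ (Fin n), v ≠ 0 ∧
      tangentConeAtZero (γ '' Set.Ioo (-ε) ε) = (fun t : ℝ => t • v) '' Set.Ici 0) := by
  obtain ⟨δ, hδc, hδ⟩ := hhomeo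
  have h0I : (0 : ℝ) ∈ Ioo (-ε) ε := ⟨by linarith, hε⟩
  have hInhd : Ioo (-ε) ε ∈ 𝓝 (0 : ℝ) := isOpen_Ioo.mem_nhds h0I
  have hγc : ContinuousOn γ (Ioo (-ε) ε) := hγan.continuousOn
  have hne : ∀ t ∈ Ioo (-ε) ε, t ≠ 0 → γ t ≠ 0 := by
    intro t ht ht0 h
    rw [← hγ0] at h
    exact ht0 (hinj ht h0I h)
  have hlim0 : Tendsto γ (𝓝 0) (𝓝 0) := by
    have := (hγan 0 h0I).continuousAt.tendsto
    rwa [hγ0] at this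
  obtain ⟨k, g, hgan, hg0, hfg⟩ :=
    (hγan 0 h0I).exists_eventuallyEq_pow_smul_nonzero_iff.mpr (by
      intro h
      have h1 : ∀ᶠ t in 𝓝[≠] (0 : ℝ), γ t = 0 ∧ t ∈ Ioo (-ε) ε ∧ t ≠ 0 := by
        filter_upwards [nhdsWithin_le_nhds h, nhdsWithin_le_nhds hInhd, self_mem_nhdsWithin]
          with t a b c using ⟨a, b, c⟩
      obtain ⟨t, a, b, c⟩ := h1.exists
      exact hne t b c a)
  simp only [sub_zero] at hfg
  have hgc := hgan.continuousAt
  set u := ‖g 0‖⁻¹ • g 0 with hudef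
  have hune : u ≠ 0 := smul_ne_zero (inv_ne_zero (norm_ne_zero_iff.mpr hg0)) hg0
  have hpos : Tendsto (fun t => ‖γ t‖⁻¹ • γ t) (𝓝[>] 0) (𝓝 ((1 : ℝ) • u)) := by
    refine aux_dir hgc hg0 nhdsWithin_le_nhds hfg ?_
    filter_upwards [self_mem_nhdsWithin] with t ht
    have : 0 < t ^ k := pow_pos ht k
    rw [abs_of_pos this]
    field_simp
  rw [one_smul] at hpos
  have hXr : ∀ᶠ t in 𝓝[>] (0 : ℝ), γ t ∈ (γ '' Ioo (-ε) ε) \ {0} := by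
    filter_upwards [nhdsWithin_le_nhds hInhd, self_mem_nhdsWithin] with t a b
    exact ⟨⟨t, a, rfl⟩, hne t a (ne_of_gt b)⟩
  have hXl : ∀ᶠ t in 𝓝[<] (0 : ℝ), γ t ∈ (γ '' Ioo (-ε) ε) \ {0} := by
    filter_upwards [nhdsWithin_le_nhds hInhd, self_mem_nhdsWithin] with t a b
    exact ⟨⟨t, a, rfl⟩, hne t a (ne_of_lt b)⟩
  have hlr : Tendsto γ (𝓝[>] 0) (𝓝 0) := hlim0.mono_left nhdsWithin_le_nhds
  have hll : Tendsto γ (𝓝[<] 0) (𝓝 0) := hlim0.mono_left nhdsWithin_le_nhds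
  rcases Nat.even_or_odd k with hk | hk
  · have hu : Tendsto (fun t => ‖γ t‖⁻¹ • γ t) (𝓝[≠] 0) (𝓝 ((1 : ℝ) • u)) := by
      refine aux_dir hgc hg0 nhdsWithin_le_nhds hfg ?_
      filter_upwards [self_mem_nhdsWithin] with t ht
      have : 0 < t ^ k := hk.pow_pos ht
      rw [abs_of_pos this]
      field_simp
    rw [one_smul] at hu
    refine iff_of_true ?_ ?_
    · have ha : 0 < ε / 2 := by linarith
      have hsub : Icc (-(ε / 2)) (ε / 2) ⊆ Ioo (-ε) ε := fun t ht =>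
        ⟨by linarith [ht.1], by linarith [ht.2]⟩
      obtain ⟨U, hU, hUeq⟩ := (continuousOn_iff'.mp hδc) (Ioo (-(ε / 2)) (ε / 2)) isOpen_Ioo
      have hΓ : γ '' Ioo (-ε) ε ∩ U = γ '' Ioo (-(ε / 2)) (ε / 2) := by
        rw [inter_comm, ← hUeq]
        ext x
        constructor
        · rintro ⟨h1, t, ht, rfl⟩
          rw [mem_preimage, hδ t ht] at h1
          exact ⟨t, h1, rfl⟩
        · rintro ⟨t, ht, rfl⟩
          have ht' := hsub (Ioo_subset_Icc_self ht)
          refine ⟨?_, t, ht', rfl⟩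
          rw [mem_preimage, hδ t ht']
          exact ht
      refine ⟨U, {p | p 0 < (ε / 2) ^ 2}, hU, ?_, ?_, ?_, ?_⟩
      · have : (0 : EuclideanSpace ℝ (Fin n)) ∈ γ '' Ioo (-ε) ε ∩ U := by
          rw [hΓ]
          exact ⟨0, ⟨by linarith, ha⟩, hγ0⟩
        exact this.2
      · exact isOpen_lt (by fun_prop) continuous_const
      · simp only [mem_setOf_eq, PiLp.zero_apply]
        positivity
      · rw [hΓ, aux_cusp_nhd ha]
        exact aux_homeo ha hγ0 (hγc.mono hsub) (hinj.mono hsub) hu auxC_zero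
          auxC_cont.continuousOn auxC_inj.injOn auxC_dir
    · refine ⟨u, hune, Subset.antisymm ?_ ?_⟩
      · intro v hv
        exact ⟨‖v‖, norm_nonneg v, (aux_cone_sub hγ0 h0I hδc hδ hu hv).symm⟩
      · rintro _ ⟨s, hs, rfl⟩
        exact aux_cone_mem hXr hlr hpos hs
  · have hneg : Tendsto (fun t => ‖γ t‖⁻¹ • γ t) (𝓝[<] 0) (𝓝 ((-1 : ℝ) • u)) := by
      refine aux_dir hgc hg0 nhdsWithin_le_nhds hfg ?_
      filter_upwards [self_mem_nhdsWithin] with t ht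
      have : t ^ k < 0 := hk.pow_neg ht
      rw [abs_of_neg this]
      have := this.ne
      field_simp
    refine iff_of_false ?_ ?_
    · rintro ⟨U, V, hU, h0U, hV, h0V, φ, hφ0, hφb, hφc, -, Φ, hΦb, hΦc, -, hΦ⟩
      have h0X : (0 : EuclideanSpace ℝ (Fin n)) ∈ γ '' Ioo (-ε) ε ∩ U := ⟨⟨0, h0I, hγ0⟩, h0U⟩
      have key : ∀ (l : Filter ℝ) [l.NeBot] (w : EuclideanSpace ℝ (Fin n)), Tendsto γ l (𝓝 0) →
          (∀ᶠ t in l, γ t ∈ (γ '' Ioo (-ε) ε) \ {0}) →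
          Tendsto (fun t => ‖γ t‖⁻¹ • γ t) l (𝓝 w) →
          (w, (0 : ℝ)) ∈ strictTransform (γ '' Ioo (-ε) ε ∩ U) ∧
          Φ (w, 0) = ((1 : ℝ) • ‖(!₂[1, 0] : EuclideanSpace ℝ (Fin 2))‖⁻¹ • !₂[1, 0], 0) := by
        intro l _ w hl hX hw
        have hXU : ∀ᶠ t in l, γ t ∈ (γ '' Ioo (-ε) ε ∩ U) \ {0} := by
          filter_upwards [hX, hl.eventually (hU.mem_nhds h0U)] with t a b
          exact ⟨⟨a.1, b⟩, a.2⟩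
        have hnorm : Tendsto (fun t => ‖γ t‖) l (𝓝 0) := by simpa using hl.norm
        have hb : Tendsto (fun t => sphBlowup (γ t)) l (𝓝 (w, 0)) := hw.prodMk_nhds hnorm
        have hmem : ∀ᶠ t in l, sphBlowup (γ t) ∈ sphBlowup '' ((γ '' Ioo (-ε) ε ∩ U) \ {0}) := by
          filter_upwards [hXU] with t a using ⟨_, a, rfl⟩
        have hw' : (w, (0 : ℝ)) ∈ strictTransform (γ '' Ioo (-ε) ε ∩ U) :=
          mem_closure_of_tendsto hb hmem
        refine ⟨hw', ?_⟩
        have h1 : Tendsto (fun t => Φ (sphBlowup (γ t))) l (𝓝 (Φ (w, 0))) := by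
          refine (hΦc _ hw').tendsto.comp (tendsto_nhdsWithin_iff.mpr ⟨hb, ?_⟩)
          filter_upwards [hmem] with t a using subset_closure a
        have h2 : Tendsto (fun t => φ (γ t)) l (𝓝 0) := by
          have := (hφc 0 h0X).tendsto
          rw [hφ0] at this
          refine this.comp (tendsto_nhdsWithin_iff.mpr ⟨hl, ?_⟩)
          filter_upwards [hXU] with t a using a.1
        have h3 : ∀ᶠ t in l, φ (γ t) ∈ cuspSet \ {0} := by
          filter_upwards [hXU] with t a
          refine ⟨(hφb.mapsTo a.1).1, fun h => a.2 ?_⟩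
          have h' : φ (γ t) = φ 0 := by rw [hφ0]; exact h
          exact hφb.injOn a.1 h0X h'
        refine tendsto_nhds_unique h1 ((aux_cusp_lim h3 h2).congr' ?_)
        filter_upwards [hXU] with t a using (hΦ _ a).symm
      obtain ⟨m1, e1⟩ := key _ _ hlr hXr hpos
      obtain ⟨m2, e2⟩ := key _ _ hll hXl hneg
      have h := congrArg Prod.fst (hΦb.injOn m1 m2 (e1.trans e2.symm))
      simp only [neg_smul, one_smul] at h
      have h4 : (2 : ℝ) • u = 0 := by
        rw [two_smul]
        nth_rewrite 1 [h]
        exact neg_add_cancel u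
      exact hune ((smul_eq_zero.mp h4).resolve_left two_ne_zero)
    · rintro ⟨v, hv, hcone⟩
      have m1 := aux_cone_mem hXr hlr hpos zero_le_one
      have m2 := aux_cone_mem hXl hll hneg zero_le_one
      rw [hcone] at m1 m2
      obtain ⟨s, hs, hs'⟩ := m1
      obtain ⟨r, hr, hr'⟩ := m2
      simp only [one_smul, neg_smul] at hs' hr'
      have h0 : (s + r) • v = 0 := by rw [add_smul, hs', hr', add_neg_cancel]
      have hs0 : 0 ≤ s := hs
      have hr0 : 0 ≤ r := hr
      have h1 : s + r = 0 := (smul_eq_zero.mp h0).resolve_right hv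
      have h2 : s = 0 := by linarith
      rw [h2, zero_smul] at hs'
      exact hune hs'.symm
end

section
/- Let Ω ⊆ ℝⁿ be open with 0 ∈ Ω and let X ⊆ Ω be a real analytic subset of Ω with 0 ∈ X, i.e., every point p ∈ Ω has an open neighborhood V ⊆ Ω and finitely many real analytic functions f_1, …, f_m : V → ℝ with X ∩ V = {x ∈ V : f_1(x) = ⋯ = f_m(x) = 0}. Then X is C^∞ regular at 0 if and only if X is C^ω regular at 0; that is, if some neighborhood of 0 in X is a C^∞ submanifold of ℝⁿ, then some neighborhood of 0 in X is a real analytic submanifold of ℝⁿ. -/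
open Filter Set Topology

/-- `S` is a `C^∞` submanifold of `ℝⁿ` of dimension `d`: every point of `S` admits an
open neighborhood `W` and a `C^∞` diffeomorphism `Φ` from `W` onto an open set with
`Φ '' (S ∩ W) = Φ '' W ∩ (ℝ^d × {0})`. -/
def IsSmoothSubmanifoldOfDim {n : ℕ} (S : Set (EuclideanSpace ℝ (Fin n))) (d : ℕ) : Prop :=
  ∀ p ∈ S, ∃ (W : Set (EuclideanSpace ℝ (Fin n)))
      (Φ : EuclideanSpace ℝ (Fin n) → EuclideanSpace ℝ (Fin n)),
    IsOpen W ∧ p ∈ W ∧ IsOpen (Φ '' W) ∧ ContDiffOn ℝ (⊤ : ℕ∞) Φ W ∧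
    (∃ Ψ, Set.InvOn Ψ Φ W (Φ '' W) ∧ ContDiffOn ℝ (⊤ : ℕ∞) Ψ (Φ '' W)) ∧
    Φ '' (S ∩ W) = (Φ '' W) ∩ {x | ∀ i : Fin n, d ≤ (i : ℕ) → x i = 0}

/-- `S` is a real analytic (`C^ω`) submanifold of `ℝⁿ` of dimension `d`: every point of
`S` admits an open neighborhood `W` and a bijective real analytic map `Φ` from `W` onto
an open set, with real analytic inverse, such that
`Φ '' (S ∩ W) = Φ '' W ∩ (ℝ^d × {0})`. -/
def IsAnalyticSubmanifoldOfDim {n : ℕ} (S : Set (EuclideanSpace ℝ (Fin n))) (d : ℕ) : Prop :=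
  ∀ p ∈ S, ∃ (W : Set (EuclideanSpace ℝ (Fin n)))
      (Φ : EuclideanSpace ℝ (Fin n) → EuclideanSpace ℝ (Fin n)),
    IsOpen W ∧ p ∈ W ∧ IsOpen (Φ '' W) ∧ AnalyticOnNhd ℝ Φ W ∧ Set.InjOn Φ W ∧
    (∃ Ψ, Set.InvOn Ψ Φ W (Φ '' W) ∧ AnalyticOnNhd ℝ Ψ (Φ '' W)) ∧
    Φ '' (S ∩ W) = (Φ '' W) ∩ {x | ∀ i : Fin n, d ≤ (i : ℕ) → x i = 0}

/-- `X` is `C^∞` regular at `0`. -/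
def IsSmoothRegularAtZero {n : ℕ} (X : Set (EuclideanSpace ℝ (Fin n))) : Prop :=
  ∃ U : Set (EuclideanSpace ℝ (Fin n)), IsOpen U ∧ 0 ∈ U ∧
    ∃ d : ℕ, IsSmoothSubmanifoldOfDim (X ∩ U) d

/-- `X` is `C^ω` regular at `0`. -/
def IsAnalyticRegularAtZero {n : ℕ} (X : Set (EuclideanSpace ℝ (Fin n))) : Prop :=
  ∃ U : Set (EuclideanSpace ℝ (Fin n)), IsOpen U ∧ 0 ∈ U ∧
    ∃ d : ℕ, IsAnalyticSubmanifoldOfDim (X ∩ U) d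


lemma cont_compCLM {P W : Type*} [NormedAddCommGroup P] [NormedSpace ℝ P] [NormedAddCommGroup W]
    [NormedSpace ℝ W] (n : ℕ) (p : ContinuousMultilinearMap ℝ (fun _ : Fin n => P) W)
    (S : ℝ → P →L[ℝ] P) (hS : Continuous S) :
    Continuous (fun θ => p.compContinuousLinearMap (fun _ => S θ)) := by
  have := (ContinuousMultilinearMap.compContinuousLinearMapContinuousMultilinear ℝ
    (fun _ : Fin n => P) (fun _ : Fin n => P) W).cont
  have h2 := this.comp (continuous_pi (fun _ : Fin n => hS))
  exact (ContinuousLinearMap.apply ℝ _ p).continuous.comp h2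

lemma analyticAt_avg {P W : Type*} [NormedAddCommGroup P] [NormedSpace ℝ P] [NormedAddCommGroup W]
    [NormedSpace ℝ W] [CompleteSpace W] (g : P → W) (hg : AnalyticAt ℝ g 0)
    (S : ℝ → P →L[ℝ] P) (hS : Continuous S) (hS1 : ∀ θ ∈ Icc (0:ℝ) 1, ‖S θ‖ ≤ 1) :
    AnalyticAt ℝ (fun x => ∫ θ in (0:ℝ)..1, g (S θ x)) 0 := by
  obtain ⟨p, r, hp⟩ := hg
  let q : FormalMultilinearSeries ℝ P W := fun n =>
    ∫ θ in (0:ℝ)..1, (p n).compContinuousLinearMap (fun _ => S θ)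
  have hb : ∀ n, ∀ θ ∈ uIoc (0:ℝ) 1, ‖(p n).compContinuousLinearMap (fun _ => S θ)‖ ≤ ‖p n‖ := by
    intro n θ hθ
    rw [uIoc_of_le zero_le_one] at hθ
    refine (ContinuousMultilinearMap.norm_compContinuousLinearMap_le _ _).trans ?_
    have h1 : ∏ _i : Fin n, ‖S θ‖ ≤ 1 :=
      Finset.prod_le_one (fun _ _ => norm_nonneg _) (fun _ _ => hS1 θ ⟨hθ.1.le, hθ.2⟩)
    exact mul_le_of_le_one_right (norm_nonneg _) h1
  have hq : ∀ n, ‖q n‖ ≤ ‖p n‖ := by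
    intro n
    have := intervalIntegral.norm_integral_le_of_norm_le_const (hb n)
    simpa using this
  have happ : ∀ n (x : P), q n (fun _ => x) = ∫ θ in (0:ℝ)..1, (p n) (fun _ => S θ x) := by
    intro n x
    have := (ContinuousMultilinearMap.apply ℝ (fun _ : Fin n => P) W
      (fun _ => x)).intervalIntegral_comp_comm
      ((cont_compCLM n (p n) S hS).intervalIntegrable (μ := MeasureTheory.volume) 0 1)
    exact this.symm
  refine ⟨q, r, ⟨hp.r_le.trans (FormalMultilinearSeries.radius_le_of_le hq), hp.r_pos, ?_⟩⟩
  intro y hy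
  simp only [happ, zero_add]
  have hyr : ‖y‖ₑ < r := by simpa using hy
  have hsum : Summable fun n => ‖p n‖ * ‖y‖ ^ n := by
    have := p.summable_norm_mul_pow (r := ‖y‖₊) (lt_of_lt_of_le hyr hp.r_le)
    simpa using this
  refine intervalIntegral.hasSum_integral_of_dominated_convergence
    (fun n _ => ‖p n‖ * ‖y‖ ^ n) ?_ ?_ ?_ ?_ ?_
  · intro n
    have hc : Continuous fun θ => (p n) (fun _ => S θ y) :=
      (p n).cont.comp (continuous_pi fun _ => (ContinuousLinearMap.apply ℝ P y).continuous.comp hS)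
    exact hc.aestronglyMeasurable
  · intro n
    refine Eventually.of_forall fun θ hθ => ?_
    have := ((p n).compContinuousLinearMap (fun _ => S θ)).le_opNorm (fun _ => y)
    simp only [Finset.prod_const, Finset.card_univ, Fintype.card_fin] at this
    exact this.trans (by gcongr; exact hb n θ hθ)
  · exact Eventually.of_forall fun _ _ => hsum
  · exact intervalIntegrable_const
  · refine Eventually.of_forall fun θ hθ => ?_
    rw [uIoc_of_le zero_le_one] at hθ
    have h1 : S θ y ∈ Metric.eball (0:P) r := by
      have h2 : ‖S θ y‖ ≤ ‖y‖ := by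
        refine ((S θ).le_opNorm y).trans ?_
        exact mul_le_of_le_one_left (norm_nonneg _) (hS1 θ ⟨hθ.1.le, hθ.2⟩)
      have h3 : ‖S θ y‖ₑ ≤ ‖y‖ₑ := enorm_le_iff_norm_le.2 h2
      simpa using lt_of_le_of_lt h3 hyr
    simpa using hp.hasSum h1

lemma analytic_div {Z W : Type*} [NormedAddCommGroup Z] [NormedSpace ℝ Z] [NormedAddCommGroup W]
    [NormedSpace ℝ W] [CompleteSpace W] (K : ℝ × Z → W) (hK : AnalyticAt ℝ K 0) :
    ∃ K₁ : ℝ × Z → W, AnalyticAt ℝ K₁ 0 ∧ (∀ᶠ q in 𝓝 (0 : ℝ × Z), K q = K (0, q.2) + q.1 • K₁ q) ∧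
      ∀ z, K₁ (0, z) = fderiv ℝ K (0, z) (1, 0) := by
  let S : ℝ → (ℝ × Z) →L[ℝ] (ℝ × Z) := fun θ =>
    θ • ((ContinuousLinearMap.inl ℝ ℝ Z).comp (ContinuousLinearMap.fst ℝ ℝ Z)) +
      ((ContinuousLinearMap.inr ℝ ℝ Z).comp (ContinuousLinearMap.snd ℝ ℝ Z))
  have hSv : ∀ θ q, S θ q = (θ * q.1, q.2) := by
    intro θ q; simp [S]
  have hS : Continuous S := by fun_prop
  have hS2 : ∀ θ ∈ Icc (0:ℝ) 1, ∀ q, ‖S θ q‖ ≤ ‖q‖ := by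
    intro θ hθ q
    rw [hSv, Prod.norm_def, Prod.norm_def]
    refine max_le_max ?_ le_rfl
    rw [norm_mul]
    refine mul_le_of_le_one_left (norm_nonneg _) ?_
    rw [Real.norm_eq_abs, abs_of_nonneg hθ.1]; exact hθ.2
  have hS1 : ∀ θ ∈ Icc (0:ℝ) 1, ‖S θ‖ ≤ 1 := fun θ hθ =>
    ContinuousLinearMap.opNorm_le_bound _ zero_le_one (by simpa using hS2 θ hθ)
  have hD : AnalyticAt ℝ (fun q => fderiv ℝ K q ((1:ℝ), (0:Z))) 0 :=
    ((ContinuousLinearMap.apply ℝ W ((1:ℝ), (0:Z))).analyticAt _).fun_comp hK.fderiv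
  refine ⟨_, analyticAt_avg _ hD S hS hS1, ?_, ?_⟩
  · obtain ⟨ε, hε, hball⟩ := Metric.eventually_nhds_iff_ball.1 hK.eventually_analyticAt
    refine Metric.eventually_nhds_iff_ball.2 ⟨ε, hε, fun q hq => ?_⟩
    have hmem : ∀ θ ∈ Icc (0:ℝ) 1, S θ q ∈ Metric.ball (0 : ℝ × Z) ε := by
      intro θ hθ
      simp only [mem_ball_zero_iff] at hq ⊢
      exact (hS2 θ hθ q).trans_lt hq
    have hderiv : ∀ θ ∈ uIcc (0:ℝ) 1, HasDerivAt (fun θ => K (S θ q))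
        (q.1 • fderiv ℝ K (S θ q) ((1:ℝ), (0:Z))) θ := by
      intro θ hθ
      rw [uIcc_of_le zero_le_one] at hθ
      have h1 := (hball _ (hmem θ hθ)).differentiableAt.hasFDerivAt
      have h2 : HasDerivAt (fun θ => S θ q) (q.1, (0:Z)) θ := by
        simp only [hSv]
        exact (hasDerivAt_mul_const q.1).prodMk (hasDerivAt_const _ _)
      have h3 := h1.comp_hasDerivAt θ h2
      have h4 : (q.1, (0:Z)) = q.1 • ((1:ℝ), (0:Z)) := by simp
      rw [h4, map_smul] at h3
      exact h3
    have hcont : ContinuousOn (fun θ => q.1 • fderiv ℝ K (S θ q) ((1:ℝ), (0:Z))) (uIcc 0 1) := by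
      intro θ hθ
      rw [uIcc_of_le zero_le_one] at hθ
      have h1 := (hball _ (hmem θ hθ)).fderiv.continuousAt
      have h2 : ContinuousAt (fun θ => S θ q) θ := by
        simp only [hSv]; fun_prop
      have h3 : ContinuousAt (fun θ => fderiv ℝ K (S θ q)) θ :=
        ContinuousAt.comp (f := fun θ => S θ q) h1 h2
      exact ((h3.clm_apply continuousAt_const).const_smul _).continuousWithinAt
    have := intervalIntegral.integral_eq_sub_of_hasDerivAt hderiv hcont.intervalIntegrable
    rw [intervalIntegral.integral_smul] at this
    simp only [hSv, one_mul, zero_mul] at this ⊢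
    rw [this]; simp
  · intro z
    simp [hSv]

lemma analytic_taylor2 {E : Type*} [NormedAddCommGroup E] [NormedSpace ℝ E] [CompleteSpace E]
    (f : ℝ × E → ℝ) (hf : AnalyticAt ℝ f 0) (T : ℝ → E) (hT : AnalyticAt ℝ T 0) (hT0 : T 0 = 0) :
    ∃ R : ℝ × (ℝ × E) → ℝ, AnalyticAt ℝ R 0 ∧ ∀ᶠ q in 𝓝 (0 : ℝ × (ℝ × E)),
      f (q.2.1, T q.2.1 + q.1 • q.2.2) = f (q.2.1, T q.2.1) +
        q.1 * fderiv ℝ f (q.2.1, T q.2.1) (0, q.2.2) + q.1 ^ 2 * R q := by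
  let c : ℝ × (ℝ × E) → ℝ × E := fun q => (q.2.1, T q.2.1 + q.1 • q.2.2)
  have hTc : AnalyticAt ℝ (fun q : ℝ × (ℝ × E) => T q.2.1) 0 :=
    AnalyticAt.fun_comp (g := T) (f := fun q : ℝ × (ℝ × E) => q.2.1) hT
      (analyticAt_fst.fun_comp analyticAt_snd)
  have hc : AnalyticAt ℝ c 0 := by
    refine AnalyticAt.prod (analyticAt_fst.fun_comp analyticAt_snd)
      (hTc.add (analyticAt_fst.smul (analyticAt_snd.fun_comp analyticAt_snd)))
  have hc0 : c 0 = 0 := by simp [c, hT0]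
  have hK : AnalyticAt ℝ (fun q => f (c q)) 0 := AnalyticAt.fun_comp (g := f) (by rwa [hc0]) hc
  obtain ⟨K₁, hK₁, hd1, hz1⟩ := analytic_div _ hK
  obtain ⟨K₂, hK₂, hd2, hz2⟩ := analytic_div _ hK₁
  refine ⟨K₂, hK₂, ?_⟩
  have hev : ∀ᶠ q in 𝓝 (0 : ℝ × (ℝ × E)), AnalyticAt ℝ T q.2.1 ∧ AnalyticAt ℝ f (q.2.1, T q.2.1) := by
    have h1 : Tendsto (fun q : ℝ × (ℝ × E) => q.2.1) (𝓝 0) (𝓝 0) := by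
      have : ContinuousAt (fun q : ℝ × (ℝ × E) => q.2.1) 0 := by fun_prop
      simpa [ContinuousAt] using this
    have h2 : Tendsto (fun q : ℝ × (ℝ × E) => (q.2.1, T q.2.1)) (𝓝 0) (𝓝 0) := by
      have : ContinuousAt (fun q : ℝ × (ℝ × E) => (q.2.1, T q.2.1)) 0 :=
        ContinuousAt.prodMk (by fun_prop) hTc.continuousAt
      have h0 : ((0:ℝ), (0:E)) = 0 := rfl
      simpa [ContinuousAt, hT0, h0] using this
    exact (h1.eventually hT.eventually_analyticAt).and (h2.eventually hf.eventually_analyticAt)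
  filter_upwards [hd1, hd2, hev] with q h1 h2 h3
  have h4 : fderiv ℝ (fun q => f (c q)) (0, q.2) (1, 0) = fderiv ℝ f (q.2.1, T q.2.1) (0, q.2.2) := by
    have hcq : c (0, q.2) = (q.2.1, T q.2.1) := by simp [c]
    have hT' : HasFDerivAt T (fderiv ℝ T q.2.1) ((0, q.2) : ℝ × (ℝ × E)).2.1 :=
      h3.1.differentiableAt.hasFDerivAt
    have e1 : HasFDerivAt (fun q : ℝ × (ℝ × E) => q.2.1) ((ContinuousLinearMap.fst ℝ ℝ E).comp
      (ContinuousLinearMap.snd ℝ ℝ (ℝ × E))) (0, q.2) := by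
      exact ContinuousLinearMap.hasFDerivAt ((ContinuousLinearMap.fst ℝ ℝ E).comp
        (ContinuousLinearMap.snd ℝ ℝ (ℝ × E)))
    have e2 : HasFDerivAt (fun q : ℝ × (ℝ × E) => q.2.2) ((ContinuousLinearMap.snd ℝ ℝ E).comp
      (ContinuousLinearMap.snd ℝ ℝ (ℝ × E))) (0, q.2) := by
      exact ContinuousLinearMap.hasFDerivAt ((ContinuousLinearMap.snd ℝ ℝ E).comp
        (ContinuousLinearMap.snd ℝ ℝ (ℝ × E)))
    have e3 := hT'.comp (0, q.2) e1
    have e4 := e1.prodMk (e3.add (HasFDerivAt.smul (hasFDerivAt_fst (𝕜 := ℝ) (p := (0, q.2))) e2))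
    have e5 : HasFDerivAt f (fderiv ℝ f (q.2.1, T q.2.1)) (c (0, q.2)) := by
      rw [hcq]; exact h3.2.differentiableAt.hasFDerivAt
    have e6 := HasFDerivAt.comp (f := c) (0, q.2) e5 e4
    have e7 := e6.fderiv
    change fderiv ℝ (f ∘ c) (0, q.2) (1, 0) = _
    rw [e7]
    simp
  rw [hz1, h4] at h2
  have hcq : c (0, q.2) = (q.2.1, T q.2.1) := by simp [c]
  rw [h2, hcq] at h1
  change f (c q) = _
  rw [h1]
  simp only [smul_eq_mul]
  ring

open Asymptotics
set_option linter.unusedSectionVars false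

def FlatAt {W : Type*} [NormedAddCommGroup W] (u : ℝ → W) : Prop :=
  ∀ N : ℕ, u =O[𝓝 0] (fun t : ℝ => t ^ N)

def Appr {W : Type*} [NormedAddCommGroup W] [NormedSpace ℝ W] (y : ℝ → W) : Prop :=
  ∀ N : ℕ, ∃ T : ℝ → W, AnalyticAt ℝ T 0 ∧ (fun t => y t - T t) =O[𝓝 0] (fun t : ℝ => t ^ N)

section
variable {W : Type*} [NormedAddCommGroup W] [NormedSpace ℝ W]
variable {P : Type*} [NormedAddCommGroup P] [NormedSpace ℝ P]

lemma bigO_zero {u : ℝ → W} {N : ℕ} (hN : N ≠ 0) (h : u =O[𝓝 0] (fun t : ℝ => t ^ N)) : u 0 = 0 := by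
  have := h.eq_zero_imp.self_of_nhds
  exact this (by simp [hN])

lemma pow_bigO {M N : ℕ} (h : M ≤ N) : (fun t : ℝ => t ^ N) =O[𝓝 0] (fun t : ℝ => t ^ M) := by
  refine IsBigO.of_bound 1 ?_
  have : ∀ᶠ t : ℝ in 𝓝 0, ‖t‖ < 1 := by
    have h : Tendsto (fun t : ℝ => ‖t‖) (𝓝 0) (𝓝 0) := tendsto_norm_zero
    exact h.eventually (gt_mem_nhds one_pos)
  filter_upwards [this] with t ht
  rw [norm_pow, norm_pow, one_mul]
  exact pow_le_pow_of_le_one (norm_nonneg _) ht.le h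

lemma lip_bigO {G : P → W} {p : P} (hG : AnalyticAt ℝ G p) {a b : ℝ → P}
    (ha : Tendsto a (𝓝 0) (𝓝 p)) (hb : Tendsto b (𝓝 0) (𝓝 p)) :
    (fun t => G (a t) - G (b t)) =O[𝓝 0] (fun t => a t - b t) := by
  have := hG.hasStrictFDerivAt.isBigO_sub
  exact this.comp_tendsto (k := fun t => (a t, b t)) (ha.prodMk_nhds hb)

lemma bigO_iff_factor {u : ℝ → W} (hu : AnalyticAt ℝ u 0) (N : ℕ)
    (h : u =O[𝓝 0] (fun t : ℝ => t ^ N)) :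
    ∃ g : ℝ → W, AnalyticAt ℝ g 0 ∧ ∀ᶠ t in 𝓝 (0:ℝ), u t = t ^ N • g t := by
  have key : (N : ℕ∞) ≤ analyticOrderAt u 0 := by
    by_contra hlt
    push Not at hlt
    obtain ⟨m, hm⟩ := ENat.ne_top_iff_exists.1 (ne_top_of_lt hlt)
    obtain ⟨g, hg, hg0, hev⟩ := (hu.analyticOrderAt_eq_natCast).1 hm.symm
    rw [← hm] at hlt
    have hmN : m < N := by exact_mod_cast hlt
    obtain ⟨C, hC⟩ := h.bound
    have hlim : Tendsto (fun t : ℝ => ‖g t‖ ) (𝓝[≠] 0) (𝓝 0) := by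
      have hz : Tendsto (fun t : ℝ => C * ‖t‖ ^ (N - m)) (𝓝[≠] 0) (𝓝 0) := by
        have : ContinuousAt (fun t : ℝ => C * ‖t‖ ^ (N - m)) 0 := by fun_prop
        have h2 := this.tendsto
        simp only [norm_zero, zero_pow (Nat.sub_ne_zero_of_lt hmN), mul_zero] at h2
        exact h2.mono_left nhdsWithin_le_nhds
      refine squeeze_zero' (Eventually.of_forall fun _ => norm_nonneg _) ?_ hz
      filter_upwards [hev.filter_mono nhdsWithin_le_nhds, hC.filter_mono nhdsWithin_le_nhds,
        self_mem_nhdsWithin] with t h1 h2 h3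
      have h3' : t ≠ 0 := h3
      rw [h1, sub_zero, norm_smul, norm_pow, norm_pow] at h2
      have hp : 0 < ‖t‖ ^ m := by positivity
      have : ‖t‖ ^ N = ‖t‖ ^ m * ‖t‖ ^ (N - m) := by rw [← pow_add]; congr 1; omega
      rw [this] at h2
      have h4 : ‖t‖ ^ m * ‖g t‖ ≤ ‖t‖ ^ m * (C * ‖t‖ ^ (N - m)) := by linarith
      exact le_of_mul_le_mul_left h4 hp
    have hlim2 : Tendsto (fun t : ℝ => ‖g t‖ ) (𝓝[≠] 0) (𝓝 ‖g 0‖) :=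
      hg.continuousAt.norm.tendsto.mono_left nhdsWithin_le_nhds
    exact hg0 (norm_eq_zero.1 (tendsto_nhds_unique hlim2 hlim))
  obtain ⟨g, hg, hev⟩ := (natCast_le_analyticOrderAt hu).1 key
  exact ⟨g, hg, by simpa using hev⟩

lemma factor_bigO {u g : ℝ → W} (hg : ContinuousAt g 0) (N : ℕ)
    (h : ∀ᶠ t in 𝓝 (0:ℝ), u t = t ^ N • g t) : u =O[𝓝 0] (fun t : ℝ => t ^ N) := by
  have h1 : (fun t : ℝ => t ^ N • g t) =O[𝓝 0] (fun t : ℝ => t ^ N • (1:ℝ)) :=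
    (isBigO_refl _ _).smul (hg.tendsto.isBigO_one ℝ)
  refine IsBigO.congr' h1 (EventuallyEq.symm h) (by simp)

lemma flat_analytic_zero {u : ℝ → W} (hu : AnalyticAt ℝ u 0) (h : FlatAt u) :
    ∀ᶠ t in 𝓝 (0:ℝ), u t = 0 := by
  rw [← analyticOrderAt_eq_top]
  rw [ENat.eq_top_iff_forall_ge]
  intro N
  rw [natCast_le_analyticOrderAt hu]
  obtain ⟨g, hg, hev⟩ := bigO_iff_factor hu N (h N)
  exact ⟨g, hg, by simpa using hev⟩

lemma FlatAt.zero {u : ℝ → W} (h : FlatAt u) : u 0 = 0 := bigO_zero one_ne_zero (h 1)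

lemma FlatAt.trans {u : ℝ → W} {v : ℝ → P} (h : FlatAt v) (h' : u =O[𝓝 0] v) : FlatAt u :=
  fun N => h'.trans (h N)

lemma FlatAt.add {u v : ℝ → W} (h : FlatAt u) (h' : FlatAt v) : FlatAt (fun t => u t + v t) :=
  fun N => (h N).add (h' N)

lemma bigO_div {u : ℝ → W} (m N : ℕ) (h : (fun t : ℝ => t ^ m • u t) =O[𝓝 0] (fun t : ℝ => t ^ (m + N)))
    (h0 : u 0 = 0) : u =O[𝓝 0] (fun t : ℝ => t ^ N) := by
  obtain ⟨C, hCp, hC⟩ := h.exists_pos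
  refine IsBigO.of_bound C ?_
  filter_upwards [hC.bound] with t ht
  by_cases h1 : t = 0
  · subst h1
    rw [h0, norm_zero]; positivity
  · rw [norm_smul, pow_add, norm_mul] at ht
    have hp : 0 < ‖t ^ m‖ := norm_pos_iff.2 (pow_ne_zero _ h1)
    have h4 : ‖t ^ m‖ * ‖u t‖ ≤ ‖t ^ m‖ * (C * ‖t ^ N‖) := by linarith
    exact le_of_mul_le_mul_left h4 hp

lemma FlatAt.div {u : ℝ → W} (m : ℕ) (h : FlatAt (fun t : ℝ => t ^ m • u t))
    (h0 : u 0 = 0) : FlatAt u := fun N => bigO_div m N (h _) h0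

lemma Appr.tendsto {y : ℝ → W} (h : Appr y) (h0 : y 0 = 0) : Tendsto y (𝓝 0) (𝓝 0) := by
  obtain ⟨T, hT, hO⟩ := h 1
  have h1 : y 0 - T 0 = 0 := bigO_zero one_ne_zero hO
  have hT0 : T 0 = 0 := by rw [h0] at h1; simpa using h1
  have h2 : Tendsto (fun t => y t - T t) (𝓝 0) (𝓝 0) := by
    refine hO.trans_tendsto ?_
    have : ContinuousAt (fun t : ℝ => t ^ 1) 0 := by fun_prop
    simpa [ContinuousAt] using this
  have h3 := h2.add hT.continuousAt.tendsto
  simpa [hT0] using h3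

lemma Appr.clm {y : ℝ → P} (h : Appr y) (A : P →L[ℝ] W) : Appr (fun t => A (y t)) := by
  intro N
  obtain ⟨T, hT, hO⟩ := h N
  refine ⟨fun t => A (T t), (A.analyticAt _).fun_comp hT, ?_⟩
  simp only [← map_sub]
  exact (A.isBigO_comp _ _).trans hO

lemma dir_zero {F : P → ℝ} (hF : AnalyticAt ℝ F 0)
    (h : ∀ (v : P) (k : ℕ), ((fun (f : P → ℝ) x => fderiv ℝ f x v)^[k] F) 0 = 0) :
    ∀ᶠ x in 𝓝 (0:P), F x = 0 := by
  obtain ⟨ε, hε, hball⟩ := Metric.eventually_nhds_iff_ball.1 hF.eventually_analyticAt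
  refine Metric.eventually_nhds_iff_ball.2 ⟨ε, hε, fun x hx => ?_⟩
  let D : (P → ℝ) → (P → ℝ) := fun f z => fderiv ℝ f z x
  let B : Set ℝ := (fun s : ℝ => s • x) ⁻¹' (Metric.ball 0 ε)
  have hBo : IsOpen B := Metric.isOpen_ball.preimage (by fun_prop)
  have hBc : Convex ℝ B := (convex_ball (0:P) ε).linear_preimage (LinearMap.toSpanSingleton ℝ P x)
  have h0B : (0:ℝ) ∈ B := by simp [B, hε]
  have hDk : ∀ k, AnalyticOnNhd ℝ (D^[k] F) (Metric.ball 0 ε) := by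
    intro k
    induction k with
    | zero => exact hball
    | succ k ih =>
      rw [Function.iterate_succ_apply']
      intro z hz
      exact ((ContinuousLinearMap.apply ℝ ℝ x).analyticAt _).fun_comp (ih z hz).fderiv
  have hit : ∀ k, ∀ s ∈ B, iteratedDeriv k (fun s : ℝ => F (s • x)) s = (D^[k] F) (s • x) := by
    intro k
    induction k with
    | zero => intro s _; simp
    | succ k ih =>
      intro s hs
      rw [iteratedDeriv_succ, Function.iterate_succ_apply']
      have h1 : iteratedDeriv k (fun s : ℝ => F (s • x)) =ᶠ[𝓝 s] fun s => (D^[k] F) (s • x) := by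
        filter_upwards [hBo.mem_nhds hs] with r hr using ih r hr
      rw [h1.deriv_eq]
      have h2 := (hDk k (s • x) hs).differentiableAt.hasFDerivAt
      have h3 : HasDerivAt (fun s : ℝ => s • x) x s := by
        simpa using (hasDerivAt_id s).smul_const x
      exact (h2.comp_hasDerivAt s h3).deriv
  have han : AnalyticOnNhd ℝ (fun s : ℝ => F (s • x)) B := by
    intro s hs
    exact AnalyticAt.fun_comp (g := F) (f := fun s : ℝ => s • x) (hball _ hs)
      (analyticAt_id.smul analyticAt_const)
  have hev : ∀ᶠ s in 𝓝 (0:ℝ), F (s • x) = 0 := by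
    rw [← analyticOrderAt_eq_top, ENat.eq_top_iff_forall_ge]
    intro N
    rw [natCast_le_analyticOrderAt_iff_iteratedDeriv_eq_zero (han 0 h0B)]
    intro i _
    rw [hit i 0 h0B, zero_smul]
    exact h x i
  have := han.eqOn_zero_of_preconnected_of_eventuallyEq_zero hBc.isPreconnected h0B hev
  have h1 := this (show (1:ℝ) ∈ B by simpa [B] using hx)
  simpa using h1

end


lemma tendsto_graph {E : Type*} [NormedAddCommGroup E] {y : ℝ → E} (h : Tendsto y (𝓝 0) (𝓝 0)) :
    Tendsto (fun t => (t, y t)) (𝓝 (0:ℝ)) (𝓝 (0 : ℝ × E)) := tendsto_id.prodMk_nhds h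

lemma graph_sub_bigO {E : Type*} [NormedAddCommGroup E] [NormedSpace ℝ E] (y T : ℝ → E) :
    (fun t => ((t, y t) : ℝ × E) - (t, T t)) =O[𝓝 0] (fun t => y t - T t) := by
  refine IsBigO.of_bound 1 (Eventually.of_forall fun t => ?_)
  simp [Prod.norm_def]

lemma graph_lip {E W : Type*} [NormedAddCommGroup E] [NormedSpace ℝ E] [NormedAddCommGroup W]
    [NormedSpace ℝ W] {G : ℝ × E → W} (hG : AnalyticAt ℝ G 0) {y T : ℝ → E}
    (hy : Tendsto y (𝓝 0) (𝓝 0)) (hT : Tendsto T (𝓝 0) (𝓝 0)) :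
    (fun t => G (t, y t) - G (t, T t)) =O[𝓝 0] (fun t => y t - T t) :=
  (lip_bigO hG (tendsto_graph hy) (tendsto_graph hT)).trans (graph_sub_bigO y T)

lemma appr_get {E : Type*} [NormedAddCommGroup E] [NormedSpace ℝ E] {y : ℝ → E}
    (hy : Appr y) (h0 : y 0 = 0) (N : ℕ) (hN : N ≠ 0) : ∃ T : ℝ → E, AnalyticAt ℝ T 0 ∧ T 0 = 0 ∧
      (fun t => y t - T t) =O[𝓝 0] (fun t : ℝ => t ^ N) := by
  obtain ⟨T, hT, hO⟩ := hy N
  refine ⟨T, hT, ?_, hO⟩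
  have h1 : y 0 - T 0 = 0 := bigO_zero hN hO
  rw [h0] at h1; simpa using h1

lemma dt_flat {E : Type*} [NormedAddCommGroup E] [NormedSpace ℝ E] [CompleteSpace E]
    {f : ℝ × E → ℝ} (hf : AnalyticAt ℝ f 0) {y : ℝ → E} (hy : Appr y) (h0 : y 0 = 0)
    (hfl : FlatAt (fun t => f (t, y t)))
    (hD : FlatAt (fun t => (fderiv ℝ f (t, y t)).comp (ContinuousLinearMap.inr ℝ ℝ E)))
    (v : ℝ × E) : FlatAt (fun t => fderiv ℝ f (t, y t) v) := by
  have hyt := hy.tendsto h0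
  intro N
  obtain ⟨T, hT, hT0, hO⟩ := appr_get hy h0 (N + 1) (by omega)
  have hTt : Tendsto T (𝓝 0) (𝓝 0) := by simpa [hT0] using hT.continuousAt.tendsto
  have hON : (fun t => y t - T t) =O[𝓝 0] (fun t : ℝ => t ^ N) := hO.trans (pow_bigO (by omega))
  have hTy : (fun t => T t - y t) =O[𝓝 0] (fun t : ℝ => t ^ N) := by
    simpa using hON.neg_left
  have hTy1 : (fun t => T t - y t) =O[𝓝 0] (fun t : ℝ => t ^ (N + 1)) := by
    simpa using hO.neg_left
  -- φ
  have hφO : (fun t => f (t, T t)) =O[𝓝 0] (fun t : ℝ => t ^ (N + 1)) := by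
    have := ((graph_lip hf hTt hyt).trans hTy1).add (hfl (N + 1))
    simpa using this
  have hc : AnalyticAt ℝ (fun t => (t, T t)) (0:ℝ) := analyticAt_id.prod hT
  have hφ : AnalyticAt ℝ (fun t => f (t, T t)) 0 :=
    AnalyticAt.fun_comp (g := f) (f := fun t => (t, T t)) (by rw [hT0]; exact hf) hc
  obtain ⟨g, hg, hev⟩ := bigO_iff_factor hφ _ hφO
  have hdφ : (fun t => deriv (fun t => f (t, T t)) t) =O[𝓝 0] (fun t : ℝ => t ^ N) := by
    refine factor_bigO (g := fun t => ((N:ℝ) + 1) * g t + t * deriv g t) ?_ N ?_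
    · have := hg.continuousAt
      have := hg.deriv.continuousAt
      fun_prop
    · filter_upwards [hev.eventually_nhds, hg.eventually_analyticAt] with t ht hgt
      rw [EventuallyEq.deriv_eq (show (fun t => f (t, T t)) =ᶠ[𝓝 t] _ from ht)]
      have h1 : HasDerivAt (fun t : ℝ => t ^ (N + 1) * g t)
        (((N + 1 : ℕ) : ℝ) * t ^ N * g t + t ^ (N + 1) * deriv g t) t :=
        (hasDerivAt_pow (N + 1) t).mul hgt.differentiableAt.hasDerivAt
      simp only [smul_eq_mul]
      rw [h1.deriv]; push_cast; ring
  have hD2 : AnalyticAt ℝ (fun p => (fderiv ℝ f p).comp (ContinuousLinearMap.inr ℝ ℝ E)) 0 :=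
    (((ContinuousLinearMap.compL ℝ E (ℝ × E) ℝ).flip
      (ContinuousLinearMap.inr ℝ ℝ E)).analyticAt _).fun_comp hf.fderiv
  have hDT : (fun t => (fderiv ℝ f (t, T t)).comp (ContinuousLinearMap.inr ℝ ℝ E)) =O[𝓝 0]
      (fun t : ℝ => t ^ N) := by
    have := ((graph_lip hD2 hTt hyt).trans hTy).add (hD N)
    simpa using this
  have hDTapp : ∀ w : ℝ → E, ContinuousAt w 0 →
      (fun t => fderiv ℝ f (t, T t) (0, w t)) =O[𝓝 0] (fun t : ℝ => t ^ N) := by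
    intro w hw
    have h1 : (fun t => fderiv ℝ f (t, T t) (0, w t)) =O[𝓝 0]
      (fun t => ‖(fderiv ℝ f (t, T t)).comp (ContinuousLinearMap.inr ℝ ℝ E)‖ * ‖w t‖) := by
      refine IsBigO.of_bound 1 (Eventually.of_forall fun t => ?_)
      have := ((fderiv ℝ f (t, T t)).comp (ContinuousLinearMap.inr ℝ ℝ E)).le_opNorm (w t)
      simpa using this
    have h2 := hDT.norm_left.mul (hw.norm.tendsto.isBigO_one ℝ)
    refine h1.trans (h2.trans ?_)
    simpa using isBigO_refl _ _
  have hv1 : (fun t => fderiv ℝ f (t, T t) (1, 0)) =O[𝓝 0] (fun t : ℝ => t ^ N) := by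
    have h1 := hDTapp (fun t => deriv T t) hT.deriv.continuousAt
    refine (hdφ.sub h1).congr' ?_ EventuallyEq.rfl
    have hfT : ∀ᶠ t in 𝓝 (0:ℝ), AnalyticAt ℝ f (t, T t) :=
      (tendsto_graph hTt).eventually hf.eventually_analyticAt
    filter_upwards [hfT, hT.eventually_analyticAt] with t h1 h2
    have h3 : HasDerivAt (fun t => (t, T t)) ((1:ℝ), deriv T t) t :=
      (hasDerivAt_id t).prodMk h2.differentiableAt.hasDerivAt
    have h4 := HasFDerivAt.comp_hasDerivAt (f := fun t => (t, T t)) t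
      h1.differentiableAt.hasFDerivAt h3
    have h5 : deriv (fun t => f (t, T t)) t = fderiv ℝ f (t, T t) (1, deriv T t) := h4.deriv
    simp only [h5]
    rw [← map_sub]; simp
  have hvv : (fun t => fderiv ℝ f (t, T t) v) =O[𝓝 0] (fun t : ℝ => t ^ N) := by
    have := (hv1.const_mul_left v.1).add (hDTapp (fun _ => v.2) continuousAt_const)
    refine this.congr' (Eventually.of_forall fun t => ?_) EventuallyEq.rfl
    have hv : v = v.1 • ((1:ℝ), (0:E)) + (0, v.2) := by ext <;> simp
    beta_reduce
    conv_rhs => rw [hv]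
    rw [map_add, map_smul]; simp
  have hDv : AnalyticAt ℝ (fun p => fderiv ℝ f p v) 0 :=
    ((ContinuousLinearMap.apply ℝ ℝ v).analyticAt _).fun_comp hf.fderiv
  have := ((graph_lip hDv hyt hTt).trans hON).add hvv
  simpa using this

lemma caseB {E : Type*} [NormedAddCommGroup E] [NormedSpace ℝ E] [CompleteSpace E]
    {y : ℝ → E} (hy : Appr y) (h0 : y 0 = 0)
    (hB : ∀ f : ℝ × E → ℝ, AnalyticAt ℝ f 0 → FlatAt (fun t => f (t, y t)) →
      FlatAt (fun t => (fderiv ℝ f (t, y t)).comp (ContinuousLinearMap.inr ℝ ℝ E)))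
    {F : ℝ × E → ℝ} (hF : AnalyticAt ℝ F 0) (hfl : FlatAt (fun t => F (t, y t))) :
    ∀ᶠ x in 𝓝 (0 : ℝ × E), F x = 0 := by
  refine dir_zero hF fun v k => ?_
  have : AnalyticAt ℝ ((fun (f : ℝ × E → ℝ) x => fderiv ℝ f x v)^[k] F) 0 ∧
      FlatAt (fun t => ((fun (f : ℝ × E → ℝ) x => fderiv ℝ f x v)^[k] F) (t, y t)) := by
    induction k with
    | zero => exact ⟨hF, hfl⟩
    | succ k ih =>
      rw [Function.iterate_succ_apply']
      exact ⟨((ContinuousLinearMap.apply ℝ ℝ v).analyticAt _).fun_comp ih.1.fderiv,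
        dt_flat ih.1 hy h0 ih.2 (hB _ ih.1 ih.2) v⟩
  have h2 := this.2.zero
  rw [h0] at h2
  exact h2


lemma local_inv {P : Type*} [NormedAddCommGroup P] [NormedSpace ℝ P] [CompleteSpace P]
    {n : WithTop ℕ∞} (hn : n ≠ 0) {Θ : P → P} (hΘ : ContDiffAt ℝ n Θ 0) (h0 : Θ 0 = 0)
    (hd : HasFDerivAt Θ (ContinuousLinearMap.id ℝ P) 0) :
    ∃ Ξ : P → P, ContDiffAt ℝ n Ξ 0 ∧ Ξ 0 = 0 ∧ (∀ᶠ q in 𝓝 0, Θ (Ξ q) = q) ∧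
      ∀ᶠ q in 𝓝 0, Ξ (Θ q) = q := by
  have hd' : HasFDerivAt Θ ((ContinuousLinearEquiv.refl ℝ P : P ≃L[ℝ] P) : P →L[ℝ] P) 0 := hd
  have hs := hΘ.hasStrictFDerivAt' hd' hn
  refine ⟨hΘ.localInverse hd' hn, ?_, ?_, ?_, ?_⟩
  · have := hΘ.to_localInverse hd' hn
    rwa [h0] at this
  · have := hΘ.localInverse_apply_image hd' hn
    rwa [h0] at this
  · have := hs.eventually_right_inverse
    rw [h0] at this
    exact this
  · exact hs.eventually_left_inverse

lemma step {E : Type*} [NormedAddCommGroup E] [NormedSpace ℝ E] [FiniteDimensional ℝ E]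
    {y : ℝ → E} (hy : Appr y) (h0 : y 0 = 0) {f : ℝ × E → ℝ} (hf : AnalyticAt ℝ f 0)
    (hfl : FlatAt (fun t => f (t, y t)))
    (hnf : ¬ FlatAt (fun t => (fderiv ℝ f (t, y t)).comp (ContinuousLinearMap.inr ℝ ℝ E))) :
    ∃ (l : E →L[ℝ] ℝ) (u : E) (d : ℕ) (T : ℝ → E) (ζ : ℝ × l.ker → ℝ) (k : ℝ → l.ker),
      l u = 1 ∧ d ≠ 0 ∧ AnalyticAt ℝ T 0 ∧ T 0 = 0 ∧ AnalyticAt ℝ ζ 0 ∧ ζ 0 = 0 ∧ Appr k ∧ k 0 = 0 ∧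
      FlatAt (fun t => y t - (T t + t ^ d • ((k t : E) + ζ (t, k t) • u))) := by
  have := FiniteDimensional.complete ℝ E
  have hyt := hy.tendsto h0
  simp only [FlatAt, not_forall] at hnf
  obtain ⟨N0, hN0⟩ := hnf
  obtain ⟨T, hT, hT0, hO⟩ := appr_get hy h0 (2 * N0 + 4) (by omega)
  have hTt : Tendsto T (𝓝 0) (𝓝 0) := by simpa [hT0] using hT.continuousAt.tendsto
  have hTy : (fun t => T t - y t) =O[𝓝 0] (fun t : ℝ => t ^ (2 * N0 + 4)) := by
    simpa using hO.neg_left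
  have hc : AnalyticAt ℝ (fun t => (t, T t)) (0:ℝ) := analyticAt_id.prod hT
  have hD2 : AnalyticAt ℝ (fun p => (fderiv ℝ f p).comp (ContinuousLinearMap.inr ℝ ℝ E)) 0 :=
    (((ContinuousLinearMap.compL ℝ E (ℝ × E) ℝ).flip
      (ContinuousLinearMap.inr ℝ ℝ E)).analyticAt _).fun_comp hf.fderiv
  have hDTa : AnalyticAt ℝ
      (fun t => (fderiv ℝ f (t, T t)).comp (ContinuousLinearMap.inr ℝ ℝ E)) 0 :=
    AnalyticAt.fun_comp (f := fun t => (t, T t)) (by rw [hT0]; exact hD2) hc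
  have hnO : ¬ (fun t => (fderiv ℝ f (t, T t)).comp (ContinuousLinearMap.inr ℝ ℝ E)) =O[𝓝 0]
      (fun t : ℝ => t ^ N0) := by
    intro h
    apply hN0
    have := ((graph_lip hD2 hyt hTt).trans (hO.trans (pow_bigO (M := N0) (by omega)))).add h
    simpa using this
  have hord : analyticOrderAt
      (fun t => (fderiv ℝ f (t, T t)).comp (ContinuousLinearMap.inr ℝ ℝ E)) 0 < N0 := by
    by_contra hge
    push Not at hge
    obtain ⟨g, hg, hev⟩ := (natCast_le_analyticOrderAt hDTa).1 hge
    exact hnO (factor_bigO hg.continuousAt N0 (by simpa using hev))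
  obtain ⟨e, he⟩ := ENat.ne_top_iff_exists.1 (ne_top_of_lt hord)
  obtain ⟨L, hL, hL0, hLev⟩ := (hDTa.analyticOrderAt_eq_natCast).1 he.symm
  rw [← he] at hord
  have heN : e < N0 := by exact_mod_cast hord
  simp only [sub_zero] at hLev
  -- f (t, T t)
  have hφO : (fun t => f (t, T t)) =O[𝓝 0] (fun t : ℝ => t ^ (2 * e + 4)) := by
    have := ((graph_lip hf hTt hyt).trans (hTy.trans (pow_bigO (M := 2 * e + 4) (by omega)))).add
      (hfl (2 * e + 4))
    simpa using this
  have hφ : AnalyticAt ℝ (fun t => f (t, T t)) 0 :=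
    AnalyticAt.fun_comp (g := f) (f := fun t => (t, T t)) (by rw [hT0]; exact hf) hc
  obtain ⟨a, ha, haev⟩ := bigO_iff_factor hφ _ hφO
  obtain ⟨R, hR, hRev⟩ := analytic_taylor2 f hf T hT hT0
  -- h
  let A : ℝ × E → ℝ := fun p => a p.1 + R (p.1 ^ (e + 2), (p.1, p.2))
  let h : ℝ × E → ℝ := fun p => p.1 ^ 2 * A p + L p.1 p.2
  have hr : AnalyticAt ℝ (fun p : ℝ × E => (p.1 ^ (e + 2), (p.1, p.2))) 0 :=
    (analyticAt_fst.pow _).prod (analyticAt_fst.prod analyticAt_snd)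
  have hr0 : (fun p : ℝ × E => (p.1 ^ (e + 2), (p.1, p.2))) 0 = 0 := by
    simp
  have hA : AnalyticAt ℝ A 0 := by
    refine AnalyticAt.add (ha.fun_comp (f := fun p : ℝ × E => p.1) (x := 0) analyticAt_fst) ?_
    exact AnalyticAt.fun_comp (g := R) (by have := hR; rw [← hr0] at this; exact this) hr
  have hLc : AnalyticAt ℝ (fun p : ℝ × E => L p.1) 0 :=
    hL.fun_comp (f := fun p : ℝ × E => p.1) (x := 0) analyticAt_fst
  have hh : AnalyticAt ℝ h 0 := by
    have h1 : ContDiffAt ℝ ⊤ A 0 := hA.contDiffAt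
    have h2 : ContDiffAt ℝ ⊤ (fun p : ℝ × E => L p.1) 0 := hLc.contDiffAt
    have h3 : ContDiffAt ℝ ⊤ h 0 := by
      refine ContDiffAt.add (by fun_prop) (h2.clm_apply contDiffAt_snd)
    exact h3.analyticAt
  have hh0 : h 0 = 0 := by simp [h]
  have hfh : ∀ᶠ p in 𝓝 (0 : ℝ × E), f (p.1, T p.1 + p.1 ^ (e + 2) • p.2) =
      p.1 ^ (2 * e + 2) * h p := by
    have t1 : Tendsto (fun p : ℝ × E => (p.1 ^ (e + 2), (p.1, p.2))) (𝓝 0) (𝓝 0) := by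
      have := hr.continuousAt.tendsto
      rwa [show ((0 : ℝ × E).1 ^ (e + 2), ((0 : ℝ × E).1, (0 : ℝ × E).2)) = 0 from hr0] at this
    have t2 : Tendsto (fun p : ℝ × E => p.1) (𝓝 0) (𝓝 0) := continuous_fst.tendsto' _ _ rfl
    filter_upwards [t1.eventually hRev, t2.eventually haev, t2.eventually hLev] with p h1 h2 h3
    have h4 : fderiv ℝ f (p.1, T p.1) (0, p.2) = p.1 ^ e * L p.1 p.2 := by
      have := congrArg (fun B : E →L[ℝ] ℝ => B p.2) h3
      simpa using this
    rw [h1, h2, h4]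
    simp only [h, A, smul_eq_mul]
    ring
  have hhd : HasFDerivAt h ((L 0).comp (ContinuousLinearMap.snd ℝ ℝ E)) 0 := by
    have d1 : HasFDerivAt (fun p : ℝ × E => p.1 ^ 2) (0 : (ℝ × E) →L[ℝ] ℝ) 0 := by
      have := (hasFDerivAt_fst (𝕜 := ℝ) (E := ℝ) (F := E) (p := 0)).pow 2
      simpa using this
    have d2 := d1.mul hA.differentiableAt.hasFDerivAt
    have d3 := hLc.differentiableAt.hasFDerivAt.clm_apply (hasFDerivAt_snd (𝕜 := ℝ) (E := ℝ) (F := E) (p := 0))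
    have d4 := d2.add d3
    refine d4.congr_fderiv ?_
    ext <;> simp
  -- linear algebra
  set l : E →L[ℝ] ℝ := L 0 with hl
  obtain ⟨u, hu⟩ : ∃ u, l u = 1 := by
    obtain ⟨w, hw⟩ : ∃ w, l w ≠ 0 := by
      by_contra hcon
      push Not at hcon
      exact hL0 (by ext w; simpa using hcon w)
    exact ⟨(l w)⁻¹ • w, by simp [hw]⟩
  let π₀ : E →L[ℝ] E := ContinuousLinearMap.id ℝ E - l.smulRight u
  have hπ₀ : ∀ w, π₀ w ∈ l.ker := by
    intro w
    simp [π₀, hu]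
  let π : E →L[ℝ] l.ker := π₀.codRestrict l.ker hπ₀
  have hπ : ∀ w, ((π w : l.ker) : E) = w - l w • u := by
    intro w
    simp [π, π₀]
  let c : ℝ × (l.ker × ℝ) → ℝ × E := fun q => (q.1, (q.2.1 : E) + q.2.2 • u)
  let cL : (ℝ × (l.ker × ℝ)) →L[ℝ] ℝ × E :=
    (ContinuousLinearMap.fst ℝ ℝ (l.ker × ℝ)).prod
      ((l.ker.subtypeL.comp (ContinuousLinearMap.fst ℝ l.ker ℝ)
       + (ContinuousLinearMap.snd ℝ l.ker ℝ).smulRight u).comp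
        (ContinuousLinearMap.snd ℝ ℝ (l.ker × ℝ)))
  have hcL : ∀ q, cL q = c q := by intro q; simp [cL, c]
  let Θ : ℝ × (l.ker × ℝ) → ℝ × (l.ker × ℝ) := fun q => (q.1, (q.2.1, h (cL q)))
  have hhc : ContDiffAt ℝ ⊤ (fun q => h (cL q)) 0 :=
    (AnalyticAt.fun_comp (g := h) (f := cL) (by rw [map_zero]; exact hh) (cL.analyticAt _)).contDiffAt
  have hΘ : ContDiffAt ℝ ⊤ Θ 0 :=
    contDiffAt_fst.prodMk (ContDiffAt.prodMk (by fun_prop) hhc)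
  have hΘ0 : Θ 0 = 0 := by
    simp only [Θ, map_zero, hh0]; rfl
  have hΘd : HasFDerivAt Θ (ContinuousLinearMap.id ℝ (ℝ × (l.ker × ℝ))) 0 := by
    have e1 : HasFDerivAt h (l.comp (ContinuousLinearMap.snd ℝ ℝ E)) (cL 0) := by
      rw [map_zero]; exact hhd
    have e2 := e1.comp 0 cL.hasFDerivAt
    have e3 := (hasFDerivAt_fst (𝕜 := ℝ) (E := ℝ) (F := l.ker × ℝ) (p := 0)).prodMk
      ((((ContinuousLinearMap.fst ℝ l.ker ℝ).comp
        (ContinuousLinearMap.snd ℝ ℝ (l.ker × ℝ))).hasFDerivAt (x := 0)).prodMk e2)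
    refine e3.congr_fderiv ?_
    refine ContinuousLinearMap.ext fun q => ?_
    have hk : l (q.2.1 : E) = 0 := q.2.1.2
    have h5 : l (cL q).2 = q.2.2 := by
      rw [hcL]; simp [c, hk, hu]
    simp only [ContinuousLinearMap.prod_apply, ContinuousLinearMap.comp_apply,
      ContinuousLinearMap.coe_fst', ContinuousLinearMap.coe_snd', ContinuousLinearMap.id_apply, h5]
  obtain ⟨Ξ, hΞ, hΞ0, hΘΞ, hΞΘ⟩ := local_inv (by simp) hΘ hΘ0 hΘd
  have hΞa : AnalyticAt ℝ Ξ 0 := hΞ.analyticAt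
  -- the curve z
  let z : ℝ → E := fun t => (t ^ (e + 2))⁻¹ • (y t - T t)
  have hz0 : z 0 = 0 := by simp [z]
  have hzy : ∀ t, t ^ (e + 2) • z t = y t - T t := by
    intro t
    by_cases ht : t = 0
    · subst ht; simp [hT0, h0]
    · simp only [z]
      rw [smul_inv_smul₀ (pow_ne_zero _ ht)]
  have hz : Appr z := by
    intro N
    obtain ⟨T', hT', hT'0, hO'⟩ := appr_get hy h0 (e + 2 + (N + (2 * N0 + 4))) (by omega)
    have h1 : (fun t => T' t - T t) =O[𝓝 0] (fun t : ℝ => t ^ (e + 3)) := by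
      have h2 := (hO.trans (pow_bigO (M := e + 3) (by omega))).sub
        (hO'.trans (pow_bigO (M := e + 3) (by omega)))
      simpa using h2
    obtain ⟨g, hg, hgev⟩ := bigO_iff_factor (hT'.sub hT) _ h1
    have hgT : AnalyticAt ℝ (fun t : ℝ => t • g t) 0 := analyticAt_id.smul hg
    refine ⟨fun t => t • g t, hgT, ?_⟩
    refine bigO_div (e + 2) N ?_ (by simp [hz0])
    have h3 := hO'.trans (pow_bigO (M := e + 2 + N) (by omega))
    refine h3.congr' ?_ EventuallyEq.rfl
    filter_upwards [hgev] with t ht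
    rw [smul_sub, hzy, smul_smul, ← pow_succ]
    rw [show e + 2 + 1 = e + 3 from rfl, ← ht]
    simp
  have hzt := hz.tendsto hz0
  have hhz : FlatAt (fun t => h (t, z t)) := by
    refine FlatAt.div (2 * e + 2) ?_ (by rw [hz0]; exact hh0)
    refine hfl.trans (EventuallyEq.isBigO ?_)
    filter_upwards [(tendsto_graph hzt).eventually hfh] with t ht
    rw [smul_eq_mul, ← ht, hzy]; simp
  let k : ℝ → l.ker := fun t => π (z t)
  have hk : Appr k := hz.clm π
  have hk0 : k 0 = 0 := by simp [k, hz0]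
  have hkt := hk.tendsto hk0
  let ζ : ℝ × l.ker → ℝ := fun p => (Ξ (p.1, (p.2, 0))).2.2
  have hin : AnalyticAt ℝ (fun p : ℝ × l.ker => (p.1, (p.2, (0:ℝ)))) 0 :=
    analyticAt_fst.prod (analyticAt_snd.prod analyticAt_const)
  have hζ : AnalyticAt ℝ ζ 0 := by
    have h1 : AnalyticAt ℝ (fun p : ℝ × l.ker => Ξ (p.1, (p.2, (0:ℝ)))) 0 :=
      AnalyticAt.fun_comp (g := Ξ) hΞa hin
    exact (((ContinuousLinearMap.snd ℝ l.ker ℝ).comp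
      (ContinuousLinearMap.snd ℝ ℝ (l.ker × ℝ))).analyticAt _).fun_comp h1
  have hζ0 : ζ 0 = 0 := by
    change (Ξ 0).2.2 = 0
    rw [hΞ0]; rfl
  refine ⟨l, u, e + 2, T, ζ, k, hu, by omega, hT, hT0, hζ, hζ0, hk, hk0, ?_⟩
  have hcz : ∀ t, cL (t, (k t, l (z t))) = (t, z t) := by
    intro t
    rw [hcL]; simp [c, k, hπ]
  have hσ : FlatAt (fun t => l (z t) - ζ (t, k t)) := by
    have ta : Tendsto (fun t => (t, (k t, h (t, z t)))) (𝓝 (0:ℝ)) (𝓝 (0 : ℝ × (l.ker × ℝ))) := by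
      have : Tendsto (fun t => h (t, z t)) (𝓝 0) (𝓝 0) := by
        have := hh.continuousAt.tendsto.comp (tendsto_graph hzt)
        rwa [hh0] at this
      exact tendsto_id.prodMk_nhds (hkt.prodMk_nhds this)
    have tb : Tendsto (fun t => (t, (k t, (0:ℝ)))) (𝓝 (0:ℝ)) (𝓝 (0 : ℝ × (l.ker × ℝ))) :=
      tendsto_id.prodMk_nhds (hkt.prodMk_nhds tendsto_const_nhds)
    have tc : Tendsto (fun t => (t, (k t, l (z t)))) (𝓝 (0:ℝ)) (𝓝 (0 : ℝ × (l.ker × ℝ))) := by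
      have : Tendsto (fun t => l (z t)) (𝓝 0) (𝓝 0) := by
        have := (l.continuous.tendsto 0).comp hzt
        rwa [map_zero] at this
      exact tendsto_id.prodMk_nhds (hkt.prodMk_nhds this)
    refine (hhz.trans (u := fun t => ((t, (k t, h (t, z t))) : ℝ × (l.ker × ℝ)) - (t, (k t, 0))) ?_).trans
      (IsBigO.trans ?_ (lip_bigO hΞa ta tb))
    · refine IsBigO.of_bound 1 (Eventually.of_forall fun t => ?_)
      simp [Prod.norm_def]
    · refine IsBigO.of_bound 1 ?_
      filter_upwards [tc.eventually hΞΘ] with t ht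
      simp only [Θ, hcz] at ht
      rw [ht, one_mul]
      exact (norm_snd_le (((t,(k t,l (z t))) : ℝ × (l.ker × ℝ)) - Ξ (t,(k t,0))).2).trans (norm_snd_le _)
  have hfin : ∀ t, y t - (T t + t ^ (e + 2) • ((k t : E) + ζ (t, k t) • u)) =
      t ^ (e + 2) • ((l (z t) - ζ (t, k t)) • u) := by
    intro t
    rw [← sub_sub, ← hzy, ← smul_sub, hπ]
    congr 1
    module
  simp only [hfin]
  refine hσ.trans ?_
  have b1 : (fun t : ℝ => t ^ (e + 2)) =O[𝓝 0] (fun _ => (1:ℝ)) := by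
    simpa using pow_bigO (M := 0) (N := e + 2) (by omega)
  have b2 : (fun t => (l (z t) - ζ (t, k t)) • u) =O[𝓝 0] (fun t => l (z t) - ζ (t, k t)) := by
    refine IsBigO.of_bound ‖u‖ (Eventually.of_forall fun t => ?_)
    rw [norm_smul, mul_comm]
  simpa using b1.smul b2


universe u

lemma curve_lemma_aux (m : ℕ) : ∀ (E : Type u) [NormedAddCommGroup E] [NormedSpace ℝ E]
    [FiniteDimensional ℝ E] (_ : Module.finrank ℝ E = m) (F : ℝ × E → ℝ) (_ : AnalyticAt ℝ F 0)
    (y : ℝ → E) (_ : Appr y) (_ : y 0 = 0) (_ : FlatAt (fun t => F (t, y t)))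
    (_ : ∀ᶠ q : ℝ × (E × E) in 𝓝 0, q.1 ≠ 0 → F (q.1, q.2.1) = 0 → F (q.1, q.2.2) = 0 →
      q.2.1 = q.2.2),
    ∃ Y : ℝ → E, AnalyticAt ℝ Y 0 ∧ Y 0 = 0 ∧ ∀ᶠ t in 𝓝 (0:ℝ), F (t, Y t) = 0 := by
  induction m with
  | zero =>
    intro E _ _ _ hE F hF y hy h0 hfl _
    have hs : Subsingleton E := Module.finrank_zero_iff.1 hE
    refine ⟨y, ?_, h0, ?_⟩
    · have : y = fun _ => 0 := funext fun t => Subsingleton.elim _ _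
      rw [this]; exact analyticAt_const
    · refine flat_analytic_zero ?_ hfl
      have : y = fun _ => 0 := funext fun t => Subsingleton.elim _ _
      rw [this]
      exact AnalyticAt.fun_comp (g := F) (f := fun t : ℝ => (t, (0:E))) hF
        (analyticAt_id.prod analyticAt_const)
  | succ m ih =>
    intro E _ _ _ hE F hF y hy h0 hfl huniq
    have := FiniteDimensional.complete ℝ E
    by_cases hB : ∀ f : ℝ × E → ℝ, AnalyticAt ℝ f 0 → FlatAt (fun t => f (t, y t)) →
      FlatAt (fun t => (fderiv ℝ f (t, y t)).comp (ContinuousLinearMap.inr ℝ ℝ E))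
    · exfalso
      have hF0 := caseB hy h0 hB hF hfl
      have : Nontrivial E := Module.nontrivial_of_finrank_pos (R := ℝ) (by omega)
      obtain ⟨w, hw⟩ := exists_ne (0 : E)
      have t1 : Tendsto (fun s : ℝ => (s, (s • w, (0:E)))) (𝓝[≠] 0) (𝓝 0) := by
        have : Continuous (fun s : ℝ => (s, (s • w, (0:E)))) := by fun_prop
        exact (this.tendsto' 0 0 (by simp)).mono_left nhdsWithin_le_nhds
      have t2 : Tendsto (fun s : ℝ => (s, s • w)) (𝓝[≠] 0) (𝓝 0) := by
        have : Continuous (fun s : ℝ => (s, s • w)) := by fun_prop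
        exact (this.tendsto' 0 0 (by simp)).mono_left nhdsWithin_le_nhds
      have t3 : Tendsto (fun s : ℝ => (s, (0:E))) (𝓝[≠] 0) (𝓝 0) := by
        have : Continuous (fun s : ℝ => (s, (0:E))) := by fun_prop
        exact (this.tendsto' 0 0 (by simp)).mono_left nhdsWithin_le_nhds
      obtain ⟨s, h1, h2, h3, h4⟩ := ((t1.eventually huniq).and ((t2.eventually hF0).and
        ((t3.eventually hF0).and self_mem_nhdsWithin))).exists
      have h5 : s • w = 0 := h1 h4 h2 h3
      rcases smul_eq_zero.1 h5 with h | h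
      · exact h4 h
      · exact hw h
    · push Not at hB
      obtain ⟨f, hf, hffl, hnf⟩ := hB
      obtain ⟨l, u, d, T, ζ, k, hu, hd, hT, hT0, hζ, hζ0, hk, hk0, hflat⟩ := step hy h0 hf hffl hnf
      have hyt := hy.tendsto h0
      have hkt := hk.tendsto hk0
      have hrank : Module.finrank ℝ l.ker = m := by
        have h1 := LinearMap.finrank_range_add_finrank_ker (l : E →ₗ[ℝ] ℝ)
        have h2 : LinearMap.range (l : E →ₗ[ℝ] ℝ) = ⊤ := by
          rw [LinearMap.range_eq_top]
          intro c
          exact ⟨c • u, by simp [hu]⟩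
        rw [h2, hE] at h1
        simp at h1
        have h3 : Module.finrank ℝ l.ker = Module.finrank ℝ (LinearMap.ker (l : E →ₗ[ℝ] ℝ)) := rfl
        omega
      let B : ℝ × l.ker → E := fun p => T p.1 + p.1 ^ d • ((p.2 : E) + ζ p • u)
      have hBa : AnalyticAt ℝ B 0 := by
        refine (hT.fun_comp (f := fun p : ℝ × l.ker => p.1) (x := 0) analyticAt_fst).add ?_
        refine (analyticAt_fst.pow d).smul (AnalyticAt.add ?_ (hζ.smul analyticAt_const))
        exact (l.ker.subtypeL.analyticAt _).fun_comp analyticAt_snd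
      have hB0 : B 0 = 0 := by simp [B, hT0, hd]
      have hBt : Tendsto B (𝓝 0) (𝓝 0) := by simpa [hB0] using hBa.continuousAt.tendsto
      have hGr : AnalyticAt ℝ (fun p : ℝ × l.ker => (p.1, B p)) 0 := analyticAt_fst.prod hBa
      let F' : ℝ × l.ker → ℝ := fun p => F (p.1, B p)
      have hF' : AnalyticAt ℝ F' 0 :=
        AnalyticAt.fun_comp (g := F) (f := fun p : ℝ × l.ker => (p.1, B p)) (by rw [hB0]; exact hF) hGr
      have hBk : Tendsto (fun t => B (t, k t)) (𝓝 0) (𝓝 0) := hBt.comp (tendsto_graph hkt)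
      have hF'fl : FlatAt (fun t => F' (t, k t)) := by
        have h1 : FlatAt (fun t => F (t, B (t, k t)) - F (t, y t)) := by
          refine hflat.trans ((graph_lip hF hBk hyt).trans ?_)
          refine IsBigO.of_bound 1 (Eventually.of_forall fun t => ?_)
          rw [one_mul, ← norm_neg, neg_sub]
        have := h1.add hfl
        simpa using this
      have hu' : ∀ᶠ q : ℝ × (l.ker × l.ker) in 𝓝 0, q.1 ≠ 0 → F' (q.1, q.2.1) = 0 →
          F' (q.1, q.2.2) = 0 → q.2.1 = q.2.2 := by
        have t1 : Tendsto (fun q : ℝ × (l.ker × l.ker) => (q.1, (B (q.1, q.2.1), B (q.1, q.2.2))))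
            (𝓝 0) (𝓝 0) := by
          have c1 : Continuous (fun q : ℝ × (l.ker × l.ker) => (q.1, q.2.1)) := by fun_prop
          have c2 : Continuous (fun q : ℝ × (l.ker × l.ker) => (q.1, q.2.2)) := by fun_prop
          have c0 : Continuous (fun q : ℝ × (l.ker × l.ker) => q.1) := by fun_prop
          exact (c0.tendsto' 0 0 rfl).prodMk_nhds ((hBt.comp (c1.tendsto' 0 0 rfl)).prodMk_nhds
            (hBt.comp (c2.tendsto' 0 0 rfl)))
        filter_upwards [t1.eventually huniq] with q hq hq0 e1 e2
        have h1 : B (q.1, q.2.1) = B (q.1, q.2.2) := hq hq0 e1 e2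
        simp only [B, add_right_inj] at h1
        have h2 := smul_right_injective E (pow_ne_zero d hq0) h1
        have hl := congrArg l h2
        have k1 : l (q.2.1 : E) = 0 := q.2.1.2
        have k2 : l (q.2.2 : E) = 0 := q.2.2.2
        simp [k1, k2, hu] at hl
        rw [hl] at h2
        exact Subtype.ext (add_right_cancel h2)
      obtain ⟨Y', hY', hY'0, hY'F⟩ := ih l.ker hrank F' hF' k hk hk0 hF'fl hu'
      refine ⟨fun t => B (t, Y' t), ?_, ?_, hY'F⟩
      · exact AnalyticAt.fun_comp (g := B) (f := fun t => (t, Y' t)) (by rw [hY'0]; exact hBa)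
          (analyticAt_id.prod hY')
      · simp only [hY'0]; exact hB0

lemma smooth_appr {W : Type*} [NormedAddCommGroup W] [NormedSpace ℝ W] {y : ℝ → W}
    (hy : ContDiffAt ℝ (⊤ : ℕ∞) y 0) : Appr y := by
  intro N
  have hyN : ContDiffAt ℝ N y 0 := hy.of_le (by exact_mod_cast le_top)
  obtain ⟨s, hs, hys⟩ := hyN.contDiffOn (m := N) le_rfl (by simp)
  obtain ⟨ε, hε, hball⟩ := Metric.nhds_basis_ball.mem_iff.1 hs
  refine ⟨taylorWithinEval y N (Metric.ball 0 ε) 0, ?_, ?_⟩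
  · rw [show taylorWithinEval y N (Metric.ball 0 ε) 0 = fun x => _ from
      funext fun x => taylor_within_apply y N (Metric.ball 0 ε) 0 x]
    refine Finset.analyticAt_fun_sum _ fun i _ => ?_
    refine AnalyticAt.smul ?_ analyticAt_const
    exact analyticAt_const.mul ((analyticAt_id.sub analyticAt_const).pow _)
  · have := taylor_isLittleO (convex_ball (0:ℝ) ε) (Metric.mem_ball_self hε) (hys.mono hball)
    rw [Metric.isOpen_ball.nhdsWithin_eq (Metric.mem_ball_self hε)] at this
    simpa using this.isBigO


section polar
variable {E F : Type*} [NormedAddCommGroup E] [NormedSpace ℝ E] [NormedAddCommGroup F]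
  [NormedSpace ℝ F]

def sgB (b : Bool) : ℝ := if b then 1 else -1
def vaB (b : Bool) : ℝ := if b then 1 else 0
def coB {k : ℕ} (e : Fin k → Bool) : Option (Fin k) → ℝ
  | none => 1
  | some i => vaB (e i)
def weB {k : ℕ} (v0 : E) (v : Fin k → E) : Option (Fin k) → E
  | none => v0
  | some i => v i

lemma polar_miss {k : ℕ} (r : Fin k → Option (Fin k)) (i0 : Fin k) (h : ∀ j, r j ≠ some i0) :
    ∑ e : Fin k → Bool, (∏ i, sgB (e i)) * ∏ j, coB e (r j) = 0 := by
  let fl : (Fin k → Bool) → (Fin k → Bool) := fun e => Function.update e i0 (!e i0)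
  have hinv : Function.Involutive fl := by
    intro e
    simp [fl]
  have h1 : ∀ e, ∏ i, sgB (fl e i) = - ∏ i, sgB (e i) := by
    intro e
    rw [← Finset.mul_prod_erase _ _ (Finset.mem_univ i0),
      ← Finset.mul_prod_erase _ (fun i => sgB (e i)) (Finset.mem_univ i0), ← neg_mul]
    congr 1
    · simp only [fl, Function.update_self]
      cases e i0 <;> simp [sgB]
    · refine Finset.prod_congr rfl fun i hi => ?_
      simp [fl, Function.update_of_ne (Finset.ne_of_mem_erase hi)]
  have h2 : ∀ e, ∏ j, coB (fl e) (r j) = ∏ j, coB e (r j) := by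
    intro e
    refine Finset.prod_congr rfl fun j _ => ?_
    rcases hr : r j with _ | i
    · rfl
    · have : i ≠ i0 := by rintro rfl; exact h j hr
      simp [coB, fl, Function.update_of_ne this]
  have h3 := (Equiv.sum_comp (Function.Involutive.toPerm fl hinv)
    (fun e : Fin k → Bool => (∏ i, sgB (e i)) * ∏ j, coB e (r j)))
  simp only [Function.Involutive.coe_toPerm, h1, h2, neg_mul, Finset.sum_neg_distrib] at h3
  linarith

lemma polar_perm {k : ℕ} (σ : Equiv.Perm (Fin k)) :
    ∑ e : Fin k → Bool, (∏ i, sgB (e i)) * ∏ j, coB e (some (σ j)) = 1 := by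
  rw [Finset.sum_eq_single (fun _ => true)]
  · simp [sgB, coB, vaB]
  · intro e _ he
    obtain ⟨i, hi⟩ : ∃ i, e i ≠ true := by
      by_contra hcon
      push Not at hcon
      exact he (funext hcon)
    have : ∏ j, coB e (some (σ j)) = 0 :=
      Finset.prod_eq_zero (Finset.mem_univ (σ.symm i)) (by simp [coB, vaB, hi])
    rw [this, mul_zero]
  · simp

lemma polar {k : ℕ} (D : ContinuousMultilinearMap ℝ (fun _ : Fin k => E) F) (v0 : E)
    (v : Fin k → E) :
    ∑ σ : Equiv.Perm (Fin k), D (fun i => v (σ i)) =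
      ∑ e : Fin k → Bool, (∏ i, sgB (e i)) • D (fun _ => v0 + ∑ i, vaB (e i) • v i) := by
  have h1 : ∀ e : Fin k → Bool, D (fun _ => v0 + ∑ i, vaB (e i) • v i) =
      ∑ r : Fin k → Option (Fin k), (∏ j, coB e (r j)) • D (fun j => weB v0 v (r j)) := by
    intro e
    have : (fun _ : Fin k => v0 + ∑ i, vaB (e i) • v i) =
        fun _ => ∑ o : Option (Fin k), coB e o • weB v0 v o := by
      funext _
      rw [Fintype.sum_option]
      simp [coB, weB]
    rw [this, D.map_sum]
    refine Finset.sum_congr rfl fun r _ => ?_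
    rw [D.map_smul_univ]
  simp only [h1, Finset.smul_sum, smul_smul]
  rw [Finset.sum_comm]
  simp only [← Finset.sum_smul]
  refine Finset.sum_of_injOn (fun (σ : Equiv.Perm (Fin k)) (j : Fin k) => some (σ j)) ?_ ?_ ?_ ?_
  · intro σ _ τ _ h
    ext j
    have := congrFun h j
    simp at this
    rw [this]
  · intro _ _; simp
  · intro r _ hr
    have : ∃ i0, ∀ j, r j ≠ some i0 := by
      by_contra hcon
      push Not at hcon
      choose f hf using hcon
      have hinj : Function.Injective f := by
        intro a b hab
        have := hf a
        rw [hab, hf b] at this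
        exact (Option.some.inj this).symm
      have hbij := Finite.injective_iff_bijective.1 hinj
      apply hr
      refine ⟨(Equiv.ofBijective f hbij).symm, by simp, ?_⟩
      funext j
      have := hf ((Equiv.ofBijective f hbij).symm j)
      have h2 : f ((Equiv.ofBijective f hbij).symm j) = j := (Equiv.ofBijective f hbij).apply_symm_apply j
      rw [h2] at this
      exact this.symm
    obtain ⟨i0, h0⟩ := this
    rw [polar_miss r i0 h0, zero_smul]
  · intro σ _
    rw [polar_perm, one_smul]
    rfl

def symD {k : ℕ} (D : ContinuousMultilinearMap ℝ (fun _ : Fin k => E) F) :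
    ContinuousMultilinearMap ℝ (fun _ : Fin k => E) F :=
  ∑ σ : Equiv.Perm (Fin k), D.domDomCongr σ

lemma symD_apply {k : ℕ} (D : ContinuousMultilinearMap ℝ (fun _ : Fin k => E) F) (v : Fin k → E) :
    symD D v = ∑ σ : Equiv.Perm (Fin k), D (fun i => v (σ i)) := by
  simp [symD]

lemma symD_diag {k : ℕ} (D : ContinuousMultilinearMap ℝ (fun _ : Fin k => E) F) (v : E) :
    symD D (fun _ => v) = k.factorial • D (fun _ => v) := by
  simp [symD_apply, Fintype.card_perm]

lemma symD_small {k : ℕ} (D : ContinuousMultilinearMap ℝ (fun _ : Fin k => E) F) {v0 : E} {ρ C : ℝ}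
    (hρ : 0 < ρ) (hD : ∀ w ∈ Metric.ball v0 ρ, ‖D (fun _ => w)‖ ≤ C) (v : Fin k → E)
    (hv : ∀ i, ‖v i‖ ≤ ρ / (k + 1)) : ‖symD D v‖ ≤ 2 ^ k * C := by
  rw [symD_apply, polar D v0 v]
  refine (norm_sum_le _ _).trans ?_
  have : ∀ e ∈ (Finset.univ : Finset (Fin k → Bool)),
      ‖(∏ i, sgB (e i)) • D (fun _ => v0 + ∑ i, vaB (e i) • v i)‖ ≤ C := by
    intro e _
    have h1 : ‖∏ i, sgB (e i)‖ = 1 := by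
      rw [norm_prod]
      refine Finset.prod_eq_one fun i _ => ?_
      cases e i <;> simp [sgB]
    rw [norm_smul, h1, one_mul]
    apply hD
    rw [mem_ball_iff_norm, add_sub_cancel_left]
    have h2 : ∀ i ∈ (Finset.univ : Finset (Fin k)), ‖vaB (e i) • v i‖ ≤ ρ / (k + 1) := by
      intro i _
      refine le_trans ?_ (hv i)
      cases e i <;> simp [vaB]
    refine (norm_sum_le_of_le _ h2).trans_lt ?_
    simp only [Finset.sum_const, Finset.card_univ, Fintype.card_fin, nsmul_eq_mul]
    rw [mul_div_assoc', div_lt_iff₀ (by positivity)]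
    nlinarith
  refine (Finset.sum_le_sum this).trans ?_
  simp

lemma symD_norm {k : ℕ} (D : ContinuousMultilinearMap ℝ (fun _ : Fin k => E) F) {v0 : E} {ρ C : ℝ}
    (hρ : 0 < ρ) (hC : 0 ≤ C) (hD : ∀ w ∈ Metric.ball v0 ρ, ‖D (fun _ => w)‖ ≤ C) :
    ‖symD D‖ ≤ 2 ^ k * C * ((k + 1) / ρ) ^ k := by
  refine ContinuousMultilinearMap.opNorm_le_bound (by positivity) fun v => ?_
  by_cases h : ∃ i, v i = 0
  · obtain ⟨i, hi⟩ := h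
    rw [ContinuousMultilinearMap.map_coord_zero _ i hi, norm_zero]
    positivity
  · push Not at h
    have hp : ∀ i, 0 < ‖v i‖ := fun i => norm_pos_iff.2 (h i)
    have h1 := symD_small D hρ hD (fun i => (ρ / (k + 1) / ‖v i‖) • v i) (by
      intro i
      rw [norm_smul, norm_div, norm_norm, div_mul_cancel₀ _ (hp i).ne', Real.norm_of_nonneg]
      positivity)
    rw [ContinuousMultilinearMap.map_smul_univ, norm_smul, norm_prod] at h1
    have h2 : ∏ i, ‖ρ / (k + 1) / ‖v i‖‖ = (((k + 1) / ρ) ^ k * ∏ i, ‖v i‖)⁻¹ := by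
      rw [mul_inv, ← inv_pow, inv_div, ← Finset.prod_inv_distrib]
      have : ∀ i, ‖ρ / (k + 1) / ‖v i‖‖ = (ρ / (k + 1)) * ‖v i‖⁻¹ := by
        intro i
        rw [Real.norm_of_nonneg (by positivity), div_eq_mul_inv]
      simp only [this, Finset.prod_mul_distrib]
      simp [div_pow]
    have h3 : 0 < ((k + 1) / ρ) ^ k * ∏ i, ‖v i‖ := by
      have : 0 < ∏ i, ‖v i‖ := Finset.prod_pos fun i _ => hp i
      positivity
    rw [h2, inv_mul_le_iff₀ h3] at h1
    linarith
end polar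


section boch
variable {E F : Type*} [NormedAddCommGroup E] [NormedSpace ℝ E] [NormedAddCommGroup F]
  [NormedSpace ℝ F]

lemma line_deriv_eq {f : E → F} {r : ℝ} (hr : 0 < r)
    (hf : ContDiffOn ℝ (⊤ : ℕ∞) f (Metric.ball 0 r)) (v : E) (k : ℕ) :
    iteratedDeriv k (fun s : ℝ => f (s • v)) 0 = iteratedFDeriv ℝ k f 0 (fun _ => v) := by
  let g : ℝ →L[ℝ] E := ContinuousLinearMap.toSpanSingleton ℝ v
  have ho : IsOpen (g ⁻¹' (Metric.ball 0 r)) := Metric.isOpen_ball.preimage g.continuous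
  have h0 : g 0 ∈ Metric.ball (0:E) r := by simp [hr]
  have h1 := g.iteratedFDerivWithin_comp_right hf Metric.isOpen_ball.uniqueDiffOn ho.uniqueDiffOn h0
    (i := k) (by exact_mod_cast le_top)
  rw [iteratedFDerivWithin_of_isOpen k ho h0, iteratedFDerivWithin_of_isOpen k Metric.isOpen_ball h0]
    at h1
  rw [iteratedDeriv_eq_iteratedFDeriv]
  have h2 : (fun s : ℝ => f (s • v)) = f ∘ g := by
    funext s; simp [g]
  rw [h2, h1]
  simp [g]

lemma bochnak [FiniteDimensional ℝ E] [CompleteSpace F] {γ : E → F} {r : ℝ} (hr : 0 < r)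
    (hγ : ContDiffOn ℝ (⊤ : ℕ∞) γ (Metric.ball 0 r))
    (hl : ∀ (v : E) (t : ℝ), t • v ∈ Metric.ball (0:E) r → AnalyticAt ℝ (fun s : ℝ => γ (s • v)) t) :
    AnalyticAt ℝ γ 0 := by
  have := FiniteDimensional.complete ℝ E
  let D : ∀ k, ContinuousMultilinearMap ℝ (fun _ : Fin k => E) F := fun k => iteratedFDeriv ℝ k γ 0
  let A : ℕ → Set E := fun M => {v | ∀ k, ‖D k (fun _ => v)‖ ≤ k.factorial * (M : ℝ) ^ (k + 1)}
  have hAc : ∀ M, IsClosed (A M) := by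
    intro M
    simp only [A, ofPred_forall]
    refine isClosed_iInter fun k => isClosed_le ?_ continuous_const
    exact ((D k).cont.comp (continuous_pi fun _ => continuous_id)).norm
  have hAu : ⋃ M, A M = univ := by
    refine eq_univ_of_forall fun v => ?_
    obtain ⟨p, ρ, hp⟩ := hl v 0 (by simp [hr])
    obtain ⟨C, q, hC, hq, hpb⟩ := p.le_mul_pow_of_radius_pos (hp.r_pos.trans_le hp.r_le)
    obtain ⟨M, hM⟩ := exists_nat_ge (max C q)
    refine mem_iUnion.2 ⟨M, fun k => ?_⟩
    have h1 := hp.factorial_smul 1 k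
    rw [← iteratedDeriv_eq_iteratedFDeriv, line_deriv_eq hr hγ] at h1
    simp only [D]
    rw [← h1, ← Nat.cast_smul_eq_nsmul ℝ, norm_smul]
    have h2 : ‖p k (fun _ => 1)‖ ≤ ‖p k‖ := by
      have := (p k).le_opNorm (fun _ => 1)
      simpa using this
    have h3 : ‖p k (fun _ => 1)‖ ≤ (M : ℝ) ^ (k + 1) := by
      refine h2.trans ((hpb k).trans ?_)
      rw [pow_succ']
      have := le_max_left C q
      have := le_max_right C q
      gcongr <;> linarith
    simp only [Real.norm_natCast]
    gcongr
  obtain ⟨M, v0, hv0⟩ := nonempty_interior_of_iUnion_of_closed hAc hAu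
  obtain ⟨ρ, hρ, hball⟩ := Metric.isOpen_iff.1 isOpen_interior v0 hv0
  have hAM : ∀ w ∈ Metric.ball v0 ρ, ∀ k, ‖D k (fun _ => w)‖ ≤ k.factorial * (M : ℝ) ^ (k + 1) :=
    fun w hw => interior_subset (hball hw)
  let q : FormalMultilinearSeries ℝ E F := fun k =>
    ((k.factorial : ℝ)⁻¹ * (k.factorial : ℝ)⁻¹) • symD (D k)
  let K : ℝ := 2 * M * Real.exp 1 / ρ + 1
  have hK : 0 < K := by positivity
  have hq : ∀ k, ‖q k‖ ≤ (M * Real.exp 1) * K ^ k := by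
    intro k
    have h1 := symD_norm (D k) hρ (by positivity) (fun w hw => hAM w hw k)
    simp only [q]
    rw [norm_smul]
    have hf : (0:ℝ) < k.factorial := by positivity
    have h2 : ((k:ℝ) + 1) ^ k / k.factorial ≤ Real.exp 1 * Real.exp 1 ^ k := by
      have := Real.pow_div_factorial_le_exp ((k:ℝ) + 1) (by positivity) k
      rw [Real.exp_add, mul_comm, ← Real.exp_one_pow] at this
      exact this
    rw [Real.norm_of_nonneg (by positivity)]
    calc _ ≤ ((k.factorial : ℝ)⁻¹ * (k.factorial : ℝ)⁻¹) *
          (2 ^ k * (k.factorial * (M : ℝ) ^ (k + 1)) * ((k + 1) / ρ) ^ k) := by gcongr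
      _ = M * (2 * M / ρ) ^ k * (((k:ℝ) + 1) ^ k / k.factorial) := by
          simp only [div_pow, mul_pow, pow_succ]; field_simp
      _ ≤ M * (2 * M / ρ) ^ k * (Real.exp 1 * Real.exp 1 ^ k) := by gcongr
      _ = (M * Real.exp 1) * (2 * M * Real.exp 1 / ρ) ^ k := by
          simp only [div_pow, mul_pow, pow_succ]; field_simp
      _ ≤ _ := by
          gcongr
          simp [K]
  have hrad : 0 < q.radius := by
    have h1 := q.le_radius_of_bound (M * Real.exp 1) (r := ⟨K⁻¹, by positivity⟩) (by
      intro k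
      change ‖q k‖ * (K⁻¹) ^ k ≤ _
      calc _ ≤ (M * Real.exp 1) * K ^ k * (K⁻¹) ^ k := by gcongr; exact hq k
        _ = _ := by rw [mul_assoc, ← mul_pow, mul_inv_cancel₀ hK.ne', one_pow, mul_one])
    refine lt_of_lt_of_le ?_ h1
    refine ENNReal.coe_pos.2 ?_
    exact inv_pos.2 hK
  have hG := q.hasFPowerSeriesOnBall hrad
  have hGa : AnalyticAt ℝ q.sum 0 := hG.analyticAt
  obtain ⟨ε, hε, hεb⟩ := Metric.eventually_nhds_iff_ball.1 hGa.eventually_analyticAt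
  have hδ : 0 < min r ε := lt_min hr hε
  refine hGa.congr ?_
  refine Metric.eventually_nhds_iff_ball.2 ⟨min r ε, hδ, fun x hx => ?_⟩
  let B : Set ℝ := (fun s : ℝ => s • x) ⁻¹' (Metric.ball 0 (min r ε))
  have hBc : Convex ℝ B := (convex_ball (0:E) _).linear_preimage (LinearMap.toSpanSingleton ℝ E x)
  have h0B : (0:ℝ) ∈ B := by simp [B, hr, hε]
  have hG2 : ∀ s ∈ B, AnalyticAt ℝ (fun s : ℝ => q.sum (s • x)) s := by
    intro s hs
    exact AnalyticAt.fun_comp (g := q.sum) (f := fun s : ℝ => s • x)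
      (hεb _ (Metric.ball_subset_ball (min_le_right _ _) hs)) (analyticAt_id.smul analyticAt_const)
  have hg2 : ∀ s ∈ B, AnalyticAt ℝ (fun s : ℝ => γ (s • x)) s := fun s hs =>
    hl x s (Metric.ball_subset_ball (min_le_left _ _) hs)
  have han : AnalyticOnNhd ℝ (fun s : ℝ => q.sum (s • x) - γ (s • x)) B :=
    fun s hs => (hG2 s hs).sub (hg2 s hs)
  have hev : ∀ᶠ s in 𝓝 (0:ℝ), q.sum (s • x) - γ (s • x) = 0 := by
    rw [← analyticOrderAt_eq_top, ENat.eq_top_iff_forall_ge]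
    intro N
    rw [natCast_le_analyticOrderAt_iff_iteratedDeriv_eq_zero (han 0 h0B)]
    intro i _
    rw [iteratedDeriv_fun_sub (hG2 0 h0B).contDiffAt (hg2 0 h0B).contDiffAt, line_deriv_eq hr hγ,
      line_deriv_eq hε (AnalyticOnNhd.contDiffOn hεb Metric.isOpen_ball.uniqueDiffOn), ← hG.factorial_smul x i, sub_eq_zero]
    simp only [q]
    rw [_root_.smul_apply, symD_diag, ← Nat.cast_smul_eq_nsmul ℝ, ← Nat.cast_smul_eq_nsmul ℝ,
      smul_smul, smul_smul]
    have hf : (i.factorial : ℝ) ≠ 0 := by positivity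
    rw [show (i.factorial : ℝ) * ((i.factorial : ℝ)⁻¹ * (i.factorial : ℝ)⁻¹) * i.factorial = 1 by
      field_simp, one_smul]
  have := han.eqOn_zero_of_preconnected_of_eventuallyEq_zero hBc.isPreconnected h0B hev
  have h1 := this (show (1:ℝ) ∈ B by simpa [B] using hx)
  simpa [sub_eq_zero] using h1
end boch


section fin
variable {E : Type*} [NormedAddCommGroup E] [InnerProductSpace ℝ E] [FiniteDimensional ℝ E]

lemma line_analytic {X V0 : Set E} (hV0 : IsOpen V0)
    (hana : ∀ p ∈ X, ∃ V : Set E, IsOpen V ∧ p ∈ V ∧ ∃ (m : ℕ) (f : Fin m → E → ℝ),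
        (∀ i, AnalyticOnNhd ℝ (f i) V) ∧ X ∩ V = {x ∈ V | ∀ i, f i x = 0})
    (P : E →L[ℝ] E) (hPP : ∀ x, P (P x) = P x) {γ : E → E} (hPγ : ∀ x, P (γ x) = 0)
    (hγP : ∀ x, γ (P x) = γ x) {r : ℝ}
    (hγ : ContDiffOn ℝ (⊤ : ℕ∞) γ (Metric.ball 0 r))
    (hX : ∀ x ∈ V0, x ∈ X ↔ x - P x = γ x) (hmem : ∀ x ∈ Metric.ball (0:E) r, P x + γ x ∈ V0)
    (v : E) (t : ℝ) (ht : t • v ∈ Metric.ball (0:E) r) :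
    AnalyticAt ℝ (fun s : ℝ => γ (s • v)) t := by
  have hPG : ∀ x, P (P x + γ x) = P x := fun x => by rw [map_add, hPP, hPγ, add_zero]
  have hγG : ∀ x, γ (P x + γ x) = γ x := fun x => by rw [← hγP, hPG, hγP]
  have hGX : ∀ x ∈ Metric.ball (0:E) r, P x + γ x ∈ X := fun x hx => by
    rw [hX _ (hmem x hx), hPG, hγG]; simp
  obtain ⟨V, hVo, hpV, m, f, hf, hXV⟩ := hana _ (hGX _ ht)
  let y : ℝ → E := fun s => γ ((t + s) • v) - γ (t • v)
  have hy0 : y 0 = 0 := by simp [y]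
  have hys : ContDiffAt ℝ (⊤ : ℕ∞) y 0 := by
    have h1 : ContDiffAt ℝ (⊤ : ℕ∞) γ (t • v) := hγ.contDiffAt (Metric.isOpen_ball.mem_nhds ht)
    have h2 : ContDiffAt ℝ (⊤ : ℕ∞) (fun s : ℝ => γ ((t + s) • v)) 0 :=
      ContDiffAt.comp (g := γ) (f := fun s : ℝ => (t + s) • v) 0 (by simpa using h1) (by fun_prop)
    exact h2.sub contDiffAt_const
  have hyt : Tendsto y (𝓝 0) (𝓝 0) := by simpa [hy0] using hys.continuousAt.tendsto
  let L : ℝ × E → E := fun q => P ((t + q.1) • v) + q.2 + γ (t • v)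
  have hL0 : L 0 = P (t • v) + γ (t • v) := by simp [L]
  have hLa : ContDiff ℝ ⊤ L := by fun_prop
  let F : ℝ × E → ℝ := fun q => (∑ i, (f i (L q)) ^ 2) + ‖P q.2‖ ^ 2
  have hF : AnalyticAt ℝ F 0 := by
    refine AnalyticAt.add ?_ ?_
    · refine Finset.analyticAt_fun_sum _ fun i _ => AnalyticAt.pow ?_ 2
      exact AnalyticAt.fun_comp (g := f i) (f := L) (by rw [hL0]; exact hf i _ hpV)
        hLa.contDiffAt.analyticAt
    · have : ContDiff ℝ ⊤ (fun q : ℝ × E => ‖P q.2‖ ^ 2) :=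
        (contDiff_norm_sq ℝ).comp (P.contDiff.comp contDiff_snd)
      exact this.contDiffAt.analyticAt
  have hLt : Tendsto L (𝓝 0) (𝓝 (P (t • v) + γ (t • v))) := by
    rw [← hL0]; exact hLa.continuous.tendsto 0
  have hFz : ∀ᶠ q in 𝓝 (0 : ℝ × E), F q = 0 → q.2 = y q.1 := by
    filter_upwards [hLt.eventually (hVo.mem_nhds hpV), hLt.eventually (hV0.mem_nhds (hmem _ ht))]
      with q h1 h2 hq
    have h3 : 0 ≤ ∑ i, (f i (L q)) ^ 2 := Finset.sum_nonneg fun i _ => sq_nonneg _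
    have h4 : 0 ≤ ‖P q.2‖ ^ 2 := sq_nonneg _
    have h5 : ∑ i, (f i (L q)) ^ 2 = 0 := by simp only [F] at hq; linarith
    have h6 : ‖P q.2‖ ^ 2 = 0 := by simp only [F] at hq; linarith
    have h7 : P q.2 = 0 := by simpa using h6
    have h8 : ∀ i, f i (L q) = 0 := by
      intro i
      have := (Finset.sum_eq_zero_iff_of_nonneg (fun i _ => sq_nonneg (f i (L q)))).1 h5 i
        (Finset.mem_univ i)
      simpa using this
    have h9 : L q ∈ X ∩ V := by rw [hXV]; exact ⟨h1, h8⟩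
    have h10 := (hX _ h2).1 h9.1
    have h11 : P (L q) = P ((t + q.1) • v) := by
      simp only [L, map_add, hPP, h7, hPγ]; simp
    rw [← hγP (L q), h11, hγP] at h10
    simp only [y]
    rw [← h10]; simp only [L]; abel
  have hFy : ∀ᶠ s in 𝓝 (0:ℝ), F (s, y s) = 0 := by
    have h1 : Tendsto (fun s : ℝ => (t + s) • v) (𝓝 0) (𝓝 (t • v)) := by
      have : Continuous (fun s : ℝ => (t + s) • v) := by fun_prop
      exact this.tendsto' _ _ (by simp)
    filter_upwards [h1.eventually (Metric.isOpen_ball.mem_nhds ht),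
      (hLt.comp (tendsto_graph hyt)).eventually (hVo.mem_nhds hpV)] with s hs hsV
    have h2 : L (s, y s) = P ((t + s) • v) + γ ((t + s) • v) := by simp only [L, y]; abel
    have h3 : L (s, y s) ∈ X ∩ V := ⟨by rw [h2]; exact hGX _ hs, hsV⟩
    rw [hXV] at h3
    have h4 : P (y s) = 0 := by simp [y, hPγ]
    simp [F, h3.2, h4]
  obtain ⟨Y, hY, hY0, hYF⟩ := curve_lemma_aux _ E rfl F hF y (smooth_appr hys) hy0
    (by
      intro N
      refine (EventuallyEq.trans_isBigO (f₂ := fun _ => (0:ℝ)) hFy ?_)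
      exact isBigO_zero _ _)
    (by
      have c1 : Continuous (fun q : ℝ × (E × E) => (q.1, q.2.1)) := by fun_prop
      have c2 : Continuous (fun q : ℝ × (E × E) => (q.1, q.2.2)) := by fun_prop
      filter_upwards [(c1.tendsto' 0 0 rfl).eventually hFz, (c2.tendsto' 0 0 rfl).eventually hFz]
        with q h1 h2 _ h3 h4
      exact (h1 h3).trans (h2 h4).symm)
  have hYt : Tendsto Y (𝓝 0) (𝓝 0) := by simpa [hY0] using hY.continuousAt.tendsto
  have hya : AnalyticAt ℝ y 0 := by
    refine hY.congr ?_
    filter_upwards [(tendsto_graph hYt).eventually hFz, hYF] with s h1 h2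
    exact h1 h2
  have h1 : AnalyticAt ℝ (fun s => y (s - t) + γ (t • v)) t := by
    refine AnalyticAt.add ?_ analyticAt_const
    exact AnalyticAt.fun_comp (g := y) (f := fun s => s - t) (by simpa using hya)
      (analyticAt_id.sub analyticAt_const)
  simpa [y] using h1

lemma local_inv_smooth {P : Type*} [NormedAddCommGroup P] [NormedSpace ℝ P] [CompleteSpace P]
    {Θ : P → P} {W : Set P} (hW : IsOpen W) (h0W : 0 ∈ W)
    (hΘ : ContDiffOn ℝ (⊤ : ℕ∞) Θ W) (h0 : Θ 0 = 0)
    (hd : HasFDerivAt Θ (ContinuousLinearMap.id ℝ P) 0) :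
    ∃ (Ξ : P → P) (r : ℝ), 0 < r ∧ ContDiffOn ℝ (⊤ : ℕ∞) Ξ (Metric.ball 0 r) ∧ Ξ 0 = 0 ∧
      (∀ᶠ q in 𝓝 0, Θ (Ξ q) = q) ∧ ∀ᶠ q in 𝓝 0, Ξ (Θ q) = q := by
  have hd' : HasFDerivAt Θ ((ContinuousLinearEquiv.refl ℝ P : P ≃L[ℝ] P) : P →L[ℝ] P) 0 := hd
  have hc := hΘ.contDiffAt (hW.mem_nhds h0W)
  have hs := hc.hasStrictFDerivAt' hd' (by simp)
  let e := hs.toOpenPartialHomeomorph Θ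
  have he : ∀ x, e x = Θ x := fun x => rfl
  have h0s : (0:P) ∈ e.source := hs.mem_toOpenPartialHomeomorph_source
  have h0t : (0:P) ∈ e.target := by
    have := e.map_source h0s
    rwa [he, h0] at this
  have hs0 : e.symm 0 = 0 := by
    have := e.left_inv h0s
    rwa [he, h0] at this
  have ht : Tendsto e.symm (𝓝 0) (𝓝 0) := by
    have := e.symm.continuousAt (x := 0) h0t
    simpa [ContinuousAt, hs0] using this
  have hfd : ContinuousAt (fderiv ℝ Θ) 0 :=
    (hc.fderiv_right (m := 0) (by exact_mod_cast le_top)).continuousAt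
  have hinv : ∀ᶠ x in 𝓝 (0:P), fderiv ℝ Θ x ∈ range ((↑) : (P ≃L[ℝ] P) → P →L[ℝ] P) := by
    have h1 := (ContinuousLinearEquiv.nhds (ContinuousLinearEquiv.refl ℝ P))
    have h2 : fderiv ℝ Θ 0 = ((ContinuousLinearEquiv.refl ℝ P : P ≃L[ℝ] P) : P →L[ℝ] P) := hd'.fderiv
    rw [← h2] at h1
    exact hfd h1
  have hsm : ∀ᶠ q in 𝓝 (0:P), ContDiffAt ℝ (⊤ : ℕ∞) e.symm q := by
    filter_upwards [e.open_target.mem_nhds h0t, ht.eventually (hW.mem_nhds h0W),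
      ht.eventually hinv] with q h1 h2 h3
    obtain ⟨A, hA⟩ := h3
    have h4 := hΘ.contDiffAt (hW.mem_nhds h2)
    have h5 : HasFDerivAt e (A : P →L[ℝ] P) (e.symm q) := by
      rw [hA]
      exact (h4.differentiableAt (by simp)).hasFDerivAt
    exact e.contDiffAt_symm h1 h5 h4
  obtain ⟨r, hr, hball⟩ := Metric.eventually_nhds_iff_ball.1 hsm
  refine ⟨e.symm, r, hr, fun x hx => (hball x hx).contDiffWithinAt, hs0, ?_, ?_⟩
  · filter_upwards [e.open_target.mem_nhds h0t] with q hq using e.right_inv hq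
  · filter_upwards [e.open_source.mem_nhds h0s] with q hq using e.left_inv hq
end fin


lemma normal_form {E : Type*} [NormedAddCommGroup E] [NormedSpace ℝ E] [CompleteSpace E]
    {X U W : Set E} {Φ Ψ : E → E} (PM : E →L[ℝ] E) (hPM : ∀ x, PM (PM x) = PM x)
    (hU : IsOpen U) (h0U : 0 ∈ U) (h0X : (0:E) ∈ X) (hW : IsOpen W) (h0W : (0:E) ∈ W)
    (hΦW : IsOpen (Φ '' W)) (hΦ : ContDiffOn ℝ (⊤ : ℕ∞) Φ W) (hinv : InvOn Ψ Φ W (Φ '' W))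
    (hΨ : ContDiffOn ℝ (⊤ : ℕ∞) Ψ (Φ '' W))
    (himg : Φ '' ((X ∩ U) ∩ W) = (Φ '' W) ∩ {x | PM x = x}) :
    ∃ (A : E ≃L[ℝ] E) (γ : E → E) (r : ℝ) (V0 : Set E), 0 < r ∧ IsOpen V0 ∧ (0:E) ∈ V0 ∧
      (∀ x, PM (A (γ x)) = 0) ∧ (∀ x, γ (A.symm (PM (A x))) = γ x) ∧
      ContDiffOn ℝ (⊤ : ℕ∞) γ (Metric.ball 0 r) ∧
      (∀ x ∈ V0, x ∈ X ↔ x - A.symm (PM (A x)) = γ x) ∧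
      (∀ x ∈ Metric.ball (0:E) r, A.symm (PM (A x)) + γ x ∈ V0) := by
  have hΦ0 := hΦ.contDiffAt (hW.mem_nhds h0W)
  have hΨ0 := hΨ.contDiffAt (hΦW.mem_nhds (mem_image_of_mem Φ h0W))
  have hdΦ := (hΦ0.differentiableAt (by simp)).hasFDerivAt
  have hdΨ := (hΨ0.differentiableAt (by simp)).hasFDerivAt
  have hL : (fderiv ℝ Ψ (Φ 0)).comp (fderiv ℝ Φ 0) = ContinuousLinearMap.id ℝ E := by
    have h1 := hdΨ.comp 0 hdΦ
    refine h1.unique ((hasFDerivAt_id (0:E)).congr_of_eventuallyEq ?_)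
    filter_upwards [hW.mem_nhds h0W] with x hx using hinv.1 hx
  have hR : (fderiv ℝ Φ 0).comp (fderiv ℝ Ψ (Φ 0)) = ContinuousLinearMap.id ℝ E := by
    have hdΦ' : HasFDerivAt Φ (fderiv ℝ Φ 0) (Ψ (Φ 0)) := by rw [hinv.1 h0W]; exact hdΦ
    have h1 := hdΦ'.comp (Φ 0) hdΨ
    refine h1.unique ((hasFDerivAt_id (Φ 0)).congr_of_eventuallyEq ?_)
    filter_upwards [hΦW.mem_nhds (mem_image_of_mem Φ h0W)] with x hx using hinv.2 hx
  let A : E ≃L[ℝ] E := ContinuousLinearEquiv.equivOfInverse (fderiv ℝ Φ 0) (fderiv ℝ Ψ (Φ 0))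
    (fun x => congrArg (fun B : E →L[ℝ] E => B x) hL) (fun x => congrArg (fun B : E →L[ℝ] E => B x) hR)
  have hA : HasFDerivAt Φ (A : E →L[ℝ] E) 0 := hdΦ
  let P : E →L[ℝ] E := (A.symm : E →L[ℝ] E).comp (PM.comp (A : E →L[ℝ] E))
  have hP : ∀ x, P x = A.symm (PM (A x)) := fun x => rfl
  have hPP : ∀ x, P (P x) = P x := fun x => by simp [hP, hPM]
  have hPA : ∀ x, PM (A x) = A (P x) := fun x => by simp [hP]
  have hmemS : ∀ x ∈ W, x ∈ U → (x ∈ X ↔ PM (Φ x) = Φ x) := by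
    intro x hx hxU
    constructor
    · intro h
      have : Φ x ∈ Φ '' ((X ∩ U) ∩ W) := ⟨x, ⟨⟨h, hxU⟩, hx⟩, rfl⟩
      rw [himg] at this
      exact this.2
    · intro h
      have : Φ x ∈ Φ '' ((X ∩ U) ∩ W) := by
        rw [himg]; exact ⟨⟨x, hx, rfl⟩, h⟩
      obtain ⟨x', hx', he⟩ := this
      rw [← hinv.1.injOn hx'.2 hx he]
      exact hx'.1.1
  let G : E → E := fun x => P x + (A.symm (Φ x) - P (A.symm (Φ x)))
  have hGP : ∀ x, P (G x) = P x := fun x => by simp [G, hPP]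
  have hG0 : G 0 = 0 := by
    have := (hmemS 0 h0W h0U).1 h0X
    simp [G, hP, this]
  have hGs : ContDiffOn ℝ (⊤ : ℕ∞) G W := by
    have h1 : ContDiffOn ℝ (⊤ : ℕ∞) (fun x => A.symm (Φ x)) W := A.symm.contDiff.comp_contDiffOn hΦ
    exact P.contDiff.contDiffOn.add (h1.sub (P.contDiff.comp_contDiffOn h1))
  have hGd : HasFDerivAt G (ContinuousLinearMap.id ℝ E) 0 := by
    have h1 : HasFDerivAt (fun x => A.symm (Φ x)) (ContinuousLinearMap.id ℝ E) 0 := by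
      have := (A.symm : E →L[ℝ] E).hasFDerivAt.comp 0 hA
      refine this.congr_fderiv ?_
      ext x; simp
    have h2 := P.hasFDerivAt.comp 0 h1
    have h3 := (P.hasFDerivAt (x := 0)).add (h1.sub h2)
    refine h3.congr_fderiv ?_
    ext x; simp
  obtain ⟨Ξ, r, hr, hΞ, hΞ0, hGΞ, hΞG⟩ := local_inv_smooth hW h0W hGs hG0 hGd
  let γ : E → E := fun x => Ξ (P x) - P (Ξ (P x))
  have hγ0 : γ 0 = 0 := by simp [γ, hΞ0]
  have hPt : Tendsto P (𝓝 0) (𝓝 0) := P.continuous.tendsto' 0 0 (map_zero P)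
  have hev : ∀ᶠ x in 𝓝 (0:E), x ∈ X ↔ x - P x = γ x := by
    filter_upwards [hW.mem_nhds h0W, hU.mem_nhds h0U, hΞG, hPt.eventually hGΞ] with x h1 h2 h3 h4
    rw [hmemS x h1 h2]
    have h5 : P (Ξ (P x)) = P x := by rw [← hGP, h4, hPP]
    have h6 : PM (Φ x) = Φ x ↔ G x = P x := by
      simp only [G, add_eq_left, sub_eq_zero]
      rw [hP, A.apply_symm_apply, A.symm.injective.eq_iff, eq_comm]
    rw [h6]
    simp only [γ, h5]
    constructor
    · intro h; rw [← h, h3, h]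
    · intro h
      have : x = Ξ (P x) := sub_left_injective h
      conv_lhs => rw [this]
      exact h4
  obtain ⟨V0, hV0, hV0o, h0V0⟩ := eventually_nhds_iff.1 hev
  have hΞc : ContinuousAt Ξ 0 := (hΞ.contDiffAt (Metric.ball_mem_nhds 0 hr)).continuousAt
  have hγt : Tendsto (fun x => P x + γ x) (𝓝 0) (𝓝 0) := by
    have h1 : Tendsto (fun x => Ξ (P x)) (𝓝 0) (𝓝 0) := by
      have := hΞc.tendsto.comp hPt
      rwa [hΞ0] at this
    have h2 := hPt.add (h1.sub (hPt.comp h1))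
    simpa using h2
  obtain ⟨r', hr', hb⟩ := Metric.eventually_nhds_iff_ball.1
    ((hγt.eventually (hV0o.mem_nhds h0V0)).and (hPt.eventually (Metric.ball_mem_nhds 0 hr)))
  refine ⟨A, γ, r', V0, hr', hV0o, h0V0, ?_, ?_, ?_, hV0, fun x hx => (hb x hx).1⟩
  · intro x
    rw [hPA]; simp [γ, hPP]
  · intro x
    rw [← hP]; simp [γ, hPP]
  · have h1 : ContDiffOn ℝ (⊤ : ℕ∞) (fun x => Ξ (P x)) (Metric.ball 0 r') :=
      hΞ.comp P.contDiff.contDiffOn fun x hx => (hb x hx).2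
    exact h1.sub (P.contDiff.comp_contDiffOn h1)

lemma final_chart {E : Type*} [NormedAddCommGroup E] [NormedSpace ℝ E] [CompleteSpace E]
    {X V0 : Set E} (PM : E →L[ℝ] E) (hPM : ∀ x, PM (PM x) = PM x)
    (A : E ≃L[ℝ] E) (γ : E → E) (hV0 : IsOpen V0) (h0V : (0:E) ∈ V0)
    (h1 : ∀ x, PM (A (γ x)) = 0) (h2 : ∀ x, γ (A.symm (PM (A x))) = γ x)
    (h3 : ∀ x ∈ V0, x ∈ X ↔ x - A.symm (PM (A x)) = γ x) (hγ : AnalyticAt ℝ γ 0) :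
    ∃ (W : Set E) (Φ Ψ : E → E), IsOpen W ∧ (0:E) ∈ W ∧ IsOpen (Φ '' W) ∧ AnalyticOnNhd ℝ Φ W ∧
      InjOn Φ W ∧ InvOn Ψ Φ W (Φ '' W) ∧ AnalyticOnNhd ℝ Ψ (Φ '' W) ∧
      Φ '' (X ∩ W) = Φ '' W ∩ {x | PM x = x} := by
  obtain ⟨r, hr, hb⟩ := Metric.eventually_nhds_iff_ball.1 hγ.eventually_analyticAt
  let P : E →L[ℝ] E := (A.symm : E →L[ℝ] E).comp (PM.comp (A : E →L[ℝ] E))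
  have hP : ∀ x, P x = A.symm (PM (A x)) := fun x => rfl
  have hPA : ∀ x, PM (A x) = A (P x) := fun x => by simp [hP]
  have hPP : ∀ x, P (P x) = P x := fun x => by simp [hP, hPM]
  have hPγ : ∀ x, P (γ x) = 0 := fun x => by simp [hP, h1]
  have hγP : ∀ x, γ (P x) = γ x := h2
  have hγa : ∀ x, P x ∈ Metric.ball 0 r → AnalyticAt ℝ γ x := by
    intro x hx
    have : AnalyticAt ℝ (fun x => γ (P x)) x := (hb _ hx).fun_comp (P.analyticAt x)
    simpa only [hγP] using this
  let Φ : E → E := fun x => A (x - γ x)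
  let Ψ : E → E := fun z => A.symm z + γ (A.symm z)
  have hΨΦ : ∀ x, Ψ (Φ x) = x := by
    intro x
    have : γ (x - γ x) = γ x := by rw [← hγP, map_sub, hPγ, sub_zero, hγP]
    simp [Φ, Ψ, this]
  have hΦΨ : ∀ x, Φ (Ψ x) = x := by
    intro x
    have : γ (A.symm x + γ (A.symm x)) = γ (A.symm x) := by
      rw [← hγP, map_add, hPγ, add_zero, hγP]
    simp [Φ, Ψ, this]
  let B : Set E := P ⁻¹' Metric.ball 0 r
  have hB : IsOpen B := Metric.isOpen_ball.preimage P.continuous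
  let W : Set E := B ∩ V0
  let Y : Set E := A.symm ⁻¹' B
  have hY : IsOpen Y := hB.preimage A.symm.continuous
  have hΨa : AnalyticOnNhd ℝ Ψ Y := by
    intro z hz
    have e1 := (A.symm : E →L[ℝ] E).analyticAt z
    exact e1.add ((hγa _ hz).fun_comp e1)
  have hPΨ : ∀ z, P (Ψ z) = P (A.symm z) := fun z => by simp [Ψ, hPγ]
  have himg : Φ '' W = Y ∩ Ψ ⁻¹' V0 := by
    ext z
    constructor
    · rintro ⟨x, hx, rfl⟩
      refine ⟨?_, by simpa [hΨΦ] using hx.2⟩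
      change P (A.symm (Φ x)) ∈ Metric.ball 0 r
      rw [← hPΨ, hΨΦ]; exact hx.1
    · rintro ⟨hz1, hz2⟩
      refine ⟨Ψ z, ⟨?_, hz2⟩, hΦΨ z⟩
      change P (Ψ z) ∈ Metric.ball 0 r
      rw [hPΨ]; exact hz1
  refine ⟨W, Φ, Ψ, hB.inter hV0, ⟨by simp [B, hr], h0V⟩, ?_, ?_, ?_, ?_, ?_, ?_⟩
  · rw [himg]
    exact hΨa.continuousOn.isOpen_inter_preimage hY hV0
  · intro x hx
    exact ((A : E →L[ℝ] E).analyticAt _).fun_comp (analyticAt_id.sub (hγa x hx.1))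
  · exact (Function.LeftInverse.injective hΨΦ).injOn
  · exact ⟨fun x _ => hΨΦ x, fun x _ => hΦΨ x⟩
  · rw [himg]; exact hΨa.mono inter_subset_left
  · have key : ∀ x ∈ W, x ∈ X ↔ PM (Φ x) = Φ x := by
      intro x hx
      rw [h3 x hx.2, ← hP, hPA, A.injective.eq_iff, map_sub, hPγ, sub_zero, sub_eq_iff_eq_add,
        eq_sub_iff_add_eq, eq_comm, add_comm]
    ext z
    constructor
    · rintro ⟨x, hx, rfl⟩
      exact ⟨⟨x, hx.2, rfl⟩, (key x hx.2).1 hx.1⟩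
    · rintro ⟨⟨x, hx, rfl⟩, hz⟩
      exact ⟨x, ⟨(key x hx).2 hz, hx⟩, rfl⟩

lemma coordProj_exists (n d : ℕ) : ∃ PM : EuclideanSpace ℝ (Fin n) →L[ℝ] EuclideanSpace ℝ (Fin n),
    (∀ x, PM (PM x) = PM x) ∧
      {x | PM x = x} = {x : EuclideanSpace ℝ (Fin n) | ∀ i : Fin n, d ≤ (i : ℕ) → x i = 0} := by
  let L : EuclideanSpace ℝ (Fin n) →ₗ[ℝ] EuclideanSpace ℝ (Fin n) :=
    { toFun := fun x => WithLp.toLp 2 (fun i : Fin n => if (i : ℕ) < d then x i else 0)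
      map_add' := by
        intro x z
        ext i
        by_cases h : (i : ℕ) < d <;> simp [h]
      map_smul' := by
        intro c x
        ext i
        by_cases h : (i : ℕ) < d <;> simp [h] }
  have hL : ∀ x i, LinearMap.toContinuousLinearMap L x i = if (i : ℕ) < d then x i else 0 :=
    fun x i => rfl
  refine ⟨LinearMap.toContinuousLinearMap L, ?_, ?_⟩
  · intro x
    ext i
    rw [hL (LinearMap.toContinuousLinearMap L x) i, hL x i]
    split_ifs <;> rfl
  · ext x
    constructor
    · intro h i hi
      have h : LinearMap.toContinuousLinearMap L x = x := h
      rw [← h, hL, if_neg (by omega)]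
    · intro h
      change LinearMap.toContinuousLinearMap L x = x
      ext i
      rw [hL]
      by_cases hi : (i : ℕ) < d
      · rw [if_pos hi]
      · rw [if_neg hi, h i (by omega)]

/-- A real analytic subset `X` of an open set `Ω ⊆ ℝⁿ` containing `0`
(locally the common zero set of finitely many real analytic functions) is `C^∞`
regular at `0` if and only if it is `C^ω` regular at `0`. -/
theorem stmt8 {n : ℕ} (Ω X : Set (EuclideanSpace ℝ (Fin n)))
    (hΩ : IsOpen Ω) (h0Ω : (0 : EuclideanSpace ℝ (Fin n)) ∈ Ω)
    (hXΩ : X ⊆ Ω) (h0X : (0 : EuclideanSpace ℝ (Fin n)) ∈ X)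
    (hana : ∀ p ∈ Ω, ∃ V : Set (EuclideanSpace ℝ (Fin n)),
      IsOpen V ∧ p ∈ V ∧ V ⊆ Ω ∧
      ∃ (m : ℕ) (f : Fin m → EuclideanSpace ℝ (Fin n) → ℝ),
        (∀ i, AnalyticOnNhd ℝ (f i) V) ∧
        X ∩ V = {x ∈ V | ∀ i, f i x = 0}) :
    IsSmoothRegularAtZero X ↔ IsAnalyticRegularAtZero X := by
  constructor
  · rintro ⟨U, hU, h0U, d, hS⟩
    obtain ⟨W, Φ, hW, h0W, hΦW, hΦ, ⟨Ψ, hinv, hΨ⟩, himg⟩ := hS 0 ⟨h0X, h0U⟩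
    obtain ⟨PM, hPM, hPMs⟩ := coordProj_exists n d
    rw [← hPMs] at himg
    obtain ⟨A, γ, r, V0, hr, hV0, h0V0, h1, h2, hγ, h3, h4⟩ :=
      normal_form PM hPM hU h0U h0X hW h0W hΦW hΦ hinv hΨ himg
    have hγa : AnalyticAt ℝ γ 0 := by
      refine bochnak hr hγ fun v t ht => ?_
      refine line_analytic (X := X) hV0 ?_
        ((A.symm : EuclideanSpace ℝ (Fin n) →L[ℝ] EuclideanSpace ℝ (Fin n)).comp
          (PM.comp (A : EuclideanSpace ℝ (Fin n) →L[ℝ] EuclideanSpace ℝ (Fin n))))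
        ?_ ?_ h2 hγ h3 h4 v t ht
      · intro p hp
        obtain ⟨V, a, b, _, c⟩ := hana p (hXΩ hp)
        exact ⟨V, a, b, c⟩
      · intro x; simp [hPM]
      · intro x; simp [h1]
    obtain ⟨W', Φ', Ψ', hW', h0W', hi, ha, hinj, hinv', ha', himg'⟩ :=
      final_chart PM hPM A γ hV0 h0V0 h1 h2 h3 hγa
    refine ⟨W', hW', h0W', d, fun p hp => ⟨W', Φ', hW', hp.2, hi, ha, hinj, ⟨Ψ', hinv', ha'⟩, ?_⟩⟩
    rw [← hPMs, ← himg', inter_assoc, inter_self]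
  · rintro ⟨U, hU, h0U, d, hS⟩
    refine ⟨U, hU, h0U, d, fun p hp => ?_⟩
    obtain ⟨W, Φ, hW, h0W, hΦW, hΦ, _, ⟨Ψ, hinv, hΨ⟩, himg⟩ := hS p hp
    exact ⟨W, Φ, hW, h0W, hΦW, hΦ.contDiffOn hW.uniqueDiffOn,
      ⟨Ψ, hinv, hΨ.contDiffOn hΦW.uniqueDiffOn⟩, himg⟩
end

section
/- Let X = {(x,y) ∈ ℝ² : y = 0} and Y = {(x,y) ∈ ℝ² : y² = x³}. Then there is no blow-spherical homeomorphism from (X,0) to (Y,0), even though X and Y are homeomorphic (Y is a topological submanifold of ℝ²). -/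
open Filter Set Topology

/-- The line `X = {(x,y) ∈ ℝ² : y = 0}`. -/
def lineSet : Set (EuclideanSpace ℝ (Fin 2)) := {p | p 1 = 0}

theorem cusp_nonneg {y : EuclideanSpace ℝ (Fin 2)} (hy : y ∈ cuspSet) : 0 ≤ y 0 := by
  have h : (y 1) ^ 2 = (y 0) ^ 3 := hy
  by_contra hn
  have := Odd.pow_neg (n := 3) (by decide) (not_le.mp hn)
  nlinarith [sq_nonneg (y 1)]

theorem cusp_homeo : Nonempty (↥lineSet ≃ₜ ↥cuspSet) := by
  refine ⟨⟨⟨fun p => ⟨!₂[((p.1 0) ^ 2) ^ (1/3 : ℝ), p.1 0], ?_⟩,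
    fun q => ⟨!₂[q.1 1, 0], ?_⟩, ?_, ?_⟩, ?_, ?_⟩⟩
  · change (p.1 0) ^ 2 = (((p.1 0) ^ 2) ^ (1/3 : ℝ)) ^ 3
    rw [← Real.rpow_natCast _ 3, ← Real.rpow_mul (sq_nonneg _)]
    norm_num
  · change (0 : ℝ) = 0
    rfl
  · rintro ⟨p, hp⟩
    have h : p 1 = 0 := hp
    apply Subtype.ext
    ext i
    fin_cases i <;> simp [h]
  · rintro ⟨q, hq⟩
    have h : (q 1) ^ 2 = (q 0) ^ 3 := hq
    have h0 := cusp_nonneg hq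
    apply Subtype.ext
    ext i
    fin_cases i
    · change ((q 1) ^ 2) ^ (1/3 : ℝ) = q 0
      rw [h, ← Real.rpow_natCast, ← Real.rpow_mul h0]
      norm_num
    · rfl
  · refine Continuous.subtype_mk ?_ _
    refine (PiLp.continuous_toLp 2 _).comp (continuous_pi fun i => ?_)
    fin_cases i
    · have : Continuous fun p : lineSet => (p.1 0) ^ 2 := by fun_prop
      exact this.rpow_const (fun _ => Or.inr (by norm_num))
    · change Continuous fun p : lineSet => p.1 0
      fun_prop
  · refine Continuous.subtype_mk ?_ _
    refine (PiLp.continuous_toLp 2 _).comp (continuous_pi fun i => ?_)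
    fin_cases i
    · change Continuous fun p : cuspSet => p.1 1
      fun_prop
    · exact continuous_const

theorem cusp_est {y : EuclideanSpace ℝ (Fin 2)} (hy : y ∈ cuspSet) (hy0 : y ≠ 0) :
    ‖‖y‖⁻¹ • y - !₂[1, 0]‖ ^ 2 ≤ 2 * ‖y‖ := by
  have h : (y 1) ^ 2 = (y 0) ^ 3 := hy
  have h0 := cusp_nonneg hy
  have hN : 0 < ‖y‖ := norm_pos_iff.mpr hy0
  have hs : ‖y‖ ^ 2 = (y 0) ^ 2 + (y 1) ^ 2 := by
    rw [EuclideanSpace.real_norm_sq_eq, Fin.sum_univ_two]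
  rw [EuclideanSpace.real_norm_sq_eq, Fin.sum_univ_two]
  simp only [PiLp.sub_apply, PiLp.smul_apply, smul_eq_mul]
  change (‖y‖⁻¹ * y 0 - 1) ^ 2 + (‖y‖⁻¹ * y 1 - 0) ^ 2 ≤ _
  generalize ‖y‖ = N at *
  generalize y 0 = a at *
  generalize y 1 = b at *
  have haN : a ≤ N := by nlinarith [sq_nonneg b]
  have e : (N⁻¹ * a - 1) ^ 2 + (N⁻¹ * b - 0) ^ 2 = 2 * (N - a) / N := by
    field_simp
    nlinarith
  rw [e, div_le_iff₀ hN]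
  have h1 : (N - a) * N ≤ a ^ 3 := by nlinarith
  have h2 : a ^ 3 ≤ N ^ 3 := pow_le_pow_left₀ h0 haN 3
  nlinarith [pow_pos hN 2]

theorem cusp_tendsto {y : ℕ → EuclideanSpace ℝ (Fin 2)}
    (hy : ∀ᶠ n in atTop, y n ∈ cuspSet ∧ y n ≠ 0) (h : Tendsto y atTop (𝓝 0)) :
    Tendsto (fun n => sphBlowup (y n)) atTop (𝓝 (!₂[1, 0], 0)) := by
  have hn : Tendsto (fun n => ‖y n‖) atTop (𝓝 0) := by simpa using h.norm
  refine Tendsto.prodMk_nhds ?_ hn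
  rw [tendsto_iff_norm_sub_tendsto_zero]
  have h2 : Tendsto (fun n => √(2 * ‖y n‖)) atTop (𝓝 0) := by
    simpa using (hn.const_mul 2).sqrt
  refine squeeze_zero' (Eventually.of_forall fun _ => norm_nonneg _) ?_ h2
  filter_upwards [hy] with n hn
  exact Real.le_sqrt_of_sq_le (cusp_est hn.1 hn.2)

theorem line_limit {U V : Set (EuclideanSpace ℝ (Fin 2))} (hU : IsOpen U)
    (h0U : (0 : EuclideanSpace ℝ (Fin 2)) ∈ U)
    {φ : EuclideanSpace ℝ (Fin 2) → EuclideanSpace ℝ (Fin 2)}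
    (h0 : φ 0 = 0) (hb : Set.BijOn φ (lineSet ∩ U) (cuspSet ∩ V))
    (hc : ContinuousOn φ (lineSet ∩ U))
    {Φ : EuclideanSpace ℝ (Fin 2) × ℝ → EuclideanSpace ℝ (Fin 2) × ℝ}
    (hΦ : ContinuousOn Φ (strictTransform (lineSet ∩ U)))
    (hext : ∀ x ∈ (lineSet ∩ U) \ {0}, Φ (sphBlowup x) = sphBlowup (φ x))
    (v : EuclideanSpace ℝ (Fin 2)) (hv : v ∈ lineSet) (hv1 : ‖v‖ = 1) :
    (v, (0 : ℝ)) ∈ strictTransform (lineSet ∩ U) ∧ Φ (v, 0) = (!₂[1, 0], 0) := by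
  have hv' : v 1 = 0 := hv
  have hv0 : v ≠ 0 := by
    rintro rfl
    simp at hv1
  have ht : Tendsto (fun n : ℕ => (1 / ((n : ℝ) + 1))) atTop (𝓝 0) :=
    tendsto_one_div_add_atTop_nhds_zero_nat
  have hx : Tendsto (fun n : ℕ => (1 / ((n : ℝ) + 1)) • v) atTop (𝓝 0) := by
    simpa using ht.smul_const v
  have hpos : ∀ n : ℕ, 0 < 1 / ((n : ℝ) + 1) := fun n => by positivity
  have hmem : ∀ᶠ n : ℕ in atTop, (1 / ((n : ℝ) + 1)) • v ∈ (lineSet ∩ U) \ {0} := by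
    filter_upwards [hx (hU.mem_nhds h0U)] with n hn
    refine ⟨⟨?_, hn⟩, ?_⟩
    · change ((1 / ((n : ℝ) + 1)) • v) 1 = 0
      simp [hv']
    · exact smul_ne_zero (hpos n).ne' hv0
  have hbl : ∀ n : ℕ, sphBlowup ((1 / ((n : ℝ) + 1)) • v) = (v, 1 / ((n : ℝ) + 1)) := by
    intro n
    have hn : ‖(1 / ((n : ℝ) + 1)) • v‖ = 1 / ((n : ℝ) + 1) := by
      rw [norm_smul, hv1, mul_one, Real.norm_of_nonneg (hpos n).le]
    unfold sphBlowup
    rw [hn, smul_smul, inv_mul_cancel₀ (hpos n).ne', one_smul]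
  have hlim : Tendsto (fun n : ℕ => sphBlowup ((1 / ((n : ℝ) + 1)) • v)) atTop
      (𝓝 (v, 0)) := by
    simp only [hbl]
    exact tendsto_const_nhds.prodMk_nhds ht
  have hin : ∀ᶠ n : ℕ in atTop, sphBlowup ((1 / ((n : ℝ) + 1)) • v) ∈
      sphBlowup '' ((lineSet ∩ U) \ {0}) := hmem.mono fun n hn => mem_image_of_mem _ hn
  have hcl : (v, (0 : ℝ)) ∈ strictTransform (lineSet ∩ U) := mem_closure_of_tendsto hlim hin
  refine ⟨hcl, ?_⟩
  have l1 := (hΦ _ hcl).tendsto.comp (tendsto_nhdsWithin_iff.mpr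
    ⟨hlim, hin.mono fun n hn => subset_closure hn⟩)
  have hl0 : (0 : EuclideanSpace ℝ (Fin 2)) ∈ lineSet ∩ U := ⟨rfl, h0U⟩
  have l2 := (hc _ hl0).tendsto.comp (tendsto_nhdsWithin_iff.mpr
    ⟨hx, hmem.mono fun n hn => hn.1⟩)
  rw [h0] at l2
  have l3 := cusp_tendsto (hmem.mono fun n hn => ⟨(hb.mapsTo hn.1).1, fun h =>
    hn.2 (hb.injOn hn.1 hl0 (h.trans h0.symm))⟩) l2
  refine tendsto_nhds_unique (l1.congr' ?_) l3
  filter_upwards [hmem] with n hn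
  exact hext _ hn

/-- The line `X = {y = 0}` and the cusp `Y = {y² = x³}` are
homeomorphic, but there is no blow-spherical homeomorphism from `(X,0)` to `(Y,0)`. -/
theorem stmt10 :
    Nonempty (↥lineSet ≃ₜ ↥cuspSet) ∧
    ¬ ∃ (U V : Set (EuclideanSpace ℝ (Fin 2))),
        IsOpen U ∧ (0 : EuclideanSpace ℝ (Fin 2)) ∈ U ∧
        IsOpen V ∧ (0 : EuclideanSpace ℝ (Fin 2)) ∈ V ∧
        ∃ φ : EuclideanSpace ℝ (Fin 2) → EuclideanSpace ℝ (Fin 2),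
          IsBlowSphericalHomeo (lineSet ∩ U) (cuspSet ∩ V) φ := by
  refine ⟨cusp_homeo, ?_⟩
  rintro ⟨U, V, hU, h0U, -, -, φ, h0, hb, hc, -, Φ, hΦb, hΦ, -, hext⟩
  have key := line_limit hU h0U h0 hb hc hΦ hext
  have hv1 : ‖(!₂[1, 0] : EuclideanSpace ℝ (Fin 2))‖ = 1 := by
    simp [EuclideanSpace.norm_eq]
  obtain ⟨m1, e1⟩ := key !₂[1, 0] rfl hv1
  obtain ⟨m2, e2⟩ := key (-!₂[1, 0]) (by simp [lineSet]) (by rw [norm_neg, hv1])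
  have h := congrArg (fun p : EuclideanSpace ℝ (Fin 2) × ℝ => p.1 0)
    (hΦb.injOn m1 m2 (e1.trans e2.symm))
  simp at h
  norm_num at h
end
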